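/- arXiv:1908.01199 — 2 statements merged into one kernel-verified Lean document; each statement's English description precedes it below -/
import Mathlib

section
/- Let λ be a partition of n with boxes enumerated as (r_1,c_1),…,(r_n,c_n) (row and column coordinates, both starting at 1). Work in the field F = ℚ(s,q) of rational functions in two variables s, q, set ħ = s², and in the field F(a) set t_1 = a s^{−1}, t_2 = a^{−1} s^{−1}, and x_i = t_1^{1−c_i} t_2^{1−r_i} for 1 ≤ i ≤ n. For d ∈ ℕ^n define c_d(a) = ∏_{i=1}^n (ħ x_i;q)_{d_i}/(q x_i;q)_{d_i} · ∏_{i,j=1}^n [(ħ t_1 x_i/x_j;q)_{d_i−d_j}/(q t_1 x_i/x_j;q)_{d_i−d_j}] · [(q x_i/x_j;q)_{d_i−d_j}/(ħ x_i/x_j;q)_{d_i−d_j}] ∈ F(a). Then for every D ∈ ℕ, the rational function ∑_{d ∈ ℕ^n, d_1+⋯+d_n = D} c_d(a) is regular at a = 0 (it has no pole at a = 0). -/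
/-- The `q`-Pochhammer symbol `(a;q)_n` for an integer index `n`. -/
noncomputable def qPoch {K : Type*} [Field K] (q a : K) (n : ℤ) : K :=
  if 0 ≤ n then ∏ j ∈ Finset.range n.toNat, (1 - a * q ^ j)
  else (∏ j ∈ Finset.range (-n).toNat, (1 - a * (q ^ (j + 1))⁻¹))⁻¹

/-- The field `F = ℚ(s,q)`, realized as `ℚ(s)(q)`: the inner variable is `s`,
the outer variable is `q`. -/
noncomputable abbrev Fsq : Type := RatFunc (RatFunc ℚ)

/-- The field `F(a)` of rational functions in `a` over `F = ℚ(s,q)`. -/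
noncomputable abbrev FsqA : Type := RatFunc Fsq

/-- The variable `a` in `F(a)`. -/
noncomputable def aVar : FsqA := RatFunc.X

/-- The variable `q` in `F(a)`. -/
noncomputable def qVar : FsqA := algebraMap Fsq FsqA RatFunc.X

/-- The variable `s` (a square root of `ħ`) in `F(a)`. -/
noncomputable def sVar : FsqA := algebraMap Fsq FsqA (algebraMap (RatFunc ℚ) Fsq RatFunc.X)

/-- `ħ = s²`. -/
noncomputable def hVar : FsqA := sVar ^ 2

/-- `t₁ = a s⁻¹`. -/
noncomputable def t1Var : FsqA := aVar * sVar⁻¹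

/-- `t₂ = a⁻¹ s⁻¹`. -/
noncomputable def t2Var : FsqA := aVar⁻¹ * sVar⁻¹

/-- The restriction `xᵢ = t₁^{1-cᵢ} t₂^{1-rᵢ}` of the Grothendieck roots to the fixed
point whose `i`-th box has (row, column) coordinates `box i = (rᵢ, cᵢ)`. -/
noncomputable def xVar {n : ℕ} (box : Fin n → ℕ × ℕ) (i : Fin n) : FsqA :=
  t1Var ^ ((1 : ℤ) - ((box i).2 : ℤ)) * t2Var ^ ((1 : ℤ) - ((box i).1 : ℤ))

/-- The coefficient `c_d(a)` of `z^{d₁+⋯+d_n}` in the vertex function of the Hilbert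
scheme of `n` points in `ℂ²` at the fixed point `λ`, with boxes enumerated by `box`. -/
noncomputable def hilbCoeff {n : ℕ} (box : Fin n → ℕ × ℕ) (d : Fin n → ℕ) : FsqA :=
  (∏ i : Fin n, qPoch qVar (hVar * xVar box i) (d i) / qPoch qVar (qVar * xVar box i) (d i)) *
  ∏ i : Fin n, ∏ j : Fin n,
    (qPoch qVar (hVar * t1Var * xVar box i / xVar box j) ((d i : ℤ) - (d j : ℤ)) /
      qPoch qVar (qVar * t1Var * xVar box i / xVar box j) ((d i : ℤ) - (d j : ℤ))) *
    (qPoch qVar (qVar * xVar box i / xVar box j) ((d i : ℤ) - (d j : ℤ)) /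
      qPoch qVar (hVar * xVar box i / xVar box j) ((d i : ℤ) - (d j : ℤ)))

section Regularity

variable {K : Type*} [Field K]

/-- The subring of rational functions that are regular at `0`. -/
def regularAtZero (K : Type*) [Field K] : Subring (RatFunc K) where
  carrier := {f | Polynomial.eval 0 (RatFunc.denom f) ≠ 0}
  mul_mem' {f g} hf hg h := by
    have h' := Polynomial.eval_dvd (x := (0 : K)) (RatFunc.denom_mul_dvd f g)
    rw [h, zero_dvd_iff, Polynomial.eval_mul] at h'
    exact mul_ne_zero hf hg h'
  one_mem' := by simp
  add_mem' {f g} hf hg h := by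
    have h' := Polynomial.eval_dvd (x := (0 : K)) (RatFunc.denom_add_dvd f g)
    rw [h, zero_dvd_iff, Polynomial.eval_mul] at h'
    exact mul_ne_zero hf hg h'
  zero_mem' := by simp
  neg_mem' {f} hf h := by
    have h' := Polynomial.eval_dvd (x := (0 : K)) (RatFunc.denom_mul_dvd (RatFunc.C (-1)) f)
    rw [map_neg, map_one, neg_one_mul, h, zero_dvd_iff, Polynomial.eval_mul, ← map_one RatFunc.C,
      ← map_neg, RatFunc.denom_C, Polynomial.eval_one, one_mul] at h'
    exact hf h'

lemma mem_regularAtZero {f : RatFunc K} :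
    f ∈ regularAtZero K ↔ Polynomial.eval 0 (RatFunc.denom f) ≠ 0 := Iff.rfl

lemma div_mem_regularAtZero (p : Polynomial K) {r : Polynomial K}
    (hr : Polynomial.eval 0 r ≠ 0) :
    algebraMap _ (RatFunc K) p / algebraMap _ (RatFunc K) r ∈ regularAtZero K := by
  intro h
  have h' := Polynomial.eval_dvd (x := (0 : K)) (RatFunc.denom_div_dvd p r)
  rw [h, zero_dvd_iff] at h'
  exact hr h'

lemma C_mem_regularAtZero (c : K) : RatFunc.C c ∈ regularAtZero K := by
  simp [mem_regularAtZero]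

lemma one_sub_div_one_sub_mem_regularAtZero (α : K) {β : K} (hβ : β ≠ 0) (k : ℤ) :
    (1 - RatFunc.C α * RatFunc.X ^ k) / (1 - RatFunc.C β * RatFunc.X ^ k) ∈ regularAtZero K := by
  have hX : (RatFunc.X : RatFunc K) ≠ 0 := RatFunc.X_ne_zero
  obtain ⟨m, rfl | rfl⟩ := k.eq_nat_or_neg
  · rcases Nat.eq_zero_or_pos m with rfl | hm
    · convert C_mem_regularAtZero ((1 - α) / (1 - β)) using 1
      simp [map_div₀]
    · convert div_mem_regularAtZero (1 - Polynomial.C α * Polynomial.X ^ m)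
        (r := 1 - Polynomial.C β * Polynomial.X ^ m) (by simp [hm.ne']) using 1
      simp
  · rcases Nat.eq_zero_or_pos m with rfl | hm
    · convert C_mem_regularAtZero ((1 - α) / (1 - β)) using 1
      simp [map_div₀]
    · convert div_mem_regularAtZero (Polynomial.X ^ m - Polynomial.C α)
        (r := Polynomial.X ^ m - Polynomial.C β) (by simp [hm.ne', hβ]) using 1
      have h (γ : K) : algebraMap _ (RatFunc K) (Polynomial.X ^ m - Polynomial.C γ) =
          RatFunc.X ^ m * (1 - RatFunc.C γ * RatFunc.X ^ (-(m : ℤ))) := by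
        simp only [map_sub, map_pow, RatFunc.algebraMap_X, RatFunc.algebraMap_C, zpow_neg,
          zpow_natCast]
        field_simp
      rw [h, h, mul_div_mul_left _ _ (pow_ne_zero m hX)]

/-- Nonzero scalar multiples of integer powers of the variable. -/
def IsLaurentMonomial (u : RatFunc K) : Prop :=
  ∃ c : K, c ≠ 0 ∧ ∃ k : ℤ, u = RatFunc.C c * RatFunc.X ^ k

namespace IsLaurentMonomial

lemma of_C {c : K} (hc : c ≠ 0) : IsLaurentMonomial (RatFunc.C c) :=
  ⟨c, hc, 0, by simp⟩

lemma of_X : IsLaurentMonomial (RatFunc.X : RatFunc K) :=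
  ⟨1, one_ne_zero, 1, by simp⟩

lemma mul {u v : RatFunc K} (hu : IsLaurentMonomial u) (hv : IsLaurentMonomial v) :
    IsLaurentMonomial (u * v) := by
  obtain ⟨c, hc, k, rfl⟩ := hu
  obtain ⟨e, he, l, rfl⟩ := hv
  refine ⟨c * e, mul_ne_zero hc he, k + l, ?_⟩
  rw [map_mul, zpow_add₀ RatFunc.X_ne_zero]
  ring

lemma zpow {u : RatFunc K} (hu : IsLaurentMonomial u) (m : ℤ) : IsLaurentMonomial (u ^ m) := by
  obtain ⟨c, hc, k, rfl⟩ := hu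
  exact ⟨c ^ m, zpow_ne_zero m hc, k * m, by rw [map_zpow₀, mul_zpow, zpow_mul]⟩

lemma inv {u : RatFunc K} (hu : IsLaurentMonomial u) : IsLaurentMonomial u⁻¹ := by
  simpa using hu.zpow (-1)

lemma div {u v : RatFunc K} (hu : IsLaurentMonomial u) (hv : IsLaurentMonomial v) :
    IsLaurentMonomial (u / v) := by
  simpa only [div_eq_mul_inv] using hu.mul hv.inv

end IsLaurentMonomial

lemma qPoch_div_qPoch_mem_regularAtZero {p α β : K} (hp : p ≠ 0) (hα : α ≠ 0) (hβ : β ≠ 0)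
    {u : RatFunc K} (hu : IsLaurentMonomial u) (m : ℤ) :
    qPoch (RatFunc.C p) (RatFunc.C α * u) m / qPoch (RatFunc.C p) (RatFunc.C β * u) m ∈
      regularAtZero K := by
  obtain ⟨c, hc, k, rfl⟩ := hu
  have key {γ δ e : K} (hδ : δ ≠ 0) (he : e ≠ 0) :
      (1 - RatFunc.C γ * (RatFunc.C c * RatFunc.X ^ k) * RatFunc.C e) /
        (1 - RatFunc.C δ * (RatFunc.C c * RatFunc.X ^ k) * RatFunc.C e) ∈ regularAtZero K := by
    convert one_sub_div_one_sub_mem_regularAtZero (γ * c * e)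
      (mul_ne_zero (mul_ne_zero hδ hc) he) k using 3 <;> simp only [map_mul] <;> ring
  unfold qPoch
  split_ifs
  · rw [← Finset.prod_div_distrib]
    refine Subring.prod_mem _ fun j _ => ?_
    rw [← map_pow]
    exact key hβ (pow_ne_zero j hp)
  · rw [inv_div_inv, ← Finset.prod_div_distrib]
    refine Subring.prod_mem _ fun j _ => ?_
    rw [← map_pow, ← map_inv₀]
    exact key hα (inv_ne_zero (pow_ne_zero _ hp))

end Regularity

lemma qVar_eq_C : qVar = RatFunc.C (RatFunc.X : Fsq) := rfl

lemma sVar_eq_C : sVar = RatFunc.C (RatFunc.C RatFunc.X : Fsq) := rfl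

lemma hVar_eq_C : hVar = RatFunc.C ((RatFunc.C RatFunc.X : Fsq) ^ 2) := by
  rw [hVar, sVar_eq_C, map_pow]

lemma C_X_ne_zero : (RatFunc.C RatFunc.X : Fsq) ≠ 0 :=
  (map_ne_zero _).2 RatFunc.X_ne_zero

lemma isLaurentMonomial_sVar : IsLaurentMonomial sVar :=
  sVar_eq_C ▸ .of_C C_X_ne_zero

lemma isLaurentMonomial_t1Var : IsLaurentMonomial t1Var :=
  .mul .of_X isLaurentMonomial_sVar.inv

lemma isLaurentMonomial_t2Var : IsLaurentMonomial t2Var :=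
  .mul (.inv .of_X) isLaurentMonomial_sVar.inv

lemma isLaurentMonomial_xVar {n : ℕ} (box : Fin n → ℕ × ℕ) (i : Fin n) :
    IsLaurentMonomial (xVar box i) :=
  (isLaurentMonomial_t1Var.zpow _).mul (isLaurentMonomial_t2Var.zpow _)

lemma hilbCoeff_mem_regularAtZero {n : ℕ} (box : Fin n → ℕ × ℕ) (d : Fin n → ℕ) :
    hilbCoeff box d ∈ regularAtZero Fsq := by
  have hq : (RatFunc.X : Fsq) ≠ 0 := RatFunc.X_ne_zero
  have hh : (RatFunc.C RatFunc.X : Fsq) ^ 2 ≠ 0 := pow_ne_zero 2 C_X_ne_zero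
  have hx := isLaurentMonomial_xVar box
  rw [hilbCoeff, hVar_eq_C, qVar_eq_C]
  refine mul_mem (prod_mem fun i _ => ?_)
    (prod_mem fun i _ => prod_mem fun j _ => mul_mem ?_ ?_)
  · exact qPoch_div_qPoch_mem_regularAtZero hq hh hq (hx i) _
  · convert qPoch_div_qPoch_mem_regularAtZero hq hh hq
      (isLaurentMonomial_t1Var.mul ((hx i).div (hx j))) (d i - d j) using 3 <;> ring
  · convert qPoch_div_qPoch_mem_regularAtZero hq hq hh
      ((hx i).div (hx j)) (d i - d j) using 3 <;> ring

/-- For a partition `λ` of `n` (rows `lam 1 ≥ lam 2 ≥ …`, boxes enumerated by `box`),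
each `z`-coefficient `∑_{|d|=D} c_d(a)` of the vertex function of `Hilbⁿ(ℂ²)` at the
fixed point `λ` is regular at `a = 0`: its denominator does not vanish at `a = 0`. -/
theorem hilbert_vertex_regular_at_zero (n : ℕ) (hn : 1 ≤ n)
    (lam : ℕ → ℕ) (hlam : Antitone lam)
    (box : Fin n → ℕ × ℕ) (hinj : Function.Injective box)
    (hrange : Set.range box = {p : ℕ × ℕ | 1 ≤ p.1 ∧ 1 ≤ p.2 ∧ p.2 ≤ lam p.1})
    (D : ℕ) :
    Polynomial.eval (0 : Fsq)
      (RatFunc.denom (∑ d ∈ Finset.Nat.antidiagonalTuple n D, hilbCoeff box d)) ≠ 0 := by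
  exact mem_regularAtZero.1 (sum_mem fun d _ => hilbCoeff_mem_regularAtZero box d)
end

section
/- Let λ be a partition of n with boxes enumerated as (r_1,c_1),…,(r_n,c_n). Work in the field F' = ℚ(u,s') of rational functions in two variables u, s', set q = u², ħ = q/ħ' with ħ' = s'², and s = u/s' (so s² = ħ). In F'(a) set t_1 = a s^{−1}, t_2 = a^{−1} s^{−1}, x_i = t_1^{1−c_i} t_2^{1−r_i}, and for d ∈ ℕ^n let c_d(a) ∈ F'(a) be as follows: c_d(a) = ∏_{i=1}^n (ħ x_i;q)_{d_i}/(q x_i;q)_{d_i} · ∏_{i,j=1}^n [(ħ t_1 x_i/x_j;q)_{d_i−d_j}/(q t_1 x_i/x_j;q)_{d_i−d_j}] · [(q x_i/x_j;q)_{d_i−d_j}/(ħ x_i/x_j;q)_{d_i−d_j}]. Let L_D ∈ F' denote the value at a = 0 of ∑_{d ∈ ℕ^n, |d| = D} c_d(a). Then in the formal power series ring F'[[a']] one has the identity ∑_{D=0}^∞ L_D (a' s')^D = ∏_{□ ∈ λ} ∑_{m=0}^∞ ((q/ħ';q)_m/(q;q)_m) (a'^{l(□)+a(□)+1} · s'^{a(□)+1−l(□)})^m,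 where for a box □ ∈ λ, l(□) and a(□) denote its leg length and arm length in λ. Equivalently, κ*V_λ(0_{𝔠_+}, z) = ∏_{□ ∈ λ} ξ(q/ħ', t_1'^{l(□)} t_2'^{−a(□)−1}) with t_1' = a' ħ'^{−1/2}, t_2' = a'^{−1} ħ'^{−1/2}. -/
/-- The field `F' = ℚ(u,s')`, realized as `ℚ(u)(s')`: inner variable `u`, outer `s'`. -/
noncomputable abbrev Fus : Type := RatFunc (RatFunc ℚ)

/-- The variable `u` (a square root of `q`) in `F'`. -/
noncomputable def uE : Fus := algebraMap (RatFunc ℚ) Fus RatFunc.X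

/-- The variable `s'` (a square root of `ħ'`) in `F'`. -/
noncomputable def s'E : Fus := RatFunc.X

/-- `q = u²`. -/
noncomputable def qE : Fus := uE ^ 2

/-- `ħ' = s'²`. -/
noncomputable def h'E : Fus := s'E ^ 2

/-- `ħ = q/ħ'`. -/
noncomputable def hE : Fus := qE / h'E

/-- `s = u/s'`, so that `s² = ħ`. -/
noncomputable def sE : Fus := uE / s'E

/-- The field `F'(a)`. -/
noncomputable abbrev FusA : Type := RatFunc Fus

/-- The variable `a` in `F'(a)`. -/
noncomputable def aA : FusA := RatFunc.X

/-- `q` viewed in `F'(a)`. -/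
noncomputable def qA : FusA := algebraMap Fus FusA qE

/-- `ħ` viewed in `F'(a)`. -/
noncomputable def hA : FusA := algebraMap Fus FusA hE

/-- `s` viewed in `F'(a)`. -/
noncomputable def sA : FusA := algebraMap Fus FusA sE

/-- `t₁ = a s⁻¹`. -/
noncomputable def t1A : FusA := aA * sA⁻¹

/-- `t₂ = a⁻¹ s⁻¹`. -/
noncomputable def t2A : FusA := aA⁻¹ * sA⁻¹

/-- `xᵢ = t₁^{1-cᵢ} t₂^{1-rᵢ}` for the box `box i = (rᵢ, cᵢ)`. -/
noncomputable def xA {n : ℕ} (box : Fin n → ℕ × ℕ) (i : Fin n) : FusA :=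
  t1A ^ ((1 : ℤ) - ((box i).2 : ℤ)) * t2A ^ ((1 : ℤ) - ((box i).1 : ℤ))

/-- The coefficient `c_d(a)` of `z^{d₁+⋯+d_n}` in the vertex function of the Hilbert
scheme of `n` points in `ℂ²` at the fixed point `λ`, with boxes enumerated by `box`. -/
noncomputable def cCoeff {n : ℕ} (box : Fin n → ℕ × ℕ) (d : Fin n → ℕ) : FusA :=
  (∏ i : Fin n, qPoch qA (hA * xA box i) (d i) / qPoch qA (qA * xA box i) (d i)) *
  ∏ i : Fin n, ∏ j : Fin n,
    (qPoch qA (hA * t1A * xA box i / xA box j) ((d i : ℤ) - (d j : ℤ)) /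
      qPoch qA (qA * t1A * xA box i / xA box j) ((d i : ℤ) - (d j : ℤ))) *
    (qPoch qA (qA * xA box i / xA box j) ((d i : ℤ) - (d j : ℤ)) /
      qPoch qA (hA * xA box i / xA box j) ((d i : ℤ) - (d j : ℤ)))

/-- `L_D`: the value at `a = 0` of the coefficient `∑_{|d| = D} c_d(a)`. -/
noncomputable def Lcoeff {n : ℕ} (box : Fin n → ℕ × ℕ) (D : ℕ) : Fus :=
  RatFunc.eval (RingHom.id Fus) 0 (∑ d ∈ Finset.Nat.antidiagonalTuple n D, cCoeff box d)

/-- The leg length `l(□) = λ_r - c` of a box `□ = (r,c)` of the partition `lam`. -/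
def legL (lam : ℕ → ℕ) (rc : ℕ × ℕ) : ℕ := lam rc.1 - rc.2

/-- The arm length `a(□) = λ'_c - r` of a box `□ = (r,c)` of the partition `lam` of `n`
(the transposed part `λ'_c` is the number of rows `1 ≤ r' ≤ n` with `λ_{r'} ≥ c`). -/
def armL (n : ℕ) (lam : ℕ → ℕ) (rc : ℕ × ℕ) : ℕ :=
  ((Finset.Icc 1 n).filter fun r => rc.2 ≤ lam r).card - rc.1

/-- The two-body function of Ruijsenaars' identity, in homogeneous form. -/
def ruijG {K : Type*} [Field K] (a b x y : K) : K :=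
  (x - a * y) * (x - b * y) / ((x - y) * (x - a * b * y))

lemma ruijG_mul_left {K : Type*} [Field K] {a b x y : K} (hc : a * b ≠ 0) :
    ruijG a b (a * b * x) y = ruijG a b y x := by
  unfold ruijG
  have ha : a ≠ 0 := left_ne_zero_of_mul hc
  have hb : b ≠ 0 := right_ne_zero_of_mul hc
  rw [show (a * b * x - a * y) * (a * b * x - b * y) =
      (a * b) * ((y - a * x) * (y - b * x)) by ring,
    show (a * b * x - y) * (a * b * x - a * b * y) = (a * b) * ((y - x) * (y - a * b * x)) by ring,
    mul_div_mul_left _ _ hc]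

open Finset in
/-- The sum over `r`-subsets `I` of `P` of `∏_{i ∈ I, j ∉ I} g i j`. -/
def powersetSum {K ι : Type*} [Field K] [DecidableEq ι] (g : ι → ι → K) (r : ℕ)
    (P : Finset ι) : K :=
  ∑ I ∈ P.powersetCard r, ∏ i ∈ I, ∏ j ∈ P \ I, g i j

section Ruijsenaars

open Finset Polynomial

variable {K ι : Type*} [Field K] [DecidableEq ι]

lemma powersetSum_zero (g : ι → ι → K) (P : Finset ι) : powersetSum g 0 P = 1 := by
  simp [powersetSum]

lemma prod_sdiff_insert_of_notMem {Q J : Finset ι} {k : ι} (hk : k ∉ Q) (hJ : J ⊆ Q)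
    (f : ι → K) : ∏ j ∈ insert k Q \ J, f j = f k * ∏ j ∈ Q \ J, f j := by
  have hkJ : k ∉ J := fun h => hk (hJ h)
  rw [insert_sdiff_of_notMem _ hkJ, prod_insert (by simp [hk])]

lemma prod_sdiff_insert_insert {Q J : Finset ι} {k : ι} (hk : k ∉ Q)
    (f : ι → K) : ∏ j ∈ insert k Q \ insert k J, f j = ∏ j ∈ Q \ J, f j := by
  rw [insert_sdiff_insert, sdiff_insert_of_notMem hk]

lemma sum_powersetCard_succ_insert {Q : Finset ι} {k : ι} (hk : k ∉ Q) (r : ℕ)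
    (f : Finset ι → K) :
    ∑ I ∈ (insert k Q).powersetCard (r + 1), f I =
      ∑ I ∈ Q.powersetCard (r + 1), f I + ∑ I ∈ Q.powersetCard r, f (insert k I) := by
  rw [powersetCard_succ_insert hk, sum_union, sum_image]
  · intro x hx y hy h
    replace hx := mem_powersetCard.1 hx
    replace hy := mem_powersetCard.1 hy
    have := congrArg (fun s => s.erase k) h
    simpa [erase_insert (fun h => hk (hx.1 h)), erase_insert (fun h => hk (hy.1 h))] using this
  · rw [disjoint_left]
    intro x hx hx'
    obtain ⟨y, _, rfl⟩ := mem_image.1 hx'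
    exact hk ((mem_powersetCard.1 hx).1 (mem_insert_self _ _))

/-- Splitting off one point `o`: the cleared-denominator form depends on the values `n`, `n'`, `d`
at the remaining points. -/
def clearedSum (g : ι → ι → K) {A : Type*} [CommRing A] [Algebra K A] (n n' d : ι → A) (r : ℕ)
    (Q : Finset ι) : A :=
  ∑ J ∈ Q.powersetCard r,
    (algebraMap K A (∏ i ∈ J, ∏ j ∈ Q \ J, g i j) * (∏ j ∈ Q \ J, n j) * ∏ j ∈ J, d j -
      algebraMap K A (∏ i ∈ J, ∏ j ∈ Q \ J, g j i) * (∏ j ∈ Q \ J, n' j) * ∏ j ∈ J, d j) +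
  ∑ J ∈ Q.powersetCard (r + 1),
    (algebraMap K A (∏ i ∈ J, ∏ j ∈ Q \ J, g i j) * (∏ j ∈ J, n' j) * ∏ j ∈ Q \ J, d j -
      algebraMap K A (∏ i ∈ J, ∏ j ∈ Q \ J, g j i) * (∏ j ∈ J, n j) * ∏ j ∈ Q \ J, d j)

lemma powersetSum_insert_sub (g : ι → ι → K) (d : ι → K) (r : ℕ) {Q : Finset ι} {o : ι}
    (ho : o ∉ Q) :
    (∏ j ∈ Q, d j) * (powersetSum g (r + 1) (insert o Q) -
      powersetSum (fun i j => g j i) (r + 1) (insert o Q)) =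
    clearedSum g (fun j => g o j * d j) (fun j => g j o * d j) d r Q := by
  unfold powersetSum clearedSum
  rw [sum_powersetCard_succ_insert ho, sum_powersetCard_succ_insert ho, add_comm,
    add_comm (∑ I ∈ Q.powersetCard (r + 1), _), add_sub_add_comm, ← sum_sub_distrib,
    ← sum_sub_distrib, mul_add, mul_sum, mul_sum]
  congr 1
  · refine sum_congr rfl fun J hJ => ?_
    have hJQ := (mem_powersetCard.1 hJ).1
    rw [prod_insert (fun h => ho (hJQ h)), prod_insert (fun h => ho (hJQ h))]
    simp only [prod_sdiff_insert_insert ho, prod_mul_distrib, Algebra.algebraMap_self,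
      RingHom.id_apply]
    rw [← prod_sdiff hJQ]
    ring
  · refine sum_congr rfl fun J hJ => ?_
    have hJQ := (mem_powersetCard.1 hJ).1
    simp only [prod_sdiff_insert_of_notMem ho hJQ, prod_mul_distrib, Algebra.algebraMap_self,
      RingHom.id_apply]
    rw [← prod_sdiff hJQ]
    ring

lemma clearedSum_of_eq_zero (g : ι → ι → K) (n n' d u u' : ι → K) (r : ℕ) {Q : Finset ι} {k : ι}
    (hk : k ∉ Q) (hd : d k = 0) (hn : ∀ j ∈ Q, n j = u j * d j) (hn' : ∀ j ∈ Q, n' j = u' j * d j) :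
    clearedSum g n n' d r (insert k Q) =
      (∏ j ∈ Q, d j) * ∑ J ∈ Q.powersetCard r,
        ((∏ i ∈ J, ∏ j ∈ Q \ J, g i j) *
            (n k * (∏ i ∈ J, g i k) * (∏ j ∈ Q \ J, u j) +
              n' k * (∏ j ∈ Q \ J, g k j) * ∏ j ∈ J, u' j) -
          (∏ i ∈ J, ∏ j ∈ Q \ J, g j i) *
            (n' k * (∏ i ∈ J, g k i) * (∏ j ∈ Q \ J, u' j) +
              n k * (∏ j ∈ Q \ J, g j k) * ∏ j ∈ J, u j)) := by
  unfold clearedSum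
  rw [sum_powersetCard_succ_insert hk, ← sum_subset (powersetCard_mono (subset_insert k Q)),
    sum_eq_zero (s := Q.powersetCard (r + 1)), zero_add, ← sum_add_distrib, mul_sum]
  · refine sum_congr rfl fun J hJ => ?_
    have hJQ := (mem_powersetCard.1 hJ).1
    have hkJ : k ∉ J := fun h => hk (hJQ h)
    rw [prod_insert hkJ, prod_insert hkJ, prod_insert hkJ, prod_insert hkJ]
    simp only [prod_sdiff_insert_of_notMem hk hJQ, prod_sdiff_insert_insert hk, prod_mul_distrib,
      Algebra.algebraMap_self, RingHom.id_apply]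
    rw [prod_congr rfl fun j hj => hn j (sdiff_subset hj),
      prod_congr rfl fun j hj => hn' j (sdiff_subset hj),
      prod_congr rfl fun j hj => hn j (hJQ hj), prod_congr rfl fun j hj => hn' j (hJQ hj)]
    simp only [prod_mul_distrib]
    rw [← prod_sdiff hJQ]
    ring
  · intro J hJ
    have hJQ := (mem_powersetCard.1 hJ).1
    have : ∏ j ∈ insert k Q \ J, d j = 0 :=
      prod_eq_zero (i := k) (mem_sdiff.2 ⟨mem_insert_self _ _, fun h => hk (hJQ h)⟩) hd
    simp [this]
  · intro J hJ hJ'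
    have hkJ : k ∈ J := by
      by_contra h
      refine hJ' (mem_powersetCard.2 ⟨fun x hx => ?_, (mem_powersetCard.1 hJ).2⟩)
      rcases mem_insert.1 ((mem_powersetCard.1 hJ).1 hx) with rfl | h'
      · exact absurd hx h
      · exact h'
    have : ∏ j ∈ J, d j = 0 := prod_eq_zero hkJ hd
    simp [this]

lemma map_clearedSum (g : ι → ι → K) {A : Type*} [CommRing A] [Algebra K A] (φ : A →ₐ[K] K)
    (n n' d : ι → A) (r : ℕ) (Q : Finset ι) :
    φ (clearedSum g n n' d r Q) =
      clearedSum g (fun i => φ (n i)) (fun i => φ (n' i)) (fun i => φ (d i)) r Q := by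
  simp only [clearedSum, map_add, map_sum, map_sub, map_mul, map_prod, AlgHom.commutes]

/-- The trigonometric form of Ruijsenaars' functional identity. -/
theorem powersetSum_ruijG_symm {a b : K} (hc0 : a * b ≠ 0) (hc : (a * b) ^ 2 ≠ 1) (z : ι → K)
    (P : Finset ι) (h0 : ∀ i ∈ P, z i ≠ 0)
    (hz : ∀ i ∈ P, ∀ j ∈ P, i ≠ j →
      z i ≠ z j ∧ z i ≠ a * b * z j ∧ z i ≠ (a * b) ^ 2 * z j) (r : ℕ) :
    powersetSum (fun i j => ruijG a b (z i) (z j)) r P =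
      powersetSum (fun i j => ruijG a b (z j) (z i)) r P := by
  induction P using Finset.strongInduction generalizing r with
  | H P ih =>
  rcases r with _ | r
  · simp only [powersetSum_zero]
  rcases P.eq_empty_or_nonempty with rfl | ⟨o, hoP⟩
  · simp [powersetSum]
  obtain ⟨Q, hoQ, rfl⟩ : ∃ Q, o ∉ Q ∧ P = insert o Q :=
    ⟨P.erase o, notMem_erase _ _, (insert_erase hoP).symm⟩
  set c := a * b with hcdef
  set g : ι → ι → K := fun i j => ruijG a b (z i) (z j) with hg
  have hc1 : c ≠ 1 := fun h => hc (by rw [h]; ring)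
  have ihS : ∀ R ⊂ insert o Q, ∀ r, powersetSum g r R = powersetSum (fun i j => g j i) r R :=
    fun R hR r => ih R hR (fun i hi => h0 i (hR.1 hi))
      (fun i hi j hj => hz i (hR.1 hi) j (hR.1 hj)) r
  let D : ι → K[X] := fun k => (X - C (z k)) * (X - C (c * z k)) * (C c * X - C (z k))
  let N : ι → K[X] := fun k => (X - C (a * z k)) * (X - C (b * z k)) * (C c * X - C (z k))
  let N' : ι → K[X] := fun k => (C a * X - C (z k)) * (C b * X - C (z k)) * (X - C (c * z k))
  let F : K[X] := clearedSum g N N' D r Q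
  have hF : ∀ x, F.eval x = clearedSum g (fun i => (N i).eval x) (fun i => (N' i).eval x)
      (fun i => (D i).eval x) r Q := fun x => by
    have := map_clearedSum g (aeval x) N N' D r Q
    simpa only [coe_aeval_eq_eval] using this
  have hNev : ∀ i x, (N i).eval x = (x - a * z i) * (x - b * z i) * (c * x - z i) := by
    intro i x; simp [N]
  have hN'ev : ∀ i x, (N' i).eval x = (a * x - z i) * (b * x - z i) * (x - c * z i) := by
    intro i x; simp [N']
  have hDev : ∀ i x, (D i).eval x = (x - z i) * (x - c * z i) * (c * x - z i) := by
    intro i x; simp [D]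
  have hND : ∀ i x, (D i).eval x ≠ 0 → (N i).eval x = ruijG a b x (z i) * (D i).eval x ∧
      (N' i).eval x = ruijG a b (z i) x * (D i).eval x := by
    intro i x hD
    rw [hDev] at hD
    have h1 : x - z i ≠ 0 := fun h => hD (by rw [h]; ring)
    have h1' : z i - x ≠ 0 := fun h => h1 (by linear_combination -h)
    have h2 : x - a * b * z i ≠ 0 := fun h => hD (by rw [hcdef, h]; ring)
    have h3 : z i - a * b * x ≠ 0 := fun h =>
      hD (by rw [hcdef]; linear_combination (-(x - z i) * (x - a * b * z i)) * h)
    rw [hNev, hN'ev, hDev, ruijG, ruijG, div_mul_eq_mul_div, div_mul_eq_mul_div,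
      eq_div_iff (mul_ne_zero h1 h2), eq_div_iff (mul_ne_zero h1' h3), hcdef]
    constructor <;> ring
  -- vanishing at the points
  have hvan : ∀ k ∈ Q, ∀ x, (D k).eval x = 0 → F.eval x = 0 := by
    intro k hkQ x hDk
    obtain ⟨R, hkR, rfl⟩ : ∃ R, k ∉ R ∧ Q = insert k R :=
      ⟨Q.erase k, notMem_erase _ _, (insert_erase hkQ).symm⟩
    have hRss : R ⊂ insert o (insert k R) :=
      ⟨fun x hx => by simp [hx], fun h => hkR (h (by simp))⟩
    have hzk := h0 k (by simp)
    rw [hF]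
    have hDne : ∀ j ∈ R, (D j).eval x ≠ 0 := by
      intro j hj
      have hjk : j ≠ k := fun h => hkR (h ▸ hj)
      obtain ⟨e1, e2, e3⟩ := hz j (by simp [hj]) k (by simp) hjk
      obtain ⟨e4, e5, e6⟩ := hz k (by simp) j (by simp [hj]) hjk.symm
      rw [hDev]
      rw [hDev, mul_eq_zero, mul_eq_zero] at hDk
      refine mul_ne_zero (mul_ne_zero ?_ ?_) ?_ <;> intro hh
      · rcases hDk with (h | h) | h
        · exact e1 (by linear_combination h - hh)
        · exact e2 (by linear_combination h - hh)
        · exact e5 (by linear_combination c * hh - h)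
      · rcases hDk with (h | h) | h
        · exact e5 (by linear_combination hh - h)
        · exact e1 (mul_left_cancel₀ hc0 (by linear_combination h - hh))
        · exact e6 (by linear_combination c * hh - h)
      · rcases hDk with (h | h) | h
        · exact e2 (by linear_combination c * h - hh)
        · exact e3 (by linear_combination c * h - hh)
        · exact e1 (by linear_combination h - hh)
    rw [clearedSum_of_eq_zero g _ _ _ (fun j => ruijG a b x (z j)) (fun j => ruijG a b (z j) x) r
      hkR hDk (fun j hj => (hND j x (hDne j hj)).1) (fun j hj => (hND j x (hDne j hj)).2)]
    refine mul_eq_zero_of_right _ ?_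
    have hih := ihS R hRss r
    rw [hDev, mul_eq_zero, mul_eq_zero] at hDk
    rcases hDk with (h | h) | h
    · have hx : x = z k := by linear_combination h
      refine sum_eq_zero fun J _ => ?_
      rw [hNev, hN'ev, hx]
      simp only [hg, hcdef]
      ring
    · have hx : x = a * b * z k := by linear_combination h
      have h1 : (N' k).eval x = 0 := by rw [hN'ev, h]; ring
      have h2 : ∀ j, ruijG a b x (z j) = g j k := fun j => by rw [hx, ruijG_mul_left hc0]
      simp only [h1, h2, zero_mul, add_zero, zero_add]
      calc _ = (N k).eval x * (∏ j ∈ R, g j k) *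
          (powersetSum g r R - powersetSum (fun i j => g j i) r R) := by
            unfold powersetSum
            rw [← sum_sub_distrib, mul_sum]
            refine sum_congr rfl fun J hJ => ?_
            rw [← prod_sdiff (mem_powersetCard.1 hJ).1 (f := fun j => g j k)]
            ring
        _ = 0 := by rw [hih]; ring
    · have hx : z k = a * b * x := by linear_combination -h
      have h1 : (N k).eval x = 0 := by rw [hNev, h]; ring
      have h2 : ∀ j, ruijG a b (z j) x = g k j := fun j => by
        simp only [hg]
        rw [hx, ruijG_mul_left hc0]
      simp only [h1, h2, zero_mul, add_zero, zero_add]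
      calc _ = (N' k).eval x * (∏ j ∈ R, g k j) *
          (powersetSum g r R - powersetSum (fun i j => g j i) r R) := by
            unfold powersetSum
            rw [← sum_sub_distrib, mul_sum]
            refine sum_congr rfl fun J hJ => ?_
            rw [← prod_sdiff (mem_powersetCard.1 hJ).1 (f := fun j => g k j)]
            ring
        _ = 0 := by rw [hih]; ring
  -- degree bound
  have hDdeg : ∀ k, (D k).natDegree ≤ 3 := fun k => by simp only [D]; compute_degree
  have hNdeg : ∀ k, (N k).natDegree ≤ 3 := fun k => by simp only [N]; compute_degree
  have hN'deg : ∀ k, (N' k).natDegree ≤ 3 := fun k => by simp only [N']; compute_degree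
  have hDc : ∀ k, (D k).coeff 3 = c := fun k => by simp only [D]; compute_degree!
  have hNc : ∀ k, (N k).coeff 3 = c := fun k => by simp only [N]; compute_degree!
  have hN'c : ∀ k, (N' k).coeff 3 = c := fun k => by simp only [N']; compute_degree!; 
  have hprod : ∀ (A B : ι → K[X]), (∀ k, (A k).natDegree ≤ 3) → (∀ k, (B k).natDegree ≤ 3) →
      (∀ k, (A k).coeff 3 = c) → (∀ k, (B k).coeff 3 = c) → ∀ J ⊆ Q,
      ((∏ j ∈ Q \ J, A j) * ∏ j ∈ J, B j).natDegree ≤ #Q * 3 ∧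
      ((∏ j ∈ Q \ J, A j) * ∏ j ∈ J, B j).coeff (#Q * 3) = c ^ #Q := by
    intro A B hA hB hA' hB' J hJ
    have e : ((∏ j ∈ Q \ J, A j) * ∏ j ∈ J, B j) = ∏ j ∈ Q, (if j ∈ J then B j else A j) := by
      rw [← prod_sdiff hJ]
      congr 1
      · exact prod_congr rfl fun j hj => by rw [if_neg (mem_sdiff.1 hj).2]
      · exact prod_congr rfl fun j hj => by rw [if_pos hj]
    have hd : ∀ j ∈ Q, (if j ∈ J then B j else A j).natDegree ≤ 3 := by
      intro j _; split_ifs <;> simp [hA, hB]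
    rw [e]
    refine ⟨(natDegree_prod_le _ _).trans ((sum_le_sum hd).trans (by simp)), ?_⟩
    rw [coeff_prod_of_natDegree_le _ _ _ hd, prod_congr rfl (g := fun _ => c)]
    · simp
    · intro j _; split_ifs <;> simp [hA', hB']
  have hterm : ∀ w : K, ∀ p : K[X], p.natDegree ≤ #Q * 3 →
      (algebraMap K K[X] w * p).natDegree ≤ #Q * 3 := fun w p hp =>
    (natDegree_C_mul_le w p).trans hp
  have hFdeg : F.natDegree ≤ #Q * 3 := by
    refine (natDegree_add_le _ _).trans (max_le ?_ ?_)
    · refine natDegree_sum_le_of_forall_le _ _ fun J hJ => ?_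
      have hJQ := (mem_powersetCard.1 hJ).1
      refine (natDegree_sub_le _ _).trans (max_le ?_ ?_) <;> rw [mul_assoc]
      · exact hterm _ _ (hprod N D hNdeg hDdeg hNc hDc J hJQ).1
      · exact hterm _ _ (hprod N' D hN'deg hDdeg hN'c hDc J hJQ).1
    · refine natDegree_sum_le_of_forall_le _ _ fun J hJ => ?_
      have hJQ := (mem_powersetCard.1 hJ).1
      refine (natDegree_sub_le _ _).trans (max_le ?_ ?_) <;>
        rw [mul_assoc, mul_comm (∏ j ∈ J, _)]
      · exact hterm _ _ (hprod D N' hDdeg hN'deg hDc hN'c J hJQ).1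
      · exact hterm _ _ (hprod D N hDdeg hNdeg hDc hNc J hJQ).1
  have hQss : Q ⊂ insert o Q := ssubset_insert hoQ
  have hFc : F.coeff (#Q * 3) = 0 := by
    have : F.coeff (#Q * 3) = c ^ #Q * ((powersetSum g r Q - powersetSum (fun i j => g j i) r Q) +
        (powersetSum g (r + 1) Q - powersetSum (fun i j => g j i) (r + 1) Q)) := by
      simp only [F, clearedSum, powersetSum, coeff_add, finsetSum_coeff, coeff_sub,
        mul_add]
      rw [← sum_sub_distrib, ← sum_sub_distrib, mul_sum, mul_sum]
      congr 1
      · refine sum_congr rfl fun J hJ => ?_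
        have hJQ := (mem_powersetCard.1 hJ).1
        rw [mul_assoc, mul_assoc]
        simp only [algebraMap_eq, coeff_C_mul]
        rw [(hprod N D hNdeg hDdeg hNc hDc J hJQ).2, (hprod N' D hN'deg hDdeg hN'c hDc J hJQ).2]
        ring
      · refine sum_congr rfl fun J hJ => ?_
        have hJQ := (mem_powersetCard.1 hJ).1
        rw [mul_assoc, mul_assoc, mul_comm (∏ j ∈ J, _), mul_comm (∏ j ∈ J, _)]
        simp only [algebraMap_eq, coeff_C_mul]
        rw [(hprod D N' hDdeg hN'deg hDc hN'c J hJQ).2, (hprod D N hDdeg hNdeg hDc hNc J hJQ).2]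
        ring
    rw [this, ihS Q hQss, ihS Q hQss]
    ring
  have hF0 : F = 0 := by
    rcases Q.eq_empty_or_nonempty with rfl | hQne
    · refine Polynomial.ext fun m => ?_
      rcases m with _ | m
      · simpa using hFc
      · rw [coeff_eq_zero_of_natDegree_lt (by simp at hFdeg; omega)]
        simp
    classical
    let pts : Finset K := Q.image z ∪ Q.image (fun k => c * z k) ∪ Q.image (fun k => c⁻¹ * z k)
    have hzinj : Set.InjOn z Q := fun i hi j hj h => by
      by_contra hij
      exact (hz i (by simp [mem_coe.1 hi]) j (by simp [mem_coe.1 hj]) hij).1 h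
    have hcz : ∀ i ∈ Q, ∀ j ∈ Q, z i ≠ c * z j := by
      intro i hi j hj h
      by_cases hij : i = j
      · subst hij
        exact hc1 (mul_right_cancel₀ (h0 i (by simp [hi])) (by linear_combination -h))
      · exact (hz i (by simp [hi]) j (by simp [hj]) hij).2.1 h
    have hczz : ∀ i ∈ Q, ∀ j ∈ Q, z i ≠ c ^ 2 * z j := by
      intro i hi j hj h
      by_cases hij : i = j
      · subst hij
        exact hc (mul_right_cancel₀ (h0 i (by simp [hi])) (by linear_combination -h))
      · exact (hz i (by simp [hi]) j (by simp [hj]) hij).2.2 h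
    have hcard : #pts = #Q * 3 := by
      simp only [pts]
      rw [card_union_of_disjoint, card_union_of_disjoint, card_image_of_injOn hzinj,
        card_image_of_injOn, card_image_of_injOn]
      · ring
      · intro i hi j hj h
        exact hzinj hi hj (mul_left_cancel₀ (inv_ne_zero hc0) h)
      · intro i hi j hj h
        exact hzinj hi hj (mul_left_cancel₀ hc0 h)
      · rw [disjoint_left]
        intro x hx hx'
        obtain ⟨i, hi, rfl⟩ := mem_image.1 hx
        obtain ⟨j, hj, h⟩ := mem_image.1 hx'
        exact hcz i hi j hj h.symm
      · rw [disjoint_left]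
        intro x hx hx'
        obtain ⟨j, hj, rfl⟩ := mem_image.1 hx'
        rcases mem_union.1 hx with hx | hx
        · obtain ⟨i, hi, h⟩ := mem_image.1 hx
          refine hcz j hj i hi ?_
          rw [h, mul_inv_cancel_left₀ hc0]
        · obtain ⟨i, hi, h⟩ := mem_image.1 hx
          refine hczz j hj i hi ?_
          rw [pow_two, mul_assoc, h, mul_inv_cancel_left₀ hc0]
    refine eq_zero_of_degree_lt_of_eval_finset_eq_zero pts ?_ ?_
    · rw [hcard]
      have hpos : 0 < #Q * 3 := by have := hQne.card_pos; omega
      refine lt_of_le_of_ne (natDegree_le_iff_degree_le.1 hFdeg) fun h => ?_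
      have := coeff_ne_zero_of_eq_degree h
      exact this hFc
    · intro x hx
      rcases mem_union.1 hx with hx | hx
      · rcases mem_union.1 hx with hx | hx
        · obtain ⟨k, hk, rfl⟩ := mem_image.1 hx
          exact hvan k hk _ (by rw [hDev]; ring)
        · obtain ⟨k, hk, rfl⟩ := mem_image.1 hx
          exact hvan k hk _ (by rw [hDev]; ring)
      · obtain ⟨k, hk, rfl⟩ := mem_image.1 hx
        exact hvan k hk _ (by rw [hDev, mul_inv_cancel_left₀ hc0]; ring)
  have hDo : ∀ k ∈ Q, (D k).eval (z o) ≠ 0 := by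
    intro k hk
    have hok : o ≠ k := fun h => hoQ (h ▸ hk)
    obtain ⟨e1, e2, _⟩ := hz o (by simp) k (by simp [hk]) hok
    obtain ⟨_, e3, _⟩ := hz k (by simp [hk]) o (by simp) hok.symm
    rw [hDev]
    exact mul_ne_zero (mul_ne_zero (sub_ne_zero.2 e1) (sub_ne_zero.2 e2)) (sub_ne_zero.2 e3.symm)
  have hfin := powersetSum_insert_sub g (fun i => (D i).eval (z o)) r hoQ
  have hev : clearedSum g (fun j => g o j * (D j).eval (z o)) (fun j => g j o * (D j).eval (z o))
      (fun i => (D i).eval (z o)) r Q = F.eval (z o) := by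
    rw [hF]
    unfold clearedSum
    have e1 : ∀ j ∈ Q, g o j * (D j).eval (z o) = (N j).eval (z o) := fun j hj =>
      (hND j _ (hDo j hj)).1.symm
    have e2 : ∀ j ∈ Q, g j o * (D j).eval (z o) = (N' j).eval (z o) := fun j hj =>
      (hND j _ (hDo j hj)).2.symm
    congr 1
    · refine sum_congr rfl fun J hJ => ?_
      have hJQ := (mem_powersetCard.1 hJ).1
      rw [prod_congr rfl fun j hj => e1 j (sdiff_subset hj),
        prod_congr rfl fun j hj => e2 j (sdiff_subset hj)]
    · refine sum_congr rfl fun J hJ => ?_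
      have hJQ := (mem_powersetCard.1 hJ).1
      rw [prod_congr rfl fun j hj => e1 j (hJQ hj), prod_congr rfl fun j hj => e2 j (hJQ hj)]
  rw [hev, hF0, eval_zero] at hfin
  exact sub_eq_zero.1 ((mul_eq_zero.1 hfin).resolve_left (prod_ne_zero_iff.2 hDo))

end Ruijsenaars

/-- `q` and `h` are multiplicatively independent. -/
structure QGeneric {K : Type*} [Field K] (q h : K) : Prop where
  q_ne : q ≠ 0
  h_ne : h ≠ 0
  indep : ∀ a b : ℤ, q ^ a * h ^ b = 1 → a = 0 ∧ b = 0

/-- The ratio `(h·h^k;q)_m / (q·h^k;q)_m`. -/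
noncomputable def qPhi {K : Type*} [Field K] (q h : K) (k m : ℤ) : K :=
  qPoch q (h * h ^ k) m / qPoch q (q * h ^ k) m

/-- The ratio of consecutive values of `qPhi`. -/
def qPsi {K : Type*} [Field K] (q h : K) (k m : ℤ) : K :=
  (1 - h * h ^ k * q ^ m) / (1 - q * h ^ k * q ^ m)

section qPhi

variable {K : Type*} [Field K] {q h : K}

lemma qPoch_zero (q a : K) : qPoch q a 0 = 1 := by simp [qPoch]

lemma qPoch_succ (q a : K) {m : ℤ} (hm : 0 ≤ m ∨ 1 - a * q ^ m ≠ 0) :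
    qPoch q a (m + 1) = qPoch q a m * (1 - a * q ^ m) := by
  rcases le_or_gt 0 m with h0 | h0
  · lift m to ℕ using h0
    simp only [qPoch, if_pos (show (0 : ℤ) ≤ m + 1 by positivity), if_pos (Int.natCast_nonneg m)]
    rw [show ((m : ℤ) + 1).toNat = m + 1 by omega, Finset.prod_range_succ]
    simp
  · replace hm := hm.resolve_left (by omega)
    obtain ⟨n, rfl⟩ : ∃ n : ℕ, m = -(n + 1 : ℤ) := ⟨(-m - 1).toNat, by omega⟩
    have e : qPoch q a (-(n + 1 : ℤ)) =
        (∏ j ∈ Finset.range (n + 1), (1 - a * (q ^ (j + 1))⁻¹))⁻¹ := by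
      rw [qPoch, if_neg (by omega)]; rfl
    have e' : qPoch q a (-(n + 1 : ℤ) + 1) =
        (∏ j ∈ Finset.range n, (1 - a * (q ^ (j + 1))⁻¹))⁻¹ := by
      rcases n with _ | n
      · simp [qPoch]
      · rw [qPoch, if_neg (by push_cast; omega)]; rfl
    have e2 : q ^ (-(n + 1 : ℤ)) = (q ^ (n + 1))⁻¹ := by rw [zpow_neg]; norm_cast
    rw [e2] at hm ⊢
    rw [e, e', Finset.prod_range_succ, mul_inv, mul_assoc, inv_mul_cancel₀ hm, mul_one]

lemma QGeneric.one_sub_ne (H : QGeneric q h) {a b : ℤ} (hab : a ≠ 0 ∨ b ≠ 0) :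
    1 - h ^ b * q ^ a ≠ 0 := by
  intro h0
  have := H.indep a b (by linear_combination -h0)
  omega

lemma QGeneric.num_eq (H : QGeneric q h) (k m : ℤ) :
    1 - h * h ^ k * q ^ m = 1 - h ^ (k + 1) * q ^ m := by
  rw [zpow_add_one₀ H.h_ne, mul_comm h]

lemma QGeneric.den_eq (H : QGeneric q h) (k m : ℤ) :
    1 - q * h ^ k * q ^ m = 1 - h ^ k * q ^ (m + 1) := by
  rw [zpow_add_one₀ H.q_ne]; ring

lemma qPhi_zero (q h : K) (k : ℤ) : qPhi q h k 0 = 1 := by simp [qPhi, qPoch_zero]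

lemma qPhi_succ (H : QGeneric q h) {k m : ℤ} (hm : k = 0 → m ≠ -1) :
    qPhi q h k (m + 1) = qPhi q h k m * qPsi q h k m := by
  unfold qPhi qPsi
  rw [qPoch_succ, qPoch_succ, mul_div_mul_comm]
  · rcases le_or_gt 0 m with h0 | h0
    · exact .inl h0
    · rw [H.den_eq]; exact .inr (H.one_sub_ne (by omega))
  · rcases le_or_gt 0 m with h0 | h0
    · exact .inl h0
    · rw [H.num_eq]; exact .inr (H.one_sub_ne (by omega))

lemma qPsi_ne_zero (H : QGeneric q h) {k m : ℤ} (h1 : k = 0 → m ≠ -1) (h2 : k = -1 → m ≠ 0) :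
    qPsi q h k m ≠ 0 := by
  unfold qPsi
  rw [H.num_eq, H.den_eq]
  exact div_ne_zero (H.one_sub_ne (by omega)) (H.one_sub_ne (by omega))

lemma qPhi_ne_zero (H : QGeneric q h) {k m : ℤ} (h1 : k = 0 → 0 ≤ m) (h2 : k = -1 → m ≤ 0) :
    qPhi q h k m ≠ 0 := by
  induction m using Int.induction_on with
  | zero => simp [qPhi_zero]
  | succ m ih =>
    rw [qPhi_succ H (by omega)]
    exact mul_ne_zero (ih (by omega) (by omega)) (qPsi_ne_zero H (by omega) (by omega))
  | pred m ih =>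
    have := qPhi_succ H (k := k) (m := -m - 1) (by omega)
    intro h0
    rw [h0, zero_mul, sub_add_cancel] at this
    exact ih (by omega) (by omega) this

lemma qPhi_zero_of_neg (H : QGeneric q h) {m : ℤ} (hm : m < 0) : qPhi q h 0 m = 0 := by
  have : qPoch q (q * h ^ (0 : ℤ)) m = 0 := by
    rw [qPoch, if_neg (by omega), inv_eq_zero]
    refine Finset.prod_eq_zero (i := 0) (by simp; omega) ?_
    simp [H.q_ne]
  rw [qPhi, this, div_zero]

lemma qPhi_neg_one_of_pos (H : QGeneric q h) {m : ℤ} (hm : 0 < m) : qPhi q h (-1) m = 0 := by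
  have : qPoch q (h * h ^ (-1 : ℤ)) m = 0 := by
    rw [qPoch, if_pos (by omega)]
    refine Finset.prod_eq_zero (i := 0) (by simp; omega) ?_
    simp [H.h_ne]
  rw [qPhi, this, zero_div]

lemma qPsi_reflect (H : QGeneric q h) (k m : ℤ) :
    qPsi q h (-1 - k) (-m - 1) = h / q * (qPsi q h k m)⁻¹ := by
  have hq := H.q_ne
  have hh := H.h_ne
  have e1 : h ^ (-1 - k) = (h * h ^ k)⁻¹ := by
    rw [show -1 - k = -(k + 1) by ring, zpow_neg, zpow_add_one₀ hh, mul_comm]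
  have e2 : q ^ (-m - 1) = (q * q ^ m)⁻¹ := by
    rw [show -m - 1 = -(m + 1) by ring, zpow_neg, zpow_add_one₀ hq, mul_comm]
  unfold qPsi
  rw [e1, e2, inv_div]
  have hk := zpow_ne_zero k hh
  have hm := zpow_ne_zero m hq
  have a1 : 1 - h * (h * h ^ k)⁻¹ * (q * q ^ m)⁻¹ =
      -(1 - q * h ^ k * q ^ m) / (h ^ k * (q * q ^ m)) := by field_simp; ring
  have a2 : 1 - q * (h * h ^ k)⁻¹ * (q * q ^ m)⁻¹ =
      -(1 - h * h ^ k * q ^ m) / (h * h ^ k * q ^ m) := by field_simp; ring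
  rw [a1, a2, div_div_div_eq, neg_mul, neg_mul_eq_mul_neg]
  rw [show h ^ k * (q * q ^ m) * -(1 - h * h ^ k * q ^ m) =
    -((h ^ k * (q * q ^ m)) * (1 - h * h ^ k * q ^ m)) by ring,
    ← neg_mul_eq_mul_neg, neg_div_neg_eq,
    mul_comm (1 - q * h ^ k * q ^ m), mul_div_mul_comm]
  congr 1
  field_simp

lemma qPhi_reflect_of_nonneg (H : QGeneric q h) {k : ℤ} (hk : k ≠ -1) (m : ℕ) :
    qPhi q h (-1 - k) (-m) = (q / h) ^ (m : ℤ) * qPhi q h k m := by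
  induction m with
  | zero => simp [qPhi_zero]
  | succ m ih =>
    have h1 := qPhi_succ H (k := -1 - k) (m := -m - 1) (by omega)
    rw [sub_add_cancel, ih, qPsi_reflect H] at h1
    have hpsi : qPsi q h k m ≠ 0 := qPsi_ne_zero H (by omega) (by omega)
    have h2 := qPhi_succ H (k := k) (m := m) (by omega)
    have hq := H.q_ne
    have hh := H.h_ne
    push_cast
    rw [neg_add, ← sub_eq_add_neg, h2, zpow_add_one₀ (div_ne_zero hq hh)]
    calc _ = qPhi q h (-1 - k) (-↑m - 1) * (h / q * (qPsi q h k ↑m)⁻¹) *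
          (q / h * qPsi q h k m) := by field_simp
      _ = _ := by rw [← h1]; ring

lemma qPhi_reflect (H : QGeneric q h) (k m : ℤ) :
    qPhi q h (-1 - k) (-m) = (q / h) ^ m * qPhi q h k m := by
  have hqh : q / h ≠ 0 := div_ne_zero H.q_ne H.h_ne
  have key : ∀ k m : ℤ, 0 < m → qPhi q h (-1 - k) (-m) = (q / h) ^ m * qPhi q h k m := by
    intro k m hm
    by_cases hk : k = -1
    · subst hk
      rw [qPhi_neg_one_of_pos H hm, show (-1 - -1 : ℤ) = 0 by ring, qPhi_zero_of_neg H (by omega),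
        mul_zero]
    · lift m to ℕ using hm.le
      exact qPhi_reflect_of_nonneg H hk m
  rcases lt_trichotomy m 0 with hm | rfl | hm
  · have := key (-1 - k) (-m) (by omega)
    rw [neg_neg, sub_sub_cancel] at this
    rw [this, ← mul_assoc, ← zpow_add₀ hqh]
    simp
  · simp [qPhi_zero]
  · exact key k m hm

lemma ruijG_eq (H : QGeneric q h) (s s' i j : ℤ) :
    ruijG q (h / q) (h ^ s * q ^ i) (h ^ s' * q ^ j) =
      qPsi q h (s' - s) (j - i - 1) / qPsi q h (s' - s) (j - i) := by
  have hq := H.q_ne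
  have hh := H.h_ne
  set x := h ^ s * q ^ i with hx
  have hx0 : x ≠ 0 := mul_ne_zero (zpow_ne_zero _ hh) (zpow_ne_zero _ hq)
  set Y := h ^ (s' - s) * q ^ (j - i) with hY
  have hy : h ^ s' * q ^ j = x * Y := by
    rw [hx, hY, mul_mul_mul_comm, ← zpow_add₀ hh, ← zpow_add₀ hq]
    congr 2 <;> ring
  have e1 : qPsi q h (s' - s) (j - i) = (1 - h * Y) / (1 - q * Y) := by
    rw [qPsi, hY]; congr 1 <;> ring
  have e2 : qPsi q h (s' - s) (j - i - 1) = (1 - h / q * Y) / (1 - Y) := by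
    rw [qPsi, hY, zpow_sub_one₀ hq]; congr 1 <;> field_simp
  rw [hy, e1, e2, ruijG, div_div_div_eq, mul_div_cancel₀ _ hq]
  rw [show (x - q * (x * Y)) * (x - h / q * (x * Y)) = x ^ 2 * ((1 - h / q * Y) * (1 - q * Y)) by
    ring, show (x - x * Y) * (x - h * (x * Y)) = x ^ 2 * ((1 - Y) * (1 - h * Y)) by ring,
    mul_div_mul_left _ _ (pow_ne_zero 2 hx0)]

/-- Telescoping of the two-body function over a rectangle. -/
lemma prod_Ico_ruijG (H : QGeneric q h) (s s' : ℤ) {A κ κ' B : ℕ} (hA : A ≤ κ) (hB : κ' ≤ B)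
    (h1 : s' = s → κ ≤ κ') (h2 : s' = s - 1 → B ≤ A) :
    ∏ i ∈ Finset.Ico A κ, ∏ j ∈ Finset.Ico κ' B,
      ruijG q (h / q) (h ^ s * q ^ (i : ℤ)) (h ^ s' * q ^ (j : ℤ)) =
    qPhi q h (s' - s) (κ' - A) * qPhi q h (s' - s) (B - κ) /
      (qPhi q h (s' - s) (κ' - κ) * qPhi q h (s' - s) (B - A)) := by
  have hne : ∀ b : ℕ, κ' ≤ b → b ≤ B → qPhi q h (s' - s) (b - κ) ≠ 0 := fun b hb hb' =>
    qPhi_ne_zero H (by omega) (by omega)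
  obtain rfl | hlt := hA.eq_or_lt
  · rw [Finset.Ico_self, Finset.prod_empty, div_self]
    exact mul_ne_zero (hne κ' le_rfl hB) (hne B hB le_rfl)
  have hrow : ∀ n : ℕ, A ≤ n → n ≤ κ → ∀ j ∈ Finset.Ico κ' B, ∏ i ∈ Finset.Ico A n,
      ruijG q (h / q) (h ^ s * q ^ (i : ℤ)) (h ^ s' * q ^ (j : ℤ)) =
      qPsi q h (s' - s) (j - n) / qPsi q h (s' - s) (j - A) := by
    intro n hn
    induction n, hn using Nat.le_induction with
    | base =>
      intro _ j hj
      rw [Finset.mem_Ico] at hj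
      rw [Finset.Ico_self, Finset.prod_empty, div_self]
      exact qPsi_ne_zero H (by omega) (by omega)
    | succ n hn ih =>
      intro hn' j hj
      rw [Finset.prod_Ico_succ_top hn, ih (by omega) j hj, ruijG_eq H]
      rw [Finset.mem_Ico] at hj
      have : qPsi q h (s' - s) (j - n) ≠ 0 := qPsi_ne_zero H (by omega) (by omega)
      rw [div_mul_div_comm, mul_comm, mul_div_mul_right _ _ this]
      push_cast
      rw [sub_sub]
  have hcol : ∀ c : ℕ, A ≤ c → c ≤ κ → ∀ b : ℕ, κ' ≤ b → b ≤ B →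
      ∏ j ∈ Finset.Ico κ' b, qPsi q h (s' - s) (j - c) =
      qPhi q h (s' - s) (b - c) / qPhi q h (s' - s) (κ' - c) := by
    intro c hc hc' b hb
    have h0 : ∀ b : ℕ, κ' ≤ b → b ≤ B → qPhi q h (s' - s) (b - c) ≠ 0 := fun b hb hb' =>
      qPhi_ne_zero H (by omega) (by omega)
    induction b, hb using Nat.le_induction with
    | base => intro hb'; rw [Finset.Ico_self, Finset.prod_empty, div_self (h0 _ le_rfl hb')]
    | succ b hb ih =>
      intro hb'
      rw [Finset.prod_Ico_succ_top hb, ih (by omega)]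
      push_cast
      rw [add_sub_right_comm, qPhi_succ H (by omega), div_mul_eq_mul_div]
  rw [Finset.prod_comm, Finset.prod_congr rfl (hrow κ hA le_rfl), Finset.prod_div_distrib,
    hcol κ hA le_rfl B hB le_rfl, hcol A le_rfl hA B hB le_rfl, div_div_div_eq]
  ring

end qPhi

open Finset in
lemma powersetSum_swap {ι K : Type*} [DecidableEq ι] [Field K] (g : ι → ι → K) {r : ℕ}
    {P : Finset ι}
    (hr : r ≤ #P) : powersetSum (fun i j => g j i) r P = powersetSum g (#P - r) P := by
  unfold powersetSum
  refine sum_nbij' (fun I => P \ I) (fun I => P \ I) ?_ ?_ ?_ ?_ ?_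
  · intro I hI
    rw [mem_powersetCard] at hI ⊢
    exact ⟨sdiff_subset, by rw [card_sdiff_of_subset hI.1, hI.2]⟩
  · intro I hI
    rw [mem_powersetCard] at hI ⊢
    exact ⟨sdiff_subset, by rw [card_sdiff_of_subset hI.1, hI.2]; omega⟩
  · intro I hI
    exact Finset.sdiff_sdiff_eq_self (mem_powersetCard.1 hI).1
  · intro I hI
    exact Finset.sdiff_sdiff_eq_self (mem_powersetCard.1 hI).1
  · intro I hI
    simp only
    rw [Finset.sdiff_sdiff_eq_self (mem_powersetCard.1 hI).1, prod_comm]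

section Interval

open Finset

variable {K : Type*} [Field K] {q h : K} {n : ℕ}

/-- The weight of a cut `κ` of the family of intervals `[A s, B s)`. -/
noncomputable def cutWeight (q h : K) (A B κ : Fin n → ℕ) : K :=
  ∏ s : Fin n, ∏ t : Fin n,
    (qPhi q h ((t : ℤ) - s) ((κ t : ℤ) - A s) * qPhi q h ((t : ℤ) - s) ((B t : ℤ) - κ s) /
      (qPhi q h ((t : ℤ) - s) ((κ t : ℤ) - κ s) * qPhi q h ((t : ℤ) - s) ((B t : ℤ) - A s)))

/-- Cuts of size `r`. -/
def cuts (A B : Fin n → ℕ) (r : ℕ) : Finset (Fin n → ℕ) :=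
  {κ ∈ Fintype.piFinset fun s => Icc (A s) (B s) | ∑ s, (κ s - A s) = r}

lemma mem_cuts {A B : Fin n → ℕ} {r : ℕ} {κ : Fin n → ℕ} :
    κ ∈ cuts A B r ↔ (∀ s, A s ≤ κ s ∧ κ s ≤ B s) ∧ ∑ s, (κ s - A s) = r := by
  simp [cuts]

lemma powersetSum_sigma_Ico (H : QGeneric q h) {A B : Fin n → ℕ} (hAB : ∀ s, A s ≤ B s)
    (hord : ∀ s t, s < t → B s ≤ A t) (r : ℕ) :
    powersetSum (fun i j : Σ _ : Fin n, ℕ => ruijG q (h / q) (h ^ (i.1 : ℤ) * q ^ (i.2 : ℤ))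
      (h ^ (j.1 : ℤ) * q ^ (j.2 : ℤ))) r (univ.sigma fun s => Ico (A s) (B s)) =
    ∑ κ ∈ cuts A B r, cutWeight q h A B κ := by
  unfold powersetSum
  symm
  have hmem : ∀ κ : Fin n → ℕ, (∀ s, A s ≤ κ s ∧ κ s ≤ B s) →
      (univ.sigma fun s => Ico (A s) (κ s)) ⊆ univ.sigma fun s => Ico (A s) (B s) := fun κ hκ =>
    sigma_mono subset_rfl fun s => Ico_subset_Ico le_rfl (hκ s).2
  refine sum_of_injOn (fun κ => univ.sigma fun s => Ico (A s) (κ s)) ?_ ?_ ?_ ?_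
  · intro κ hκ κ' hκ' he
    rw [mem_coe, mem_cuts] at hκ hκ'
    ext s
    have : ∀ p, p ∈ Ico (A s) (κ s) ↔ p ∈ Ico (A s) (κ' s) := fun p => by
      have := Finset.ext_iff.1 he ⟨s, p⟩
      simpa using this
    have h3 := congrArg card (Finset.ext this)
    rw [Nat.card_Ico, Nat.card_Ico] at h3
    have := hκ.1 s
    have := hκ'.1 s
    omega
  · intro κ hκ
    rw [mem_coe, mem_cuts] at hκ
    rw [mem_coe, mem_powersetCard]
    exact ⟨hmem κ hκ.1, by simpa using hκ.2⟩
  · intro I hI hI'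
    rw [mem_powersetCard] at hI
    by_contra hne
    have hdown : ∀ s p, A s ≤ p → (⟨s, p + 1⟩ : Σ _ : Fin n, ℕ) ∈ I →
        (⟨s, p⟩ : Σ _ : Fin n, ℕ) ∈ I := by
      intro s p hp hI1
      by_contra hI2
      refine hne (prod_eq_zero hI1 (prod_eq_zero (mem_sdiff.2 ⟨?_, hI2⟩) ?_))
      · have := hI.1 hI1
        simp only [mem_sigma, mem_univ, mem_Ico, true_and] at this ⊢
        omega
      · have : h ^ (s : ℤ) * q ^ ((p + 1 : ℕ) : ℤ) - q * (h ^ (s : ℤ) * q ^ (p : ℤ)) = 0 := by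
          push_cast
          rw [zpow_add_one₀ H.q_ne]; ring
        simp only [ruijG]
        rw [this, zero_mul, zero_div]
    have hdown' : ∀ s p p', A s ≤ p → p ≤ p' → (⟨s, p'⟩ : Σ _ : Fin n, ℕ) ∈ I →
        (⟨s, p⟩ : Σ _ : Fin n, ℕ) ∈ I := by
      intro s p p' hp hpp'
      induction p', hpp' using Nat.le_induction with
      | base => exact id
      | succ p' hp' ih => exact fun h => ih (hdown s p' (hp.trans hp') h)
    set J : Fin n → Finset ℕ := fun s =>
      (Ico (A s) (B s)).filter fun p => (⟨s, p⟩ : Σ _ : Fin n, ℕ) ∈ I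
      with hJ
    set κ : Fin n → ℕ := fun s => A s + #(J s) with hκ
    have hJsub : ∀ s, #(J s) ≤ B s - A s := fun s => by
      rw [← Nat.card_Ico]; exact card_filter_le _ _
    have hκB : ∀ s, A s ≤ κ s ∧ κ s ≤ B s := fun s => by
      have := hJsub s; have := hAB s; simp only [hκ]; omega
    have hJeq : ∀ s, J s = Ico (A s) (κ s) := by
      intro s
      refine eq_of_subset_of_card_le ?_ (by simp [hκ])
      intro p hp
      rw [hJ, mem_filter, mem_Ico] at hp
      rw [mem_Ico]
      refine ⟨hp.1.1, ?_⟩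
      have : Icc (A s) p ⊆ J s := by
        intro p' hp'
        rw [mem_Icc] at hp'
        rw [hJ, mem_filter, mem_Ico]
        exact ⟨⟨hp'.1, by omega⟩, hdown' s p' p hp'.1 hp'.2 hp.2⟩
      have := card_le_card this
      rw [Nat.card_Icc] at this
      simp only [hκ]
      omega
    have hIeq : (univ.sigma fun s => Ico (A s) (κ s)) = I := by
      ext ⟨s, p⟩
      simp only [← hJeq, mem_sigma, mem_univ, true_and, hJ, mem_filter]
      refine ⟨fun h => h.2, fun h => ⟨?_, h⟩⟩
      have := hI.1 h
      simpa using this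
    refine hI' ⟨κ, ?_, hIeq⟩
    rw [mem_coe, mem_cuts]
    refine ⟨hκB, ?_⟩
    rw [← hI.2, ← hIeq]
    simp
  · intro κ hκ
    rw [mem_cuts] at hκ
    have hsd : (univ.sigma fun s => Ico (A s) (B s)) \ (univ.sigma fun s => Ico (A s) (κ s)) =
        univ.sigma fun s => Ico (κ s) (B s) := by
      ext ⟨s, p⟩
      have := hκ.1 s
      simp only [mem_sdiff, mem_sigma, mem_univ, true_and, mem_Ico]
      omega
    rw [hsd, prod_sigma, cutWeight]
    refine prod_congr rfl fun s _ => ?_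
    simp only [prod_sigma]
    rw [prod_comm]
    refine prod_congr rfl fun t _ => ?_
    refine (prod_Ico_ruijG H s t (hκ.1 s).1 (hκ.1 t).2 ?_ ?_).symm
    · intro hst
      obtain rfl : t = s := Fin.ext (by exact_mod_cast hst)
      rfl
    · intro hst
      exact hord t s (Fin.lt_def.2 (by omega))

/-- The generating function of cuts is palindromic. -/
theorem sum_cuts_symm (H : QGeneric q h) {A B : Fin n → ℕ} (hAB : ∀ s, A s ≤ B s)
    (hord : ∀ s t, s < t → B s ≤ A t) {r : ℕ} (hr : r ≤ ∑ s, (B s - A s)) :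
    ∑ κ ∈ cuts A B r, cutWeight q h A B κ =
      ∑ κ ∈ cuts A B (∑ s, (B s - A s) - r), cutWeight q h A B κ := by
  have hq := H.q_ne
  have hh := H.h_ne
  have hcard : #(univ.sigma fun s => Ico (A s) (B s)) = ∑ s, (B s - A s) := by simp
  rw [← powersetSum_sigma_Ico H hAB hord, ← powersetSum_sigma_Ico H hAB hord, ← hcard,
    ← powersetSum_swap _ (hcard ▸ hr)]
  have e : q * (h / q) = h := mul_div_cancel₀ _ hq
  refine powersetSum_ruijG_symm (e.symm ▸ hh : q * (h / q) ≠ 0) ?_ _ _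
    (fun i _ => mul_ne_zero (zpow_ne_zero _ hh) (zpow_ne_zero _ hq)) ?_ r
  · rw [e]
    intro h0
    have := (H.indep 0 2 (by simpa using h0)).2
    omega
  · rintro ⟨s, p⟩ hs ⟨t, p'⟩ ht hne
    simp only [mem_sigma, mem_univ, mem_Ico, true_and] at hs ht
    have hpp : p ≠ p' := by
      rintro rfl
      rcases lt_trichotomy s t with h1 | rfl | h1
      · have := hord _ _ h1; omega
      · exact hne rfl
      · have := hord _ _ h1; omega
    have key : ∀ e : ℤ, h ^ (s : ℤ) * q ^ (p : ℤ) ≠ h ^ e * (h ^ (t : ℤ) * q ^ (p' : ℤ)) := by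
      intro e h0
      rw [← mul_assoc, ← zpow_add₀ hh] at h0
      have := (H.indep (p - p') (s - (e + t)) (by
        rw [zpow_sub₀ hq, zpow_sub₀ hh, div_mul_div_comm, mul_comm, h0, mul_comm]
        exact div_self (mul_ne_zero (zpow_ne_zero _ hq) (zpow_ne_zero _ hh)))).1
      omega
    rw [e]
    refine ⟨?_, ?_, ?_⟩
    · simpa using key 0
    · simpa using key 1
    · exact_mod_cast key 2

end Interval

section QLim

open Filter Polynomial

variable {K : Type*} [Field K] {q h : K}

/-- `f` is eventually a rational function of `q ^ M`, regular at `0` with value `l`. -/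
def QLim (q : K) (f : ℕ → K) (l : K) : Prop :=
  ∃ N D : K[X], N.eval 0 = l ∧ D.eval 0 = 1 ∧
    ∀ᶠ M in atTop, f M * D.eval (q ^ M) = N.eval (q ^ M)

lemma QGeneric.pow_injective (H : QGeneric q h) : Function.Injective fun M : ℕ => q ^ M := by
  intro m n hmn
  have := (H.indep (m - n) 0 (by
    rw [zpow_sub₀ H.q_ne, zpow_zero, mul_one]
    simp only [zpow_natCast]
    simp only at hmn
    rw [hmn, div_self (pow_ne_zero _ H.q_ne)])).1
  omega

lemma QGeneric.eventually_eval_ne (H : QGeneric q h) {P : K[X]} (hP : P ≠ 0) :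
    ∀ᶠ M : ℕ in atTop, P.eval (q ^ M) ≠ 0 := by
  classical
  rw [← Nat.cofinite_eq_atTop]
  have hfin : Set.Finite {M : ℕ | P.eval (q ^ M) = 0} := by
    refine Set.Finite.preimage (f := fun M : ℕ => q ^ M) (s := {x | P.eval x = 0})
      H.pow_injective.injOn ?_
    refine (P.roots.toFinset.finite_toSet).subset fun x hx => ?_
    simpa [hP] using hx
  exact hfin.compl_mem_cofinite

lemma QLim.unique (H : QGeneric q h) {f : ℕ → K} {l l' : K} (hl : QLim q f l)
    (hl' : QLim q f l') : l = l' := by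
  obtain ⟨N, D, rfl, hD, hf⟩ := hl
  obtain ⟨N', D', rfl, hD', hf'⟩ := hl'
  have h0 : N * D' - N' * D = 0 := by
    by_contra hne
    obtain ⟨M, h1, h2, h3⟩ := (hf.and (hf'.and (H.eventually_eval_ne hne))).exists
    refine h3 ?_
    rw [eval_sub, eval_mul, eval_mul, ← h1, ← h2]
    ring
  have := congrArg (eval 0) h0
  rw [eval_sub, eval_mul, eval_mul, hD, hD', mul_one, mul_one, eval_zero] at this
  exact sub_eq_zero.1 this

lemma QLim.congr {f g : ℕ → K} {l : K} (hf : QLim q f l) (hfg : ∀ᶠ M in atTop, g M = f M) :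
    QLim q g l := by
  obtain ⟨N, D, hN, hD, hf⟩ := hf
  exact ⟨N, D, hN, hD, by filter_upwards [hf, hfg] with M h1 h2; rw [h2, h1]⟩

lemma QLim.const (l : K) : QLim q (fun _ => l) l :=
  ⟨C l, 1, by simp, by simp, by simp⟩

lemma QLim.mul {f g : ℕ → K} {l l' : K} (hf : QLim q f l) (hg : QLim q g l') :
    QLim q (fun M => f M * g M) (l * l') := by
  obtain ⟨N, D, rfl, hD, hf⟩ := hf
  obtain ⟨N', D', rfl, hD', hg⟩ := hg
  refine ⟨N * N', D * D', by simp, by simp [hD, hD'], ?_⟩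
  filter_upwards [hf, hg] with M h1 h2
  rw [eval_mul, eval_mul, ← h1, ← h2]
  ring

lemma QLim.add {f g : ℕ → K} {l l' : K} (hf : QLim q f l) (hg : QLim q g l') :
    QLim q (fun M => f M + g M) (l + l') := by
  obtain ⟨N, D, rfl, hD, hf⟩ := hf
  obtain ⟨N', D', rfl, hD', hg⟩ := hg
  refine ⟨N * D' + N' * D, D * D', by simp [hD, hD'], by simp [hD, hD'], ?_⟩
  filter_upwards [hf, hg] with M h1 h2
  rw [eval_mul, eval_add, eval_mul, eval_mul, ← h1, ← h2]
  ring

lemma QLim.inv (H : QGeneric q h) {f : ℕ → K} {l : K} (hf : QLim q f l) (hl : l ≠ 0) :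
    QLim q (fun M => (f M)⁻¹) l⁻¹ := by
  obtain ⟨N, D, rfl, hD, hf⟩ := hf
  have hN : N ≠ 0 := by rintro rfl; simp at hl
  refine ⟨C (N.eval 0)⁻¹ * D, C (N.eval 0)⁻¹ * N, by simp [hD], by simp [hl], ?_⟩
  filter_upwards [hf, H.eventually_eval_ne hN] with M h1 h2
  have : f M ≠ 0 := by rintro h0; rw [h0, zero_mul] at h1; exact h2 h1.symm
  rw [eval_mul, eval_mul, ← h1]
  field_simp

lemma QLim.sum {ι : Type*} {s : Finset ι} {f : ι → ℕ → K} {l : ι → K}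
    (hf : ∀ i ∈ s, QLim q (f i) (l i)) : QLim q (fun M => ∑ i ∈ s, f i M) (∑ i ∈ s, l i) := by
  classical
  induction s using Finset.induction_on with
  | empty => simpa using QLim.const (q := q) (0 : K)
  | insert a s ha ih =>
    simp only [Finset.sum_insert ha]
    exact (hf a (by simp)).add (ih fun i hi => hf i (by simp [hi]))

lemma QLim.prod {ι : Type*} {s : Finset ι} {f : ι → ℕ → K} {l : ι → K}
    (hf : ∀ i ∈ s, QLim q (f i) (l i)) : QLim q (fun M => ∏ i ∈ s, f i M) (∏ i ∈ s, l i) := by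
  classical
  induction s using Finset.induction_on with
  | empty => simpa using QLim.const (q := q) (1 : K)
  | insert a s ha ih =>
    simp only [Finset.prod_insert ha]
    exact (hf a (by simp)).mul (ih fun i hi => hf i (by simp [hi]))

lemma qLim_qPsi (H : QGeneric q h) (k c : ℤ) : QLim q (fun M => qPsi q h k (M + c)) 1 := by
  have e : ∀ x : K, QLim q (fun M => 1 - x * q ^ ((M : ℤ) + c)) 1 := fun x => by
    refine ⟨1 - C (x * q ^ c) * X, 1, by simp, by simp, .of_forall fun M => ?_⟩
    simp [zpow_add₀ H.q_ne]
    ring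
  have := (e (h * h ^ k)).mul ((e (q * h ^ k)).inv H one_ne_zero)
  simpa [qPsi, div_eq_mul_inv] using this

lemma qLim_qPhi_div (H : QGeneric q h) {k : ℤ} (hk : 0 ≤ k) (c c' : ℤ) :
    QLim q (fun M => qPhi q h k (M + c) / qPhi q h k (M + c')) 1 := by
  have key : ∀ (c' : ℤ) (n : ℕ),
      QLim q (fun M => qPhi q h k (M + (c' + n)) / qPhi q h k (M + c')) 1 := by
    intro c' n
    induction n with
    | zero =>
      refine (QLim.const 1).congr ?_
      filter_upwards [eventually_ge_atTop (-c').toNat] with M hM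
      simp only [Nat.cast_zero, add_zero]
      exact div_self (qPhi_ne_zero H (by omega) (by omega))
    | succ n ih =>
      have := ih.mul (qLim_qPsi H k (c' + n))
      rw [mul_one] at this
      refine this.congr ?_
      filter_upwards [eventually_ge_atTop (-c').toNat] with M hM
      rw [div_mul_eq_mul_div, ← qPhi_succ H (by omega)]
      push_cast
      congr 2
      ring
  rcases le_total c' c with hc | hc
  · have := key c' (c - c').toNat
    rwa [Int.toNat_of_nonneg (by omega), add_sub_cancel] at this
  · have := (key c (c' - c).toNat).inv H one_ne_zero
    rw [Int.toNat_of_nonneg (by omega), add_sub_cancel] at this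
    simpa [inv_div] using this

lemma qLim_qPhi_div_neg (H : QGeneric q h) {k : ℤ} (hk : k ≤ -1) (c c' : ℤ) :
    QLim q (fun M => qPhi q h k (c - M) / qPhi q h k (c' - M)) ((q / h) ^ (c' - c)) := by
  have hqh : q / h ≠ 0 := div_ne_zero H.q_ne H.h_ne
  have := (QLim.const ((q / h) ^ (c' - c))).mul
    (qLim_qPhi_div H (k := -1 - k) (by omega) (-c) (-c'))
  rw [mul_one] at this
  refine this.congr (.of_forall fun M => ?_)
  have e : ∀ c : ℤ, qPhi q h k (c - M) = (q / h) ^ ((M : ℤ) + -c) * qPhi q h (-1 - k) (M + -c) := by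
    intro c
    rw [← qPhi_reflect H]
    congr 1 <;> ring
  rw [e, e, mul_div_mul_comm, ← zpow_sub₀ hqh]
  congr 2
  ring

end QLim

section Limit

open Filter Finset

variable {K : Type*} [Field K] {q h : K} {L : ℕ}

lemma prod_zpow_eq_zpow_sum {ι : Type*} {x : K} (hx : x ≠ 0) (s : Finset ι) (f : ι → ℤ) :
    ∏ i ∈ s, x ^ f i = x ^ ∑ i ∈ s, f i := by
  classical
  induction s using Finset.induction_on with
  | empty => simp
  | insert a s ha ih => rw [prod_insert ha, sum_insert ha, zpow_add₀ hx, ih]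

/-- The intervals `[A s, B s)`, completed by a last one of length `M`. -/
def extendTop (A : Fin (L + 1) → ℕ) (B : Fin L → ℕ) (M : ℕ) : Fin (L + 1) → ℕ :=
  Fin.snoc B (A (Fin.last L) + M)

@[simp] lemma extendTop_castSucc (A : Fin (L + 1) → ℕ) (B : Fin L → ℕ) (M : ℕ) (s : Fin L) :
    extendTop A B M s.castSucc = B s := by simp [extendTop]

@[simp] lemma extendTop_last (A : Fin (L + 1) → ℕ) (B : Fin L → ℕ) (M : ℕ) :
    extendTop A B M (Fin.last L) = A (Fin.last L) + M := by simp [extendTop]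

/-- The constant by which the limits of cut weights are normalized. -/
noncomputable def cutNorm (q h : K) (A : Fin (L + 1) → ℕ) (B : Fin L → ℕ) : K :=
  ∏ s : Fin (L + 1), ∏ t : Fin L, qPhi q h ((t : ℤ) - s) ((B t : ℤ) - A s)

/-- The normalized limit weight of a lower cut. -/
noncomputable def lowerWeight (q h : K) (A : Fin (L + 1) → ℕ) (B : Fin L → ℕ)
    (κ : Fin (L + 1) → ℕ) : K :=
  (∏ s : Fin (L + 1), ∏ t : Fin (L + 1),
    qPhi q h ((t : ℤ) - s) ((κ t : ℤ) - A s) / qPhi q h ((t : ℤ) - s) ((κ t : ℤ) - κ s)) *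
  ∏ s : Fin (L + 1), ∏ t : Fin L, qPhi q h ((t : ℤ) - s) ((B t : ℤ) - κ s)

/-- The normalized limit weight of an upper cut. -/
noncomputable def upperWeight (q h : K) (A : Fin (L + 1) → ℕ) (B : Fin L → ℕ)
    (τ : Fin L → ℕ) : K :=
  (∏ s : Fin (L + 1), ∏ t : Fin L, qPhi q h ((t : ℤ) - s) ((τ t : ℤ) - A s)) *
  ∏ s : Fin L, ∏ t : Fin L,
    qPhi q h ((t : ℤ) - s) ((B t : ℤ) - τ s) / qPhi q h ((t : ℤ) - s) ((τ t : ℤ) - τ s)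

lemma qLim_cutWeight_lower (H : QGeneric q h) {A : Fin (L + 1) → ℕ} {B : Fin L → ℕ}
    (κ : Fin (L + 1) → ℕ) :
    QLim q (fun M => cutWeight q h A (extendTop A B M) κ)
      (lowerWeight q h A B κ / cutNorm q h A B) := by
  have : QLim q (fun M => cutWeight q h A (extendTop A B M) κ)
      (∏ s : Fin (L + 1), ((∏ t : Fin L, qPhi q h ((t : ℤ) - s) ((κ t.castSucc : ℤ) - A s) *
        qPhi q h ((t : ℤ) - s) ((B t : ℤ) - κ s) /
        (qPhi q h ((t : ℤ) - s) ((κ t.castSucc : ℤ) - κ s) *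
          qPhi q h ((t : ℤ) - s) ((B t : ℤ) - A s))) *
        (qPhi q h ((L : ℤ) - s) ((κ (Fin.last L) : ℤ) - A s) /
          qPhi q h ((L : ℤ) - s) ((κ (Fin.last L) : ℤ) - κ s) * 1))) := by
    simp only [cutWeight, Fin.prod_univ_castSucc (n := L) (M := K) fun t : Fin (L + 1) =>
      _ * _ / (_ * _), extendTop_castSucc, extendTop_last, Fin.val_castSucc, Fin.val_last]
    refine QLim.prod fun s _ => (QLim.const _).mul ?_
    refine ((QLim.const _).mul (qLim_qPhi_div H (k := (L : ℤ) - s) (by omega)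
      ((A (Fin.last L) : ℤ) - κ s) ((A (Fin.last L) : ℤ) - A s))).congr (.of_forall fun M => ?_)
    rw [mul_div_mul_comm]
    push_cast
    congr 3 <;> ring
  convert this using 1
  rw [lowerWeight, cutNorm, ← prod_mul_distrib, ← prod_div_distrib]
  refine prod_congr rfl fun s _ => ?_
  rw [Fin.prod_univ_castSucc]
  simp only [prod_div_distrib, prod_mul_distrib, Fin.val_castSucc, Fin.val_last]
  ring

lemma qLim_cutWeight_upper (H : QGeneric q h) {A : Fin (L + 1) → ℕ} {B : Fin L → ℕ}
    (τ : Fin L → ℕ) (k : ℕ) :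
    QLim q (fun M => cutWeight q h A (extendTop A B M) (Fin.snoc τ (A (Fin.last L) + (M - k))))
      (qPhi q h 0 k * (q / h) ^ (∑ t, ((τ t : ℤ) - B t)) * upperWeight q h A B τ /
        cutNorm q h A B) := by
  have hqh : q / h ≠ 0 := div_ne_zero H.q_ne H.h_ne
  have : QLim q (fun M => cutWeight q h A (extendTop A B M)
        (Fin.snoc τ (A (Fin.last L) + (M - k))))
      ((∏ s : Fin L, ((∏ t : Fin L, qPhi q h ((t : ℤ) - s) ((τ t : ℤ) - A s.castSucc) *
        qPhi q h ((t : ℤ) - s) ((B t : ℤ) - τ s) /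
        (qPhi q h ((t : ℤ) - s) ((τ t : ℤ) - τ s) *
          qPhi q h ((t : ℤ) - s) ((B t : ℤ) - A s.castSucc))) * (1 * 1))) *
        ((∏ t : Fin L, (qPhi q h ((t : ℤ) - L) ((τ t : ℤ) - A (Fin.last L)) /
          qPhi q h ((t : ℤ) - L) ((B t : ℤ) - A (Fin.last L)) *
            (q / h) ^ ((τ t : ℤ) - B t))) * (qPhi q h 0 k * 1))) := by
    simp only [cutWeight, Fin.prod_univ_castSucc (n := L) (M := K), extendTop_castSucc,
      extendTop_last, Fin.val_castSucc, Fin.val_last, Fin.snoc_castSucc, Fin.snoc_last]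
    refine (QLim.prod fun s _ => (QLim.const _).mul ?_).mul
      ((QLim.prod fun t _ => ?_).mul ?_)
    · refine ((qLim_qPhi_div H (k := (L : ℤ) - s) (by omega)
        ((A (Fin.last L) : ℤ) - k - A s.castSucc) ((A (Fin.last L) : ℤ) - k - τ s)).mul
        (qLim_qPhi_div H (k := (L : ℤ) - s) (by omega) ((A (Fin.last L) : ℤ) - τ s)
          ((A (Fin.last L) : ℤ) - A s.castSucc))).congr ?_
      filter_upwards [eventually_ge_atTop k] with M hM
      rw [mul_div_mul_comm]
      push_cast [hM]
      congr 3 <;> ring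
    · have e : (q / h) ^ ((τ t : ℤ) - B t) = (q / h) ^ ((τ t : ℤ) + k - A (Fin.last L) -
          ((B t : ℤ) + k - A (Fin.last L))) := by congr 1; ring
      rw [e]
      refine QLim.congr ((QLim.const _).mul (qLim_qPhi_div_neg H (k := (t : ℤ) - L) (by omega)
        ((B t : ℤ) + k - A (Fin.last L)) ((τ t : ℤ) + k - A (Fin.last L)))) ?_
      filter_upwards [eventually_ge_atTop k] with M hM
      rw [div_mul_div_comm, mul_comm (qPhi q h ((t : ℤ) - L) ((B t : ℤ) - A (Fin.last L)))]
      push_cast [hM]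
      congr 3 <;> ring
    · refine QLim.congr ((QLim.const _).mul (qLim_qPhi_div H (k := 0) le_rfl (-k : ℤ) 0)) ?_
      filter_upwards [eventually_ge_atTop k] with M hM
      rw [← mul_div_assoc, mul_comm]
      push_cast [hM]
      rw [sub_self, sub_self, qPhi_zero, one_mul]
      rw [show (A (Fin.last L) : ℤ) + (M - k) - A (Fin.last L) = M + -k by ring,
        show (A (Fin.last L) : ℤ) + M - (A (Fin.last L) + (M - k)) = k by ring,
        show (A (Fin.last L) : ℤ) + M - A (Fin.last L) = M + 0 by ring]
  convert this using 1
  rw [upperWeight, cutNorm]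
  simp only [Fin.prod_univ_castSucc (n := L) (M := K), prod_div_distrib, prod_mul_distrib,
    Fin.val_castSucc, Fin.val_last, mul_one]
  rw [prod_zpow_eq_zpow_sum hqh]
  ring
end Limit

section Limit

open Filter Finset

variable {K : Type*} [Field K] {q h : K} {L : ℕ}

/-- Upper cuts of size `j`. -/
def upperCuts (A : Fin (L + 1) → ℕ) (B : Fin L → ℕ) (j : ℕ) : Finset (Fin L → ℕ) :=
  {τ ∈ Fintype.piFinset fun s : Fin L => Icc (A s.castSucc) (B s) | ∑ s, (B s - τ s) = j}

lemma cuts_extendTop_of_le (A : Fin (L + 1) → ℕ) (B : Fin L → ℕ) {r M : ℕ} (hM : r ≤ M) :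
    cuts A (extendTop A B M) r = cuts A (extendTop A B r) r := by
  ext κ
  simp only [mem_cuts, Fin.forall_fin_succ', extendTop_castSucc, extendTop_last]
  refine ⟨fun ⟨⟨h1, h2⟩, h3⟩ => ⟨⟨h1, h2.1, ?_⟩, h3⟩, fun ⟨⟨h1, h2⟩, h3⟩ => ⟨⟨h1, h2.1, ?_⟩, h3⟩⟩
  · have := single_le_sum (f := fun s => κ s - A s) (fun _ _ => Nat.zero_le _)
      (mem_univ (Fin.last L))
    omega
  · omega

/-- The limit of the palindromic identity when the last interval becomes infinite. -/
theorem sum_lowerWeight_eq (H : QGeneric q h) {A : Fin (L + 1) → ℕ} {B : Fin L → ℕ}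
    (hAB : ∀ s : Fin L, A s.castSucc ≤ B s)
    (hord : ∀ (s : Fin L) (t : Fin (L + 1)), s.castSucc < t → B s ≤ A t) (r : ℕ) :
    ∑ κ ∈ cuts A (extendTop A B r) r, lowerWeight q h A B κ =
      ∑ k ∈ range (r + 1), ∑ τ ∈ upperCuts A B (r - k),
        qPhi q h 0 k * (q / h) ^ (∑ t, ((τ t : ℤ) - B t)) * upperWeight q h A B τ := by
  have hC : cutNorm q h A B ≠ 0 := by
    refine prod_ne_zero_iff.2 fun s _ => prod_ne_zero_iff.2 fun t _ => qPhi_ne_zero H ?_ ?_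
    · intro h0
      obtain rfl : s = t.castSucc := Fin.ext (by simp; omega)
      have := hAB t
      omega
    · intro h0
      have := hord t s (Fin.lt_def.2 (by simp; omega))
      omega
  have key : (∑ κ ∈ cuts A (extendTop A B r) r, lowerWeight q h A B κ / cutNorm q h A B) =
      ∑ k ∈ range (r + 1), ∑ τ ∈ upperCuts A B (r - k),
        qPhi q h 0 k * (q / h) ^ (∑ t, ((τ t : ℤ) - B t)) * upperWeight q h A B τ /
          cutNorm q h A B := by
    refine QLim.unique H (QLim.sum fun κ _ => qLim_cutWeight_lower H κ)
      (QLim.congr (QLim.sum fun k _ => QLim.sum fun τ _ => qLim_cutWeight_upper H τ k) ?_)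
    filter_upwards [eventually_ge_atTop r] with M hM
    have hABM : ∀ s, A s ≤ extendTop A B M s := by
      rw [Fin.forall_fin_succ']
      exact ⟨fun s => by simpa using hAB s, by simp⟩
    have hordM : ∀ s t, s < t → extendTop A B M s ≤ A t := by
      rw [Fin.forall_fin_succ']
      exact ⟨fun s t h => by simpa using hord s t h, fun t ht => absurd ht (Fin.le_last t).not_gt⟩
    have htot : ∑ s, (extendTop A B M s - A s) = ∑ s : Fin L, (B s - A s.castSucc) + M := by
      simp [Fin.sum_univ_castSucc]
    rw [← cuts_extendTop_of_le A B hM, sum_cuts_symm H hABM hordM (by omega), sum_sigma']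
    refine sum_nbij' (fun κ => ⟨A (Fin.last L) + M - κ (Fin.last L), Fin.init κ⟩)
      (fun p => Fin.snoc p.2 (A (Fin.last L) + (M - p.1))) ?_ ?_ ?_ ?_ ?_
    · intro κ hκ
      simp only [mem_cuts, Fin.forall_fin_succ', extendTop_castSucc, extendTop_last,
        Fin.sum_univ_castSucc, htot] at hκ
      obtain ⟨⟨h1, h2⟩, h3⟩ := hκ
      have e : ∑ s : Fin L, (κ s.castSucc - A s.castSucc) + ∑ s : Fin L, (B s - κ s.castSucc) =
          ∑ s : Fin L, (B s - A s.castSucc) := by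
        rw [← sum_add_distrib]
        exact sum_congr rfl fun s _ => by have := h1 s; omega
      simp only [mem_sigma, mem_range, upperCuts, mem_filter, Fintype.mem_piFinset, mem_Icc,
        Fin.init]
      refine ⟨by omega, h1, by omega⟩
    · rintro ⟨k, τ⟩ hp
      simp only [mem_sigma, mem_range, upperCuts, mem_filter, Fintype.mem_piFinset, mem_Icc] at hp
      obtain ⟨hk, h1, h3⟩ := hp
      have e : ∑ s : Fin L, (τ s - A s.castSucc) + ∑ s : Fin L, (B s - τ s) =
          ∑ s : Fin L, (B s - A s.castSucc) := by
        rw [← sum_add_distrib]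
        exact sum_congr rfl fun s _ => by have := h1 s; omega
      simp only [mem_cuts, Fin.forall_fin_succ', extendTop_castSucc, extendTop_last,
        Fin.sum_univ_castSucc, htot, Fin.snoc_castSucc, Fin.snoc_last]
      exact ⟨⟨h1, by omega, by omega⟩, by omega⟩
    · intro κ hκ
      simp only [mem_cuts, Fin.forall_fin_succ', extendTop_castSucc, extendTop_last] at hκ
      ext s
      refine Fin.lastCases ?_ (fun s => ?_) s
      · simp only [Fin.snoc_last]; omega
      · simp [Fin.init]
    · rintro ⟨k, τ⟩ hp
      simp only [mem_sigma, mem_range] at hp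
      simp only [Fin.snoc_last, Fin.init_snoc]
      congr 1
      omega
    · intro κ hκ
      simp only [mem_cuts, Fin.forall_fin_succ', extendTop_castSucc, extendTop_last] at hκ
      congr 1
      ext s
      refine Fin.lastCases ?_ (fun s => ?_) s
      · simp only [Fin.snoc_last]; omega
      · simp [Fin.init]
  simp only [← sum_div] at key
  exact (div_left_inj' hC).1 key

end Limit

section Stack

open Finset

variable {K : Type*} [Field K] {q h : K} {L n : ℕ}

/-- The weight of the values `κ` on a diagonal, in terms of the values `a`, `v`, `w` on the
adjacent diagonals. -/
noncomputable def stackWeight (q h : K) (a : ℕ) (v w : Fin L → ℕ) (κ : Fin n → ℕ) : K :=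
  (∏ t : Fin n, qPhi q h t ((κ t : ℤ) - a)) *
    (∏ i : Fin L, ∏ t : Fin n, qPhi q h ((t : ℤ) - i - 1) ((κ t : ℤ) - v i) *
      qPhi q h ((t : ℤ) - i - 1) ((κ t : ℤ) - w i)) /
    ∏ s : Fin n, ∏ t : Fin n, qPhi q h ((t : ℤ) - s) ((κ t : ℤ) - κ s)

lemma stackWeight_max_min (a : ℕ) (v w : Fin L → ℕ) (κ : Fin n → ℕ) :
    stackWeight q h a (fun i => max (v i) (w i)) (fun i => min (v i) (w i)) κ =
      stackWeight q h a v w κ := by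
  unfold stackWeight
  congr 2
  refine prod_congr rfl fun i _ => prod_congr rfl fun t _ => ?_
  rcases le_total (v i) (w i) with h1 | h1
  · simp only [max_eq_right h1, min_eq_left h1, mul_comm]
  · simp only [max_eq_left h1, min_eq_right h1]

lemma interlace_of_stackWeight_ne_zero (H : QGeneric q h) {a : ℕ} {v w : Fin L → ℕ}
    {κ : Fin n → ℕ} (hκ : stackWeight q h a v w κ ≠ 0) (t : Fin n) :
    ((t : ℕ) = 0 → a ≤ κ t) ∧ (∀ i : Fin L, (t : ℕ) = i + 1 → max (v i) (w i) ≤ κ t) ∧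
      ∀ i : Fin L, (t : ℕ) = i → κ t ≤ min (v i) (w i) := by
  rw [stackWeight, div_ne_zero_iff, mul_ne_zero_iff, prod_ne_zero_iff, prod_ne_zero_iff] at hκ
  obtain ⟨⟨h1, h2⟩, -⟩ := hκ
  simp only [prod_ne_zero_iff, mem_univ, true_imp_iff, mul_ne_zero_iff] at h1 h2
  refine ⟨fun h0 => ?_, fun i hi => ?_, fun i hi => ?_⟩
  · by_contra hlt
    refine h1 t ?_
    rw [h0]
    exact qPhi_zero_of_neg H (by omega)
  · have := h2 i t
    rw [show (t : ℤ) - i - 1 = 0 by omega] at this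
    by_contra hlt
    rcases lt_max_iff.1 (not_le.1 hlt) with h3 | h3
    · exact this.1 (qPhi_zero_of_neg H (by omega))
    · exact this.2 (qPhi_zero_of_neg H (by omega))
  · have := h2 i t
    rw [show (t : ℤ) - i - 1 = -1 by omega] at this
    by_contra hlt
    rcases min_lt_iff.1 (not_le.1 hlt) with h3 | h3
    · exact this.1 (qPhi_neg_one_of_pos H (by omega))
    · exact this.2 (qPhi_neg_one_of_pos H (by omega))

lemma prod_qPhi_reflect (H : QGeneric q h) (B : Fin L → ℕ) (κ : Fin n → ℕ) :
    ∏ s : Fin n, ∏ t : Fin L, qPhi q h ((t : ℤ) - s) ((B t : ℤ) - κ s) =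
      (q / h) ^ (L * ∑ s, (κ s : ℤ) - n * ∑ t, (B t : ℤ)) *
        ∏ t : Fin L, ∏ s : Fin n, qPhi q h ((s : ℤ) - t - 1) ((κ s : ℤ) - B t) := by
  have hqh : q / h ≠ 0 := div_ne_zero H.q_ne H.h_ne
  have e : ∀ (s : Fin n) (t : Fin L), qPhi q h ((t : ℤ) - s) ((B t : ℤ) - κ s) =
      (q / h) ^ ((κ s : ℤ) - B t) * qPhi q h ((s : ℤ) - t - 1) ((κ s : ℤ) - B t) := fun s t => by
    rw [← qPhi_reflect H]
    congr 1 <;> ring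
  simp only [e, prod_mul_distrib, prod_zpow_eq_zpow_sum hqh]
  rw [prod_comm]
  congr 2
  simp [sum_sub_distrib, mul_sum]

lemma lowerWeight_eq (H : QGeneric q h) (a : ℕ) (v w : Fin L → ℕ) (κ : Fin (L + 1) → ℕ) :
    lowerWeight q h (Fin.cons a v : Fin (L + 1) → ℕ) w κ =
      (q / h) ^ (L * ∑ s, (κ s : ℤ) - (L + 1) * ∑ t, (w t : ℤ)) * stackWeight q h a v w κ := by
  rw [lowerWeight, prod_qPhi_reflect H, stackWeight]
  simp only [prod_div_distrib]
  rw [Fin.prod_univ_succ (fun s : Fin (L + 1) => ∏ t : Fin (L + 1), qPhi q h ((t : ℤ) - s)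
    ((κ t : ℤ) - (Fin.cons a v : Fin (L + 1) → ℕ) s))]
  simp only [Fin.cons_zero, Fin.cons_succ, Fin.val_zero, Fin.val_succ, prod_mul_distrib,
    sub_sub, Nat.cast_add, Nat.cast_one, Nat.cast_zero, sub_zero]
  ring

lemma upperWeight_eq (H : QGeneric q h) (a : ℕ) (v w : Fin L → ℕ) (τ : Fin L → ℕ) :
    upperWeight q h (Fin.cons a v : Fin (L + 1) → ℕ) w τ =
      (q / h) ^ (L * ∑ s, (τ s : ℤ) - L * ∑ t, (w t : ℤ)) * stackWeight q h a v w τ := by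
  simp only [upperWeight, prod_div_distrib]
  rw [prod_qPhi_reflect H w τ, stackWeight]
  rw [Fin.prod_univ_succ (fun s : Fin (L + 1) => ∏ t : Fin L, qPhi q h ((t : ℤ) - s)
    ((τ t : ℤ) - (Fin.cons a v : Fin (L + 1) → ℕ) s))]
  simp only [Fin.cons_zero, Fin.cons_succ, Fin.val_zero, Fin.val_succ, prod_mul_distrib,
    sub_sub, Nat.cast_add, Nat.cast_one, Nat.cast_zero, sub_zero]
  ring

/-- The toggle identity for interlacing neighbours. -/
theorem finsum_stackWeight_aux (H : QGeneric q h) (a : ℕ) {v w : Fin L → ℕ} (hvw : ∀ i, w i ≤ v i)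
    (m : ℤ) {R : ℕ} (hR : m < R) :
    ∑ᶠ κ : Fin (L + 1) → ℕ, (if ∑ s, (κ s : ℤ) = m then stackWeight q h a v w κ else 0) =
      ∑ k ∈ range R, qPhi q h 0 k *
        (q / h) ^ ((L + 1) * (a + ∑ i, (v i : ℤ) + ∑ i, (w i : ℤ) + k - m) - L * m) *
        ∑ᶠ τ : Fin L → ℕ, (if ∑ s, (τ s : ℤ) = a + ∑ i, (v i : ℤ) + ∑ i, (w i : ℤ) + k - m then
          stackWeight q h a v w τ else 0) := by
  have hqh : q / h ≠ 0 := div_ne_zero H.q_ne H.h_ne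
  set A : Fin (L + 1) → ℕ := Fin.cons a v with hA
  have hAsum : ∑ s, (A s : ℤ) = a + ∑ i, (v i : ℤ) := by simp [hA, Fin.sum_univ_succ]
  have hAκ : ∀ {n : ℕ} (κ : Fin n → ℕ), stackWeight q h a v w κ ≠ 0 → ∀ (t : Fin n)
      (s : Fin (L + 1)), (t : ℕ) = s → A s ≤ κ t := by
    intro n κ hκ t s hts
    obtain ⟨h1, h2, -⟩ := interlace_of_stackWeight_ne_zero H hκ t
    induction s using Fin.cases with
    | zero => simpa [hA] using h1 hts
    | succ i => simpa [hA] using (le_max_left _ _).trans (h2 i (by simpa using hts))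
  have hκB : ∀ {n : ℕ} (κ : Fin n → ℕ), stackWeight q h a v w κ ≠ 0 → ∀ (t : Fin n)
      (s : Fin L), (t : ℕ) = s → κ t ≤ w s := by
    intro n κ hκ t s hts
    exact ((interlace_of_stackWeight_ne_zero H hκ t).2.2 s hts).trans (min_le_right _ _)
  by_cases hAB : ∀ s : Fin L, A s.castSucc ≤ w s
  swap
  · have hz : ∀ {n : ℕ} (_ : L ≤ n) (κ : Fin n → ℕ), stackWeight q h a v w κ = 0 := by
      intro n hn κ
      by_contra hne
      refine hAB fun s => ?_
      exact (hAκ κ hne ⟨s, by omega⟩ s.castSucc rfl).trans (hκB κ hne ⟨s, by omega⟩ s rfl)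
    simp [hz le_rfl, hz L.le_succ]
  have hmono : Monotone A := Fin.monotone_iff_le_succ.2 fun i => by
    have := hAB i
    have := hvw i
    simp only [hA, Fin.cons_succ] at *
    omega
  have hord : ∀ (s : Fin L) (t : Fin (L + 1)), s.castSucc < t → w s ≤ A t := fun s t hst => by
    have h1 : A s.succ ≤ A t := hmono (Fin.castSucc_lt_iff_succ_le.1 hst)
    have := hvw s
    simp only [hA, Fin.cons_succ] at *
    omega
  have hupper0 : ∀ k : ℕ, m - ∑ s, (A s : ℤ) < k → ∀ τ : Fin L → ℕ,
      (if ∑ s, (τ s : ℤ) = a + ∑ i, (v i : ℤ) + ∑ i, (w i : ℤ) + k - m then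
          stackWeight q h a v w τ else 0) = 0 := by
    intro k hk τ
    split_ifs with hτ
    · by_contra hne
      have : ∑ s, (τ s : ℤ) ≤ ∑ s, (w s : ℤ) :=
        sum_le_sum fun s _ => by exact_mod_cast hκB τ hne s s rfl
      omega
    · rfl
  by_cases hm : m < ∑ s, (A s : ℤ)
  · rw [finsum_eq_zero_of_forall_eq_zero, sum_eq_zero]
    · intro k _
      rw [finsum_eq_zero_of_forall_eq_zero (hupper0 k (by omega)), mul_zero]
    · intro κ
      split_ifs with hκ
      · by_contra hne
        have : ∑ s, (A s : ℤ) ≤ ∑ s, (κ s : ℤ) :=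
          sum_le_sum fun s _ => by exact_mod_cast hAκ κ hne s s rfl
        omega
      · rfl
  obtain ⟨r, hr⟩ : ∃ r : ℕ, m = ∑ s, (A s : ℤ) + r :=
    ⟨(m - ∑ s, (A s : ℤ)).toNat, by omega⟩
  have hlow : ∑ᶠ κ : Fin (L + 1) → ℕ,
      (if ∑ s, (κ s : ℤ) = m then stackWeight q h a v w κ else 0) =
      ∑ κ ∈ cuts A (extendTop A w r) r,
        (q / h) ^ ((L + 1) * ∑ i, (w i : ℤ) - L * m) * lowerWeight q h A w κ := by
    rw [finsum_eq_sum_of_support_subset (s := cuts A (extendTop A w r) r)]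
    · refine sum_congr rfl fun κ hκ => ?_
      rw [mem_cuts] at hκ
      have hsum : ∑ s, (κ s : ℤ) = m := by
        rw [hr, ← hκ.2]
        push_cast [fun s => (hκ.1 s).1]
        simp
      rw [if_pos hsum, lowerWeight_eq H, hsum, ← mul_assoc, ← zpow_add₀ hqh]
      simp
    · intro κ hκ
      rw [Function.mem_support, ne_eq, ite_eq_right_iff, Classical.not_imp] at hκ
      obtain ⟨hsum, hne⟩ := hκ
      have h1 : ∀ s, A s ≤ κ s := fun s => hAκ κ hne s s rfl
      have h2 : ∑ s, (κ s - A s) = r := by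
        zify [h1]
        rw [sum_sub_distrib]
        omega
      rw [mem_coe, mem_cuts, Fin.forall_fin_succ']
      refine ⟨⟨fun s => ⟨h1 _, by simpa using hκB κ hne s.castSucc s rfl⟩, h1 _, ?_⟩, h2⟩
      have := single_le_sum (f := fun s => κ s - A s) (fun _ _ => Nat.zero_le _)
        (mem_univ (Fin.last L))
      simp only [extendTop_last] at this ⊢
      omega
  rw [hlow, ← mul_sum, sum_lowerWeight_eq H hAB hord, mul_sum]
  have hrR : range (r + 1) ⊆ range R := by
    have : (0 : ℤ) ≤ ∑ s, (A s : ℤ) := sum_nonneg fun _ _ => by positivity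
    intro k hk
    rw [mem_range] at hk ⊢
    omega
  refine (sum_subset hrR fun k _ hk => ?_).symm.trans ?_ |>.symm
  · rw [mem_range] at hk
    rw [finsum_eq_zero_of_forall_eq_zero (hupper0 k (by omega)), mul_zero]
  · refine sum_congr rfl fun k hk => ?_
    rw [mem_range] at hk
    rw [finsum_eq_sum_of_support_subset (s := upperCuts A w (r - k)), mul_sum, mul_sum]
    · refine sum_congr rfl fun τ hτ => ?_
      simp only [upperCuts, mem_filter, Fintype.mem_piFinset, mem_Icc] at hτ
      have hsum : ∑ s, (τ s : ℤ) = a + ∑ i, (v i : ℤ) + ∑ i, (w i : ℤ) + k - m := by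
        have := hτ.2
        zify [fun s => (hτ.1 s).2, show k ≤ r by omega] at this
        rw [sum_sub_distrib] at this
        omega
      rw [if_pos hsum, upperWeight_eq H, sum_sub_distrib, hsum]
      have : (q / h) ^ ((L + 1) * (a + ∑ i, (v i : ℤ) + ∑ i, (w i : ℤ) + k - m) - L * m) =
          (q / h) ^ ((L + 1) * ∑ i, (w i : ℤ) - L * m) *
          (q / h) ^ (a + ∑ i, (v i : ℤ) + ∑ i, (w i : ℤ) + k - m - ∑ i, (w i : ℤ)) *
          (q / h) ^ (L * (a + ∑ i, (v i : ℤ) + ∑ i, (w i : ℤ) + k - m) -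
            L * ∑ i, (w i : ℤ)) := by
        rw [← zpow_add₀ hqh, ← zpow_add₀ hqh]
        congr 1
        ring
      rw [this]
      ring
    · intro τ hτ
      rw [Function.mem_support, ne_eq, ite_eq_right_iff, Classical.not_imp] at hτ
      obtain ⟨hsum, hne⟩ := hτ
      have h2 : ∀ s, τ s ≤ w s := fun s => hκB τ hne s s rfl
      simp only [upperCuts, coe_filter, Fintype.mem_piFinset, mem_Icc, Set.mem_ofPred_eq]
      refine ⟨fun s => ⟨hAκ τ hne s s.castSucc rfl, h2 s⟩, ?_⟩
      zify [h2, show k ≤ r by omega]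
      rw [sum_sub_distrib]
      omega

/-- The toggle identity on a diagonal. -/
theorem finsum_stackWeight (H : QGeneric q h) (a : ℕ) (v w : Fin L → ℕ)
    (m : ℤ) {R : ℕ} (hR : m < R) :
    ∑ᶠ κ : Fin (L + 1) → ℕ, (if ∑ s, (κ s : ℤ) = m then stackWeight q h a v w κ else 0) =
      ∑ k ∈ range R, qPhi q h 0 k *
        (q / h) ^ ((L + 1) * (a + ∑ i, (v i : ℤ) + ∑ i, (w i : ℤ) + k - m) - L * m) *
        ∑ᶠ τ : Fin L → ℕ, (if ∑ s, (τ s : ℤ) = a + ∑ i, (v i : ℤ) + ∑ i, (w i : ℤ) + k - m then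
          stackWeight q h a v w τ else 0) := by
  have e : (a + ∑ i, ((max (v i) (w i) : ℕ) : ℤ) + ∑ i, ((min (v i) (w i) : ℕ) : ℤ) : ℤ) =
      a + ∑ i, (v i : ℤ) + ∑ i, (w i : ℤ) := by
    rw [add_assoc, add_assoc, ← sum_add_distrib, ← sum_add_distrib]
    congr 1
    exact sum_congr rfl fun i _ => by exact_mod_cast max_add_min (v i) (w i)
  have := finsum_stackWeight_aux H a (v := fun i => max (v i) (w i))
    (w := fun i => min (v i) (w i)) (fun i => min_le_max) m hR
  simpa only [e, stackWeight_max_min] using this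

end Stack

section Weights

open Finset

variable {K : Type*} [Field K] {q h : K} {ι ρ : Type*} [Fintype ι] [Fintype ρ]

/-- The diagonal of a box. -/
def cellDiag (b : ℕ × ℕ) : ℤ := (b.1 : ℤ) - b.2

/-- The limit of the framing factor of a box. -/
noncomputable def boxWeight (q h : K) (b : ℕ × ℕ) (x : ℤ) : K :=
  if cellDiag b = 0 then qPhi q h b.1 x else if cellDiag b < 0 then (h / q) ^ x else 1

/-- The limit of the factor of a pair of boxes. -/
noncomputable def pairWeight (q h : K) (b b' : ℕ × ℕ) (x : ℤ) : K :=
  if cellDiag b' = cellDiag b + 1 then qPhi q h ((b.1 : ℤ) - b'.1) x * (q / h) ^ x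
  else if cellDiag b = cellDiag b' then (qPhi q h ((b.1 : ℤ) - b'.1) x)⁻¹ else 1

/-- The weight of a labelling of boxes. -/
noncomputable def rppWeight (q h : K) (box : ι → ℕ × ℕ) (d : ι → ℕ) : K :=
  (∏ i, boxWeight q h (box i) (d i)) *
    ∏ i, ∏ j, pairWeight q h (box i) (box j) ((d i : ℤ) - d j)

/-- The sums of a labelling along the diagonals. -/
def diagSum (box : ι → ℕ × ℕ) (d : ι → ℕ) (e : ℤ) : ℤ :=
  ∑ i, if cellDiag (box i) = e then (d i : ℤ) else 0

open Classical in
/-- The partition function with prescribed diagonal sums. -/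
noncomputable def rppSum (q h : K) (box : ι → ℕ × ℕ) (m : ℤ → ℤ) : K :=
  ∑ᶠ d : ι → ℕ, if diagSum box d = m then rppWeight q h box d else 0

/-- The boxes of a piece of diagonal. -/
def diagCell (i₀ j₀ : ℕ) {n : ℕ} (t : Fin n) : ℕ × ℕ := (i₀ + t, j₀ + t)

@[to_additive]
lemma prod_cellDiag_eq {M : Type*} [CommMonoid M] {b : ρ → ℕ × ℕ} (hb : Function.Injective b)
    {N X Y : ℕ} {ψ : Fin N → ρ} (hψ : ∀ i, b (ψ i) = (X + i, Y + i)) {e : ℤ}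
    (he : (X : ℤ) - Y = e) (hmem : ∀ j, cellDiag (b j) = e → X ≤ (b j).1 ∧ (b j).1 < X + N)
    (G : ρ → M) :
    ∏ j, (if cellDiag (b j) = e then G j else 1) = ∏ i, G (ψ i) := by
  classical
  rw [← prod_filter]
  symm
  refine prod_of_injOn ψ ?_ ?_ ?_ fun _ _ => rfl
  · intro i _ i' _ hii
    have := hψ i
    rw [hii, hψ i', Prod.mk.injEq] at this
    exact Fin.ext (by omega)
  · intro i _
    rw [mem_coe, mem_filter]
    refine ⟨mem_univ _, ?_⟩
    simp only [cellDiag, hψ]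
    push_cast
    omega
  · intro j hj hj'
    exfalso
    simp only [mem_filter, mem_univ, true_and] at hj
    obtain ⟨h1, h2⟩ := hmem j hj
    refine hj' ⟨⟨(b j).1 - X, by omega⟩, by simp, hb ?_⟩
    rw [hψ]
    simp only [cellDiag] at hj
    refine Prod.ext ?_ ?_ <;> simp only <;> omega

lemma pairWeight_mul_swap (H : QGeneric q h) (b b' : ℕ × ℕ) (hne : cellDiag b' ≠ cellDiag b)
    (x y : ℤ) : pairWeight q h b b' (x - y) * pairWeight q h b' b (y - x) =
      (if cellDiag b' = cellDiag b + 1 then qPhi q h ((b.1 : ℤ) - b'.1) (x - y) *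
          (q / h) ^ (x - y) else 1) *
        (if cellDiag b' = cellDiag b - 1 then qPhi q h ((b.1 : ℤ) - b'.1 - 1) (x - y) else 1) := by
  have hqh : q / h ≠ 0 := div_ne_zero H.q_ne H.h_ne
  unfold pairWeight
  by_cases h1 : cellDiag b' = cellDiag b + 1
  · rw [if_pos h1, if_neg (by omega), if_neg (by omega), if_pos h1, if_neg (by omega)]
  · rw [if_neg h1, if_neg (Ne.symm hne), if_neg h1]
    by_cases h2 : cellDiag b' = cellDiag b - 1
    · rw [if_pos (by omega), if_pos h2, one_mul, one_mul,
        show (b'.1 : ℤ) - b.1 = -1 - (b.1 - b'.1 - 1) by ring, show y - x = -(x - y) by ring,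
        qPhi_reflect H, mul_right_comm, ← zpow_add₀ hqh]
      simp
    · rw [if_neg (by omega), if_neg hne, if_neg h2]

/-- Separating a diagonal from the other boxes in the weight of a labelling. -/
lemma rppWeight_sumElim (H : QGeneric q h) {b : ρ → ℕ × ℕ} {i₀ j₀ n : ℕ}
    (hb : ∀ j, cellDiag (b j) ≠ (i₀ : ℤ) - j₀) (y : ρ → ℕ) (κ : Fin n → ℕ) :
    rppWeight q h (Sum.elim b (diagCell i₀ j₀ (n := n))) (Sum.elim y κ) =
      rppWeight q h b y * ((∏ t, boxWeight q h (diagCell i₀ j₀ t) (κ t)) *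
        ((∏ j, if cellDiag (b j) = (i₀ : ℤ) - j₀ + 1 then
          ∏ t : Fin n, qPhi q h ((i₀ : ℤ) + t - (b j).1) ((κ t : ℤ) - y j) else 1) *
        (∏ j, if cellDiag (b j) = (i₀ : ℤ) - j₀ - 1 then
          ∏ t : Fin n, qPhi q h ((i₀ : ℤ) + t - (b j).1 - 1) ((κ t : ℤ) - y j) else 1) *
        (q / h) ^ (∑ j, if cellDiag (b j) = (i₀ : ℤ) - j₀ + 1 then
          ∑ t, (κ t : ℤ) - n * y j else 0)) /
        ∏ s : Fin n, ∏ t : Fin n, qPhi q h ((t : ℤ) - s) ((κ t : ℤ) - κ s)) := by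
  have hqh : q / h ≠ 0 := div_ne_zero H.q_ne H.h_ne
  have hd : ∀ t : Fin n, cellDiag (diagCell i₀ j₀ t) = (i₀ : ℤ) - j₀ := fun t => by
    simp [cellDiag, diagCell]
  have hself : ∏ i : Fin n, ∏ t : Fin n, pairWeight q h (diagCell i₀ j₀ i) (diagCell i₀ j₀ t)
      ((κ i : ℤ) - κ t) = (∏ s : Fin n, ∏ t : Fin n, qPhi q h ((t : ℤ) - s)
        ((κ t : ℤ) - κ s))⁻¹ := by
    rw [prod_comm]
    simp only [← prod_inv_distrib]
    refine prod_congr rfl fun s _ => prod_congr rfl fun t _ => ?_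
    rw [pairWeight, hd, hd, if_neg (by omega), if_pos rfl]
    simp [diagCell]
  have hcross : (∏ j, ∏ t : Fin n, pairWeight q h (b j) (diagCell i₀ j₀ t) ((y j : ℤ) - κ t)) *
      (∏ t : Fin n, ∏ j, pairWeight q h (diagCell i₀ j₀ t) (b j) ((κ t : ℤ) - y j)) =
      (∏ j, if cellDiag (b j) = (i₀ : ℤ) - j₀ + 1 then
          ∏ t : Fin n, qPhi q h ((i₀ : ℤ) + t - (b j).1) ((κ t : ℤ) - y j) else 1) *
        (∏ j, if cellDiag (b j) = (i₀ : ℤ) - j₀ - 1 then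
          ∏ t : Fin n, qPhi q h ((i₀ : ℤ) + t - (b j).1 - 1) ((κ t : ℤ) - y j) else 1) *
        (q / h) ^ (∑ j, if cellDiag (b j) = (i₀ : ℤ) - j₀ + 1 then
          ∑ t, (κ t : ℤ) - n * y j else 0) := by
    rw [prod_comm (f := fun (t : Fin n) j => pairWeight q h (diagCell i₀ j₀ t) (b j) _),
      ← prod_mul_distrib, ← prod_zpow_eq_zpow_sum hqh, ← prod_mul_distrib, ← prod_mul_distrib]
    refine prod_congr rfl fun j _ => ?_
    rw [mul_comm, ← prod_mul_distrib]
    rw [prod_congr rfl fun t _ => pairWeight_mul_swap H (diagCell i₀ j₀ t) (b j)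
      (by rw [hd]; exact hb j) (κ t) (y j)]
    simp only [hd]
    split_ifs with h1 h2
    · omega
    · simp [prod_mul_distrib, prod_zpow_eq_zpow_sum hqh, diagCell]
    · simp [diagCell]
    · simp
  simp only [rppWeight, Fintype.prod_sum_type, Sum.elim_inl, Sum.elim_inr, prod_mul_distrib]
  rw [hself, ← hcross]
  ring

end Weights

section Corner

open Finset

variable {K : Type*} [Field K] {q h : K} {ρ : Type*} [Fintype ρ]

/-- The boxes `b` and the diagonal `(i₀,j₀), …, (i₀+L,j₀+L)` form a partition in which
`(i₀+L,j₀+L)` is a corner, as far as the adjacent diagonals are concerned. -/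
structure CornerDiag (b : ρ → ℕ × ℕ) (i₀ j₀ L : ℕ) : Prop where
  inj : Function.Injective b
  start : i₀ = 0 ∨ j₀ = 0
  off : ∀ j, cellDiag (b j) ≠ (i₀ : ℤ) - j₀
  below : ∀ x y : ℕ, x + j₀ = i₀ + y + 1 → ((∃ j, b j = (x, y)) ↔ x ≤ i₀ + L)
  above : ∀ x y : ℕ, x + j₀ + 1 = i₀ + y → ((∃ j, b j = (x, y)) ↔ y ≤ j₀ + L)

lemma rppWeight_corner (H : QGeneric q h) {b : ρ → ℕ × ℕ} {i₀ j₀ L : ℕ}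
    (hc : CornerDiag b i₀ j₀ L) (y : ρ → ℕ) :
    ∃ (a : ℕ) (v w : Fin L → ℕ), (a : ℤ) + ∑ i, (v i : ℤ) + ∑ i, (w i : ℤ) =
        diagSum b y ((i₀ : ℤ) - j₀ - 1) + diagSum b y ((i₀ : ℤ) - j₀ + 1) ∧
      ∀ (n : ℕ) (κ : Fin n → ℕ),
        rppWeight q h (Sum.elim b (diagCell i₀ j₀ (n := n))) (Sum.elim y κ) =
          rppWeight q h b y * (q / h) ^ (L * ∑ t, (κ t : ℤ) -
            n * diagSum b y ((i₀ : ℤ) - j₀ + 1)) * stackWeight q h a v w κ := by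
  have hqh : q / h ≠ 0 := div_ne_zero H.q_ne H.h_ne
  have hup : ∀ j, cellDiag (b j) = (i₀ : ℤ) - j₀ + 1 → (b j).1 ≤ i₀ + L := fun j hj => by
    refine (hc.below (b j).1 (b j).2 ?_).1 ⟨j, rfl⟩
    simp only [cellDiag] at hj
    omega
  have hdown : ∀ j, cellDiag (b j) = (i₀ : ℤ) - j₀ - 1 → (b j).2 ≤ j₀ + L := fun j hj => by
    refine (hc.above (b j).1 (b j).2 ?_).1 ⟨j, rfl⟩
    simp only [cellDiag] at hj
    omega
  have hexp : ∀ (n : ℕ) (S : ℤ) (N : ℕ) (ψ : Fin N → ρ) (X Y : ℕ)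
      (_ : ∀ i, b (ψ i) = (X + i, Y + i)) (_ : (X : ℤ) - Y = (i₀ : ℤ) - j₀ + 1)
      (_ : ∀ j, cellDiag (b j) = (i₀ : ℤ) - j₀ + 1 → X ≤ (b j).1 ∧ (b j).1 < X + N),
      (∑ j, if cellDiag (b j) = (i₀ : ℤ) - j₀ + 1 then S - n * y j else 0) =
        N * S - n * diagSum b y ((i₀ : ℤ) - j₀ + 1) := fun n S N ψ X Y h1 h2 h3 => by
    rw [diagSum, sum_cellDiag_eq hc.inj h1 h2 h3, sum_cellDiag_eq hc.inj h1 h2 h3,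
      sum_sub_distrib, mul_sum]
    simp
  rcases Nat.eq_zero_or_pos j₀ with hj | hj
  · -- the diagonal below starts after the given one
    have hw : ∀ i : Fin L, ∃ j, b j = (i₀ + 1 + i, 0 + (i : ℕ)) := fun i =>
      (hc.below _ _ (by omega)).2 (by omega)
    choose ψw hψw using hw
    have hwe : ((i₀ + 1 : ℕ) : ℤ) - (0 : ℕ) = (i₀ : ℤ) - j₀ + 1 := by push_cast; omega
    have hwm : ∀ j, cellDiag (b j) = (i₀ : ℤ) - j₀ + 1 →
        i₀ + 1 ≤ (b j).1 ∧ (b j).1 < i₀ + 1 + L := fun j hj => by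
      have := hup j hj
      simp only [cellDiag] at hj
      omega
    rcases Nat.eq_zero_or_pos i₀ with hi | hi
    · have hv : ∀ i : Fin L, ∃ j, b j = (0 + (i : ℕ), 1 + (i : ℕ)) := fun i =>
        (hc.above _ _ (by omega)).2 (by omega)
      choose ψv hψv using hv
      have hve : ((0 : ℕ) : ℤ) - (1 : ℕ) = (i₀ : ℤ) - j₀ - 1 := by push_cast; omega
      have hvm : ∀ j, cellDiag (b j) = (i₀ : ℤ) - j₀ - 1 →
          0 ≤ (b j).1 ∧ (b j).1 < 0 + L := fun j hj => by
        have := hdown j hj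
        simp only [cellDiag] at hj
        omega
      refine ⟨0, fun i => y (ψv i), fun i => y (ψw i), ?_, fun n κ => ?_⟩
      · rw [diagSum, diagSum, sum_cellDiag_eq hc.inj hψw hwe hwm,
          sum_cellDiag_eq hc.inj hψv hve hvm]
        simp
      · rw [rppWeight_sumElim H hc.off, hexp n _ L ψw _ _ hψw hwe hwm,
          prod_cellDiag_eq hc.inj hψw hwe hwm, prod_cellDiag_eq hc.inj hψv hve hvm, stackWeight]
        subst hi hj
        simp only [hψw, hψv, boxWeight, diagCell, cellDiag, prod_mul_distrib]
        simp only [Nat.cast_add, Nat.cast_zero, Nat.cast_one, zero_add, sub_self, if_true,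
          sub_zero, ← sub_sub, sub_right_comm _ (1 : ℤ)]
        ring
    · have hv : ∀ i : Fin (L + 1), ∃ j, b j = (i₀ - 1 + (i : ℕ), 0 + (i : ℕ)) := fun i =>
        (hc.above _ _ (by omega)).2 (by omega)
      choose ψv hψv using hv
      have hve : ((i₀ - 1 : ℕ) : ℤ) - (0 : ℕ) = (i₀ : ℤ) - j₀ - 1 := by push_cast; omega
      have hvm : ∀ j, cellDiag (b j) = (i₀ : ℤ) - j₀ - 1 →
          i₀ - 1 ≤ (b j).1 ∧ (b j).1 < i₀ - 1 + (L + 1) := fun j hj => by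
        have := hdown j hj
        simp only [cellDiag] at hj
        omega
      refine ⟨y (ψv 0), fun i => y (ψv i.succ), fun i => y (ψw i), ?_, fun n κ => ?_⟩
      · rw [diagSum, diagSum, sum_cellDiag_eq hc.inj hψw hwe hwm,
          sum_cellDiag_eq hc.inj hψv hve hvm, Fin.sum_univ_succ]
      · rw [rppWeight_sumElim H hc.off, hexp n _ L ψw _ _ hψw hwe hwm,
          prod_cellDiag_eq hc.inj hψw hwe hwm, prod_cellDiag_eq hc.inj hψv hve hvm, stackWeight,
          Fin.prod_univ_succ]
        have hbox : ∀ t : Fin n, boxWeight q h (diagCell i₀ j₀ t) (κ t) = 1 := fun t => by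
          rw [boxWeight, if_neg, if_neg] <;> simp only [cellDiag, diagCell] <;> omega
        have e1 : ∀ t : Fin n, (i₀ : ℤ) + t - ((i₀ - 1 + ((0 : Fin (L + 1)) : ℕ) : ℕ) : ℤ) - 1
            = t := fun t => by simp only [Fin.val_zero]; omega
        have e2 : ∀ (i : Fin L) (t : Fin n), (i₀ : ℤ) + t - ((i₀ - 1 + (i.succ : ℕ) : ℕ) : ℤ) - 1
            = t - i - 1 := fun i t => by simp only [Fin.val_succ]; omega
        have e3 : ∀ (i : Fin L) (t : Fin n), (i₀ : ℤ) + t - ((i₀ + 1 + i : ℕ) : ℤ)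
            = t - i - 1 := fun i t => by omega
        simp only [hψw, hψv, hbox, e1, e2, e3, prod_mul_distrib, prod_const_one]
        ring
  · -- the diagonal below starts before the given one
    have hi : i₀ = 0 := hc.start.resolve_right hj.ne'
    have hw : ∀ i : Fin (L + 1), ∃ j, b j = (0 + (i : ℕ), j₀ - 1 + (i : ℕ)) := fun i =>
      (hc.below _ _ (by omega)).2 (by omega)
    choose ψw hψw using hw
    have hwe : ((0 : ℕ) : ℤ) - (j₀ - 1 : ℕ) = (i₀ : ℤ) - j₀ + 1 := by omega
    have hwm : ∀ j, cellDiag (b j) = (i₀ : ℤ) - j₀ + 1 →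
        0 ≤ (b j).1 ∧ (b j).1 < 0 + (L + 1) := fun j hj => by
      have := hup j hj
      simp only [cellDiag] at hj
      omega
    have hv : ∀ i : Fin L, ∃ j, b j = (0 + (i : ℕ), j₀ + 1 + (i : ℕ)) := fun i =>
      (hc.above _ _ (by omega)).2 (by omega)
    choose ψv hψv using hv
    have hve : ((0 : ℕ) : ℤ) - (j₀ + 1 : ℕ) = (i₀ : ℤ) - j₀ - 1 := by push_cast; omega
    have hvm : ∀ j, cellDiag (b j) = (i₀ : ℤ) - j₀ - 1 →
        0 ≤ (b j).1 ∧ (b j).1 < 0 + L := fun j hj => by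
      have := hdown j hj
      simp only [cellDiag] at hj
      omega
    refine ⟨y (ψw 0), fun i => y (ψv i), fun i => y (ψw i.succ), ?_, fun n κ => ?_⟩
    · rw [diagSum, diagSum, sum_cellDiag_eq hc.inj hψw hwe hwm,
        sum_cellDiag_eq hc.inj hψv hve hvm, Fin.sum_univ_succ (fun i => (y (ψw i) : ℤ))]
      ring
    · rw [rppWeight_sumElim H hc.off, hexp n _ (L + 1) ψw _ _ hψw hwe hwm,
        prod_cellDiag_eq hc.inj hψw hwe hwm, prod_cellDiag_eq hc.inj hψv hve hvm, stackWeight,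
        Fin.prod_univ_succ]
      have hbox : ∏ t : Fin n, boxWeight q h (diagCell i₀ j₀ t) (κ t) =
          (q / h) ^ (-∑ t, (κ t : ℤ)) := by
        rw [zpow_neg, ← inv_zpow, inv_div, ← prod_zpow_eq_zpow_sum
          (div_ne_zero H.h_ne H.q_ne)]
        refine prod_congr rfl fun t _ => ?_
        rw [boxWeight, if_neg, if_pos] <;> simp only [cellDiag, diagCell] <;> omega
      have e1 : ∀ t : Fin n, (i₀ : ℤ) + t - ((0 + ((0 : Fin (L + 1)) : ℕ) : ℕ) : ℤ)
          = t := fun t => by simp only [Fin.val_zero]; omega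
      have e2 : ∀ (i : Fin L) (t : Fin n), (i₀ : ℤ) + t - ((0 + (i.succ : ℕ) : ℕ) : ℤ)
          = t - i - 1 := fun i t => by simp only [Fin.val_succ]; omega
      have e3 : ∀ (i : Fin L) (t : Fin n), (i₀ : ℤ) + t - ((0 + i : ℕ) : ℤ) - 1
          = t - i - 1 := fun i t => by omega
      have e4 : ∀ S D : ℤ, (q / h) ^ (((L + 1 : ℕ) : ℤ) * S - n * D) =
          (q / h) ^ (L * S - n * D) * (q / h) ^ S := fun S D => by
        rw [← zpow_add₀ hqh]; congr 1; push_cast; ring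
      have e5 : ∀ S : ℤ, (q / h) ^ (-S) * (q / h) ^ S = 1 := fun S => by
        rw [← zpow_add₀ hqh]; simp
      simp only [hψw, hψv, hbox, e1, e2, e3, e4, prod_mul_distrib]
      linear_combination (rppWeight q h b y * ((q / h) ^ (L * (∑ t, (κ t : ℤ)) -
          n * diagSum b y ((i₀ : ℤ) - j₀ + 1)) *
        ((∏ t : Fin n, qPhi q h (t : ℤ) ((κ t : ℤ) - y (ψw 0))) *
          ((∏ i : Fin L, ∏ t : Fin n, qPhi q h ((t : ℤ) - i - 1) ((κ t : ℤ) - y (ψv i))) *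
          ∏ i : Fin L, ∏ t : Fin n, qPhi q h ((t : ℤ) - i - 1) ((κ t : ℤ) - y (ψw i.succ)))) /
        ∏ s : Fin n, ∏ t : Fin n, qPhi q h ((t : ℤ) - s) ((κ t : ℤ) - κ s))) *
          e5 (∑ t, (κ t : ℤ))

end Corner

section Recurrence

open Finset

variable {K : Type*} [Field K] {q h : K} {ι ρ : Type*} [Fintype ι] [Fintype ρ]

lemma finite_diagSum_eq (box : ι → ℕ × ℕ) (m : ℤ → ℤ) :
    {d : ι → ℕ | diagSum box d = m}.Finite := by
  refine (Set.Finite.pi' fun i => Set.finite_Iic (m (cellDiag (box i))).toNat).subset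
    fun d hd i => ?_
  have h1 : (d i : ℤ) ≤ m (cellDiag (box i)) := by
    rw [← (hd : diagSum box d = m), diagSum]
    calc (d i : ℤ) = if cellDiag (box i) = cellDiag (box i) then (d i : ℤ) else 0 := by simp
      _ ≤ _ := single_le_sum (f := fun i' => if cellDiag (box i') = cellDiag (box i)
        then (d i' : ℤ) else 0) (fun i' _ => by split_ifs <;> positivity) (mem_univ i)
  show d i ≤ (m (cellDiag (box i))).toNat
  omega

lemma diagSum_sumElim (b : ρ → ℕ × ℕ) (i₀ j₀ : ℕ) {n : ℕ} (y : ρ → ℕ) (κ : Fin n → ℕ) (e : ℤ) :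
    diagSum (Sum.elim b (diagCell i₀ j₀ (n := n))) (Sum.elim y κ) e =
      diagSum b y e + if (i₀ : ℤ) - j₀ = e then ∑ t, (κ t : ℤ) else 0 := by
  have hd : ∀ t : Fin n, cellDiag (diagCell i₀ j₀ t) = (i₀ : ℤ) - j₀ := fun t => by
    simp [cellDiag, diagCell]
  simp only [diagSum, Fintype.sum_sum_type, Sum.elim_inl, Sum.elim_inr, hd]
  congr 1
  split_ifs <;> simp

open Classical in
/-- Summing first over the labels of one diagonal. -/
lemma rppSum_sumElim {b : ρ → ℕ × ℕ} {i₀ j₀ L : ℕ}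
    (hc : CornerDiag b i₀ j₀ L) (n : ℕ) (m : ℤ → ℤ) {a : (ρ → ℕ) → ℕ} {v w : (ρ → ℕ) → Fin L → ℕ}
    (hw : ∀ y (κ : Fin n → ℕ),
        rppWeight q h (Sum.elim b (diagCell i₀ j₀ (n := n))) (Sum.elim y κ) =
          rppWeight q h b y * (q / h) ^ (L * ∑ t, (κ t : ℤ) -
            n * diagSum b y ((i₀ : ℤ) - j₀ + 1)) * stackWeight q h (a y) (v y) (w y) κ) :
    rppSum q h (Sum.elim b (diagCell i₀ j₀ (n := n))) m =
      ∑ᶠ y : ρ → ℕ, if diagSum b y = Function.update m ((i₀ : ℤ) - j₀) 0 then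
        (rppWeight q h b y * (q / h) ^ (L * m ((i₀ : ℤ) - j₀) - n * m ((i₀ : ℤ) - j₀ + 1))) *
          ∑ᶠ κ : Fin n → ℕ, (if ∑ s, (κ s : ℤ) = m ((i₀ : ℤ) - j₀) then
            stackWeight q h (a y) (v y) (w y) κ else 0) else 0 := by
  have h0 : ∀ y, diagSum b y ((i₀ : ℤ) - j₀) = 0 := fun y =>
    sum_eq_zero fun j _ => if_neg (hc.off j)
  have hcond : ∀ y (κ : Fin n → ℕ),
      diagSum (Sum.elim b (diagCell i₀ j₀ (n := n))) (Sum.elim y κ) = m ↔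
      diagSum b y = Function.update m ((i₀ : ℤ) - j₀) 0 ∧
        ∑ s, (κ s : ℤ) = m ((i₀ : ℤ) - j₀) := fun y κ => by
    simp only [funext_iff, diagSum_sumElim, Function.update_apply]
    constructor
    · refine fun hm => ⟨fun e => ?_, ?_⟩
      · have := hm e
        by_cases he : e = (i₀ : ℤ) - j₀
        · rw [if_pos he, he, h0]
        · rw [if_neg he]
          rwa [if_neg (Ne.symm he), add_zero] at this
      · have := hm ((i₀ : ℤ) - j₀)
        rwa [if_pos rfl, h0, zero_add] at this
    · rintro ⟨h1, h2⟩ e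
      by_cases he : e = (i₀ : ℤ) - j₀
      · rw [he, if_pos rfl, h0, zero_add, h2]
      · rw [if_neg (Ne.symm he), add_zero, h1, if_neg he]
  rw [rppSum, ← finsum_comp_equiv (Equiv.sumArrowEquivProdArrow ρ (Fin n) ℕ).symm, finsum_curry]
  · refine finsum_congr fun y => ?_
    refine (finsum_congr fun κ : Fin n → ℕ => if_congr (x := rppWeight q h
      (Sum.elim b (diagCell i₀ j₀)) (Sum.elim y κ)) (hcond y κ) rfl rfl).trans ?_
    by_cases hy : diagSum b y = Function.update m ((i₀ : ℤ) - j₀) 0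
    · rw [if_pos hy, mul_finsum]
      refine finsum_congr fun κ => ?_
      by_cases hκ : ∑ s, (κ s : ℤ) = m ((i₀ : ℤ) - j₀)
      · have h1 : diagSum b y ((i₀ : ℤ) - j₀ + 1) = m ((i₀ : ℤ) - j₀ + 1) := by
          rw [hy, Function.update_of_ne (by omega)]
        rw [if_pos ⟨hy, hκ⟩, if_pos hκ, hw, hκ, h1]
      · rw [if_neg (by tauto), if_neg hκ, mul_zero]
    · rw [if_neg hy]
      exact finsum_eq_zero_of_forall_eq_zero fun κ => if_neg (by tauto)
  · refine ((finite_diagSum_eq (Sum.elim b (diagCell i₀ j₀ (n := n))) m).preimage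
      (Equiv.injective (Equiv.sumArrowEquivProdArrow ρ (Fin n) ℕ).symm).injOn).subset ?_
    intro x hx
    by_contra hx'
    exact hx (if_neg hx')

lemma rppSum_corner (H : QGeneric q h) {b : ρ → ℕ × ℕ} {i₀ j₀ L : ℕ}
    (hc : CornerDiag b i₀ j₀ L) (m : ℤ → ℤ) {R : ℕ} (hR : m ((i₀ : ℤ) - j₀) < R) :
    rppSum q h (Sum.elim b (diagCell i₀ j₀ (n := L + 1))) m =
      ∑ k ∈ range R, qPhi q h 0 k *
        (q / h) ^ (m ((i₀ : ℤ) - j₀ - 1) + k - m ((i₀ : ℤ) - j₀)) *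
        rppSum q h (Sum.elim b (diagCell i₀ j₀ (n := L))) (Function.update m ((i₀ : ℤ) - j₀)
          (m ((i₀ : ℤ) - j₀ - 1) + m ((i₀ : ℤ) - j₀ + 1) + k - m ((i₀ : ℤ) - j₀))) := by
  classical
  have hqh : q / h ≠ 0 := div_ne_zero H.q_ne H.h_ne
  choose a v w hs hw using rppWeight_corner H hc
  have hne1 : (i₀ : ℤ) - j₀ + 1 ≠ (i₀ : ℤ) - j₀ := by omega
  have hne2 : (i₀ : ℤ) - j₀ - 1 ≠ (i₀ : ℤ) - j₀ := by omega
  rw [rppSum_sumElim hc _ _ fun y κ => hw y _ κ]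
  conv_rhs =>
    enter [2, k]
    rw [rppSum_sumElim hc _ _ fun y κ => hw y _ κ, mul_finsum]
  simp only [Function.update_idem, Function.update_self, Function.update_of_ne hne1]
  rw [← finsum_sum_comm]
  · refine finsum_congr fun y => ?_
    by_cases hy : diagSum b y = Function.update m ((i₀ : ℤ) - j₀) 0
    · have hsum := hs y
      rw [hy, Function.update_of_ne hne1, Function.update_of_ne hne2] at hsum
      simp only [if_pos hy]
      rw [finsum_stackWeight H _ _ _ _ hR, mul_sum]
      refine sum_congr rfl fun k _ => ?_
      simp only [hsum]
      have : (q / h) ^ (L * m ((i₀ : ℤ) - j₀) - ((L + 1 : ℕ) : ℤ) * m ((i₀ : ℤ) - j₀ + 1)) *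
          (q / h) ^ ((L + 1) * (m ((i₀ : ℤ) - j₀ - 1) + m ((i₀ : ℤ) - j₀ + 1) + k -
            m ((i₀ : ℤ) - j₀)) - L * m ((i₀ : ℤ) - j₀)) =
          (q / h) ^ (m ((i₀ : ℤ) - j₀ - 1) + k - m ((i₀ : ℤ) - j₀)) *
          (q / h) ^ (L * (m ((i₀ : ℤ) - j₀ - 1) + m ((i₀ : ℤ) - j₀ + 1) + k -
            m ((i₀ : ℤ) - j₀)) - L * m ((i₀ : ℤ) - j₀ + 1)) := by
        rw [← zpow_add₀ hqh, ← zpow_add₀ hqh]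
        congr 1
        push_cast
        ring
      have key : ∀ r p E₁ E₂ E₃ E₄ S : K, E₁ * E₂ = E₃ * E₄ →
          r * E₁ * (p * E₂ * S) = p * E₃ * (r * E₄ * S) := fun r p E₁ E₂ E₃ E₄ S hE => by
        linear_combination r * p * S * hE
      exact key _ _ _ _ _ _ _ this
    · simp [if_neg hy]
  · intro k _
    refine (finite_diagSum_eq b (Function.update m ((i₀ : ℤ) - j₀) 0)).subset fun y hy => ?_
    by_contra hy'
    refine hy ?_
    simp only
    rw [if_neg (show ¬diagSum b y = _ from hy'), mul_zero]

lemma rppWeight_comp_equiv (σ : ι ≃ ρ) (b : ρ → ℕ × ℕ) (d : ρ → ℕ) :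
    rppWeight q h (b ∘ σ) (d ∘ σ) = rppWeight q h b d := by
  unfold rppWeight
  congr 1
  · exact σ.prod_comp fun j => boxWeight q h (b j) (d j)
  · rw [← σ.prod_comp]
    exact prod_congr rfl fun i _ =>
      σ.prod_comp fun j => pairWeight q h (b (σ i)) (b j) ((d (σ i) : ℤ) - d j)

lemma diagSum_comp_equiv (σ : ι ≃ ρ) (b : ρ → ℕ × ℕ) (d : ρ → ℕ) :
    diagSum (b ∘ σ) (d ∘ σ) = diagSum b d :=
  funext fun e => σ.sum_comp fun j => if cellDiag (b j) = e then (d j : ℤ) else 0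

lemma rppSum_comp_equiv (σ : ι ≃ ρ) (b : ρ → ℕ × ℕ) (m : ℤ → ℤ) :
    rppSum q h (b ∘ σ) m = rppSum q h b m := by
  rw [rppSum, rppSum, ← finsum_comp_equiv (σ.arrowCongr (Equiv.refl ℕ)).symm]
  refine finsum_congr fun d => ?_
  rw [show (σ.arrowCongr (Equiv.refl ℕ)).symm d = d ∘ σ from rfl, rppWeight_comp_equiv,
    diagSum_comp_equiv]

/-- The partition function depends only on the set of boxes. -/
lemma rppSum_congr {b : ι → ℕ × ℕ} {b' : ρ → ℕ × ℕ} (hb : Function.Injective b)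
    (hb' : Function.Injective b') (hr : Set.range b = Set.range b') :
    rppSum q h b = rppSum q h b' := by
  have hσ : b = b' ∘ ((Equiv.ofInjective b hb).trans ((Equiv.setCongr hr).trans
      (Equiv.ofInjective b' hb').symm)) := by
    funext i
    simp [Equiv.apply_ofInjective_symm]
  funext m
  rw [hσ, rppSum_comp_equiv]

end Recurrence

section VecSum

open Finset

variable {K : Type*} [Field K] {ι ι' : Type*} [Fintype ι] [Fintype ι']

open Classical in
/-- The weighted number of ways of writing `m` as a combination of the vectors `H v`. -/
noncomputable def vecSum (H : ι → ℤ → ℤ) (f : ι → ℕ → K) (m : ℤ → ℤ) : K :=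
  ∑ᶠ k : ι → ℕ, if ∑ v, (k v : ℤ) • H v = m then ∏ v, f v (k v) else 0

/-- The reflection of a function on `ℤ` at a point. -/
def reflectAt (e : ℤ) (m : ℤ → ℤ) : ℤ → ℤ :=
  Function.update m e (m (e - 1) + m (e + 1) - m e)

lemma reflectAt_reflectAt (e : ℤ) (m : ℤ → ℤ) : reflectAt e (reflectAt e m) = m := by
  funext e'
  by_cases h : e' = e
  · subst h
    simp [reflectAt]
  · simp [reflectAt, h]

lemma reflectAt_sum (e : ℤ) (k : ι → ℤ) (H : ι → ℤ → ℤ) :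
    reflectAt e (∑ v, k v • H v) = ∑ v, k v • reflectAt e (H v) := by
  funext e'
  by_cases h : e' = e
  · subst h
    simp [reflectAt, Finset.sum_apply, mul_sub, mul_add, sum_add_distrib, sum_sub_distrib]
  · simp [reflectAt, h]

lemma vecSum_reflectAt {x : K} (hx : x ≠ 0) {H H' : ι → ℤ → ℤ} {f f' : ι → ℕ → K} {e : ℤ}
    (hH : ∀ v, H v = reflectAt e (H' v))
    (hf : ∀ v k, f v k = f' v k * x ^ ((H v (e - 1) - H v e) * k)) (m : ℤ → ℤ) :
    vecSum H f m = x ^ (m (e - 1) - m e) * vecSum H' f' (reflectAt e m) := by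
  rw [vecSum, vecSum, mul_finsum]
  refine finsum_congr fun k => ?_
  have hiff : ∑ v, (k v : ℤ) • H v = m ↔ ∑ v, (k v : ℤ) • H' v = reflectAt e m := by
    simp only [hH, ← reflectAt_sum]
    exact ⟨fun h => by rw [← h, reflectAt_reflectAt], fun h => by rw [h, reflectAt_reflectAt]⟩
  by_cases hm : ∑ v, (k v : ℤ) • H v = m
  · rw [if_pos hm, if_pos (hiff.1 hm)]
    simp only [hf, prod_mul_distrib, prod_zpow_eq_zpow_sum hx]
    rw [mul_comm, ← hm]
    simp only [Finset.sum_apply, Pi.smul_apply, smul_eq_mul, ← sum_sub_distrib, mul_sub, mul_comm]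
  · rw [if_neg hm, if_neg (hiff.not.1 hm), mul_zero]

lemma vecSum_comp_equiv (σ : ι ≃ ι') (H : ι' → ℤ → ℤ) (f : ι' → ℕ → K) (m : ℤ → ℤ) :
    vecSum (fun i => H (σ i)) (fun i => f (σ i)) m = vecSum H f m := by
  rw [vecSum, vecSum, ← finsum_comp_equiv (σ.arrowCongr (Equiv.refl ℕ)).symm]
  refine finsum_congr fun k => ?_
  rw [show (σ.arrowCongr (Equiv.refl ℕ)).symm k = fun i => k (σ i) from rfl,
    σ.sum_comp (fun v => (k v : ℤ) • H v), σ.prod_comp (fun v => f v (k v))]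

lemma finite_vecSum {H : ι → ℤ → ℤ} (h0 : ∀ v, 0 ≤ H v) (h1 : ∀ v, ∃ e, 1 ≤ H v e)
    (m : ℤ → ℤ) : {k : ι → ℕ | ∑ v, (k v : ℤ) • H v = m}.Finite := by
  choose e he using h1
  refine (Set.Finite.pi' fun v => Set.finite_Iic (m (e v)).toNat).subset fun k hk v => ?_
  have h2 : (k v : ℤ) * H v (e v) ≤ m (e v) := by
    rw [← (hk : ∑ v, (k v : ℤ) • H v = m), Finset.sum_apply]
    exact single_le_sum (f := fun v' => (k v' : ℤ) * H v' (e v))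
      (fun v' _ => mul_nonneg (Int.natCast_nonneg _) (h0 v' _)) (mem_univ v)
  have := le_mul_of_one_le_right (Int.natCast_nonneg (k v)) (he v)
  show k v ≤ (m (e v)).toNat
  omega

lemma vecSum_eq_zero {H : ι → ℤ → ℤ} (h0 : ∀ v, 0 ≤ H v) (f : ι → ℕ → K) {m : ℤ → ℤ} {e : ℤ}
    (hm : m e < 0) : vecSum H f m = 0 := by
  refine finsum_eq_zero_of_forall_eq_zero fun k => if_neg fun hk => ?_
  rw [← hk, Finset.sum_apply] at hm
  exact absurd hm (not_lt.2 (sum_nonneg fun v _ => mul_nonneg (Int.natCast_nonneg _) (h0 v e)))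

lemma vecSum_option {H : Option ι → ℤ → ℤ} (h0 : ∀ v, 0 ≤ H v) (h1 : ∀ v, ∃ e, 1 ≤ H v e)
    (f : Option ι → ℕ → K) (m : ℤ → ℤ) {e : ℤ} (he : 1 ≤ H none e) {R : ℕ} (hR : m e < R) :
    vecSum H f m = ∑ k ∈ range R, f none k *
      vecSum (fun v => H (some v)) (fun v => f (some v)) (m - (k : ℤ) • H none) := by
  classical
  have hs : ∀ k : ℕ, R ≤ k → vecSum (fun v => H (some v)) (fun v => f (some v))
      (m - (k : ℤ) • H none) = 0 := fun k hk => by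
    refine vecSum_eq_zero (fun v => h0 (some v)) _ (e := e) ?_
    have := le_mul_of_one_le_right (Int.natCast_nonneg k) he
    simp only [Pi.sub_apply, Pi.smul_apply, smul_eq_mul]
    omega
  rw [← finsum_eq_sum_of_support_subset]
  · rw [vecSum, ← finsum_comp_equiv (Equiv.piOptionEquivProd (β := fun _ : Option ι => ℕ)).symm,
      finsum_curry]
    · refine finsum_congr fun k => ?_
      rw [vecSum, mul_finsum]
      refine finsum_congr fun κ => ?_
      simp only [Fintype.sum_option, Fintype.prod_option, Equiv.piOptionEquivProd_symm_apply]
      rw [mul_ite, mul_zero]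
      exact if_congr (by rw [eq_sub_iff_add_eq, add_comm]) rfl rfl
    · refine ((finite_vecSum h0 h1 m).preimage (Equiv.injective
        (Equiv.piOptionEquivProd (β := fun _ : Option ι => ℕ)).symm).injOn).subset ?_
      intro x hx
      by_contra hx'
      exact hx (if_neg hx')
  · intro k hk
    rw [mem_coe, mem_range]
    by_contra hk'
    exact hk (by simp only; rw [hs k (by omega), mul_zero])

end VecSum

section Shapes

open Finset

variable {K : Type*} [Field K] {q h : K}

/-- The indicator function of the diagonals met by the hook of a box. -/
def hookVec (μ : YoungDiagram) (v : ℕ × ℕ) (e : ℤ) : ℤ :=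
  if (v.1 : ℤ) - μ.rowLen v.1 + 1 ≤ e ∧ e ≤ (μ.colLen v.2 : ℤ) - 1 - v.2 then 1 else 0

/-- The exponents of the factor of a box in the product formula. -/
noncomputable def hookFactor (q h : K) (μ : YoungDiagram) (v : ℕ × ℕ) (k : ℕ) : K :=
  qPhi q h 0 k * (q / h) ^ (-((μ.rowLen v.1 : ℤ) - v.2 - 1) * k)

/-- The diagram without a maximal box. -/
def YoungDiagram.eraseMax (μ : YoungDiagram) (p : ℕ × ℕ) (hp : Maximal (· ∈ μ.cells) p) :
    YoungDiagram where
  cells := μ.cells.erase p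
  isLowerSet := by
    intro a b hba ha
    rw [mem_coe, mem_erase] at ha ⊢
    refine ⟨?_, μ.isLowerSet hba ha.2⟩
    rintro rfl
    exact ha.1 (le_antisymm (hp.2 ha.2 hba) hba)

section EraseMax

variable {μ : YoungDiagram} {p : ℕ × ℕ}

lemma rowLen_corner (hp : Maximal (· ∈ μ.cells) p) : μ.rowLen p.1 = p.2 + 1 := by
  have h1 : p.2 < μ.rowLen p.1 := YoungDiagram.mem_iff_lt_rowLen.1 hp.1
  by_contra hne
  have h2 : (p.1, p.2 + 1) ∈ μ := YoungDiagram.mem_iff_lt_rowLen.2 (by omega)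
  have := (hp.2 h2 ⟨le_rfl, Nat.le_succ _⟩).2
  simp at this

lemma colLen_corner (hp : Maximal (· ∈ μ.cells) p) : μ.colLen p.2 = p.1 + 1 := by
  have h1 : p.1 < μ.colLen p.2 := YoungDiagram.mem_iff_lt_colLen.1 hp.1
  by_contra hne
  have h2 : (p.1 + 1, p.2) ∈ μ := YoungDiagram.mem_iff_lt_colLen.2 (by omega)
  have := (hp.2 h2 ⟨Nat.le_succ _, le_rfl⟩).1
  simp at this

lemma mem_eraseMax (hp : Maximal (· ∈ μ.cells) p)
    {c : ℕ × ℕ} : c ∈ μ.eraseMax p hp ↔ c ≠ p ∧ c ∈ μ := mem_erase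

lemma rowLen_eraseMax (hp : Maximal (· ∈ μ.cells) p) (i : ℕ) :
    (μ.eraseMax p hp).rowLen i = if i = p.1 then p.2 else μ.rowLen i := by
  refine eq_of_forall_lt_iff fun j => ?_
  rw [← YoungDiagram.mem_iff_lt_rowLen, mem_eraseMax, YoungDiagram.mem_iff_lt_rowLen, Ne,
    Prod.ext_iff]
  have := rowLen_corner hp
  split_ifs with hi
  · subst hi
    simp only [true_and]
    omega
  · simp [hi]

lemma colLen_eraseMax (hp : Maximal (· ∈ μ.cells) p) (j : ℕ) :
    (μ.eraseMax p hp).colLen j = if j = p.2 then p.1 else μ.colLen j := by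
  refine eq_of_forall_lt_iff fun i => ?_
  rw [← YoungDiagram.mem_iff_lt_colLen, mem_eraseMax, YoungDiagram.mem_iff_lt_colLen, Ne,
    Prod.ext_iff]
  have := colLen_corner hp
  split_ifs with hj
  · subst hj
    simp only [and_true]
    omega
  · simp [hj]

lemma rowLen_bounds (hp : Maximal (· ∈ μ.cells) p)
    (i : ℕ) : (i ≤ p.1 → p.2 + 1 ≤ μ.rowLen i) ∧
    (p.1 < i → μ.rowLen i ≤ p.2) := by
  refine ⟨fun hi => (rowLen_corner hp).symm.trans_le (μ.rowLen_anti _ _ hi), fun hi => ?_⟩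
  by_contra hlt
  have h2 : (i, p.2) ∈ μ := YoungDiagram.mem_iff_lt_rowLen.2 (by omega)
  have := (hp.2 h2 ⟨hi.le, le_rfl⟩).1
  simp only at this
  omega

lemma colLen_bounds (hp : Maximal (· ∈ μ.cells) p)
    (j : ℕ) : (j ≤ p.2 → p.1 + 1 ≤ μ.colLen j) ∧
    (p.2 < j → μ.colLen j ≤ p.1) := by
  refine ⟨fun hj => (colLen_corner hp).symm.trans_le (μ.colLen_anti _ _ hj), fun hj => ?_⟩
  by_contra hlt
  have h2 : (p.1, j) ∈ μ := YoungDiagram.mem_iff_lt_colLen.2 (by omega)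
  have := (hp.2 h2 ⟨le_rfl, hj.le⟩).2
  simp only at this
  omega

lemma hookVec_corner (hp : Maximal (· ∈ μ.cells) p)
    : hookVec μ p = Pi.single (cellDiag p) 1 := by
  funext e
  rw [hookVec, rowLen_corner hp, colLen_corner hp, Pi.single_apply]
  refine if_congr ?_ rfl rfl
  simp only [cellDiag]
  omega

lemma hookVec_eraseMax (hp : Maximal (· ∈ μ.cells) p)
    {v : ℕ × ℕ} (hv : v ∈ μ) (hvp : v ≠ p) :
    hookVec μ v = reflectAt (cellDiag p) (hookVec (μ.eraseMax p hp) v) := by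
  funext e
  have h1 := rowLen_bounds hp v.1
  have h2 := colLen_bounds hp v.2
  have h3 := YoungDiagram.mem_iff_lt_rowLen.1 (show (v.1, v.2) ∈ μ from hv)
  have h4 := YoungDiagram.mem_iff_lt_colLen.1 (show (v.1, v.2) ∈ μ from hv)
  have h5 : v.1 = p.1 → μ.rowLen v.1 = p.2 + 1 := fun h => h ▸ rowLen_corner hp
  have h6 : v.2 = p.2 → μ.colLen v.2 = p.1 + 1 := fun h => h ▸ colLen_corner hp
  have h7 : v.1 = p.1 → v.2 ≠ p.2 := fun h => fun h' => hvp (Prod.ext h h')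
  simp only [reflectAt, Function.update_apply, hookVec, rowLen_eraseMax, colLen_eraseMax, cellDiag]
  by_cases hi : v.1 = p.1
  · have := h7 hi
    simp only [if_pos hi, if_neg this]
    split_ifs <;> omega
  · by_cases hj : v.2 = p.2
    · simp only [if_pos hj, if_neg hi]
      split_ifs <;> omega
    · simp only [if_neg hi, if_neg hj]
      split_ifs <;> omega

lemma hookVec_sub (hp : Maximal (· ∈ μ.cells) p) {v : ℕ × ℕ} (hv : v ∈ μ) (hvp : v ≠ p) :
    hookVec μ v (cellDiag p - 1) - hookVec μ v (cellDiag p) =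
      (((μ.eraseMax p hp).rowLen v.1 : ℕ) : ℤ) - μ.rowLen v.1 := by
  have h1 := rowLen_bounds hp v.1
  have h2 := colLen_bounds hp v.2
  have h3 := YoungDiagram.mem_iff_lt_rowLen.1 (show (v.1, v.2) ∈ μ from hv)
  have h4 := YoungDiagram.mem_iff_lt_colLen.1 (show (v.1, v.2) ∈ μ from hv)
  have h5 : v.1 = p.1 → μ.rowLen v.1 = p.2 + 1 := fun h => h ▸ rowLen_corner hp
  have h6 : v.2 = p.2 → μ.colLen v.2 = p.1 + 1 := fun h => h ▸ colLen_corner hp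
  have h7 : v.1 = p.1 → v.2 ≠ p.2 := fun h => fun h' => hvp (Prod.ext h h')
  simp only [hookVec, rowLen_eraseMax, cellDiag]
  by_cases hi : v.1 = p.1
  · have := h7 hi
    simp only [if_pos hi]
    split_ifs <;> omega
  · by_cases hj : v.2 = p.2
    · simp only [if_neg hi]
      split_ifs <;> omega
    · simp only [if_neg hi]
      split_ifs <;> omega

end EraseMax

lemma hookVec_nonneg (μ : YoungDiagram) (v : ℕ × ℕ) : 0 ≤ hookVec μ v := fun e => by
  unfold hookVec
  split_ifs <;> simp

lemma one_le_hookVec {μ : YoungDiagram} {v : ℕ × ℕ} (hv : v ∈ μ) :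
    ∃ e, 1 ≤ hookVec μ v e := by
  have h3 := YoungDiagram.mem_iff_lt_rowLen.1 (show (v.1, v.2) ∈ μ from hv)
  have h4 := YoungDiagram.mem_iff_lt_colLen.1 (show (v.1, v.2) ∈ μ from hv)
  refine ⟨cellDiag v, ?_⟩
  rw [hookVec, if_pos]
  simp only [cellDiag]
  omega

/-- The partition function of a Young diagram. -/
theorem rppSum_eq_vecSum (H : QGeneric q h) (μ : YoungDiagram) {ι : Type} [Fintype ι]
    {box : ι → ℕ × ℕ} (hinj : Function.Injective box) (hr : ∀ c, c ∈ μ ↔ ∃ i, box i = c)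
    (m : ℤ → ℤ) :
    rppSum q h box m =
      vecSum (fun i => hookVec μ (box i)) (fun i => hookFactor q h μ (box i)) m := by
  classical
  have hqh : q / h ≠ 0 := div_ne_zero H.q_ne H.h_ne
  induction hn : μ.cells.card generalizing μ ι m with
  | zero =>
    have he : IsEmpty ι := ⟨fun i => by
      have : box i ∈ μ.cells := (hr _).2 ⟨i, rfl⟩
      rw [card_eq_zero.1 hn] at this
      simp at this⟩
    rw [rppSum, vecSum]
    refine finsum_congr fun d => ?_
    refine if_congr ?_ (by simp [rppWeight]) rfl
    simp only [funext_iff, diagSum, univ_eq_empty, sum_empty, Pi.zero_apply]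
  | succ N ih =>
    obtain ⟨p, hp⟩ := μ.cells.exists_maximal (card_pos.1 (by omega))
    obtain ⟨i₁, hi₁⟩ := (hr p).1 hp.1
    set L := min p.1 p.2 with hL
    have hpp : ((p.1 - L : ℕ) : ℤ) - ((p.2 - L : ℕ) : ℤ) = cellDiag p := by
      simp only [cellDiag]; omega
    set b : {i // cellDiag (box i) ≠ cellDiag p} → ℕ × ℕ := fun i => box i with hb
    have hdiag : ∀ c : ℕ × ℕ, cellDiag c = cellDiag p → c ∈ μ → ∃ t : Fin (L + 1),
        diagCell (p.1 - L) (p.2 - L) t = c := fun c hc hcμ => by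
      have h1 : ¬p.1 < c.1 := fun hlt => by
        have h2 := (rowLen_bounds hp c.1).2 hlt
        have h3 := YoungDiagram.mem_iff_lt_rowLen.1 (show (c.1, c.2) ∈ μ from hcμ)
        simp only [cellDiag] at hc
        omega
      simp only [cellDiag] at hc
      refine ⟨⟨c.1 - (p.1 - L), by omega⟩, Prod.ext ?_ ?_⟩ <;> simp only [diagCell] <;> omega
    have hdiag' : ∀ t : Fin (L + 1), diagCell (p.1 - L) (p.2 - L) t ∈ μ := fun t =>
      μ.isLowerSet (a := p) ⟨by simp only [diagCell]; omega, by simp only [diagCell]; omega⟩ hp.1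
    have hc : CornerDiag b (p.1 - L) (p.2 - L) L :=
      { inj := fun i j hij => Subtype.ext (hinj hij)
        start := by omega
        off := fun j => by rw [hpp]; exact j.2
        below := fun x y hxy => by
          have h1 := colLen_bounds hp y
          constructor
          · rintro ⟨j, hj⟩
            have := YoungDiagram.mem_iff_lt_colLen.1 ((hr (x, y)).2 ⟨j, hj⟩)
            by_contra hlt
            have h2 := colLen_bounds hp y
            have h3 := rowLen_bounds hp x
            have h4 := YoungDiagram.mem_iff_lt_rowLen.1 ((hr (x, y)).2 ⟨j, hj⟩)
            omega
          · intro hx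
            obtain ⟨j, hj⟩ := (hr (x, y)).1 (YoungDiagram.mem_iff_lt_colLen.2 (by omega))
            exact ⟨⟨j, by rw [hj]; simp only [cellDiag]; omega⟩, hj⟩
        above := fun x y hxy => by
          have h1 := rowLen_bounds hp x
          constructor
          · rintro ⟨j, hj⟩
            by_contra hlt
            have h2 := colLen_bounds hp y
            have h4 := YoungDiagram.mem_iff_lt_colLen.1 ((hr (x, y)).2 ⟨j, hj⟩)
            omega
          · intro hx
            obtain ⟨j, hj⟩ := (hr (x, y)).1 (YoungDiagram.mem_iff_lt_rowLen.2 (by omega))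
            exact ⟨⟨j, by rw [hj]; simp only [cellDiag]; omega⟩, hj⟩ }
    have hdinj : ∀ n, Function.Injective (Sum.elim b (diagCell (p.1 - L) (p.2 - L) (n := n))) :=
      fun n => by
        refine hc.inj.sumElim (fun t t' htt => ?_) fun j t hjt => ?_
        · have := congrArg Prod.fst htt
          simp only [diagCell] at this
          exact Fin.ext (by omega)
        · refine hc.off j ?_
          rw [hjt]
          simp [cellDiag, diagCell]
    have e1 : rppSum q h box = rppSum q h
        (Sum.elim b (diagCell (p.1 - L) (p.2 - L) (n := L + 1))) := by
      refine rppSum_congr hinj (hdinj _) (Set.Subset.antisymm ?_ ?_)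
      · rintro _ ⟨i, rfl⟩
        by_cases hi : cellDiag (box i) = cellDiag p
        · obtain ⟨t, ht⟩ := hdiag _ hi ((hr _).2 ⟨i, rfl⟩)
          exact ⟨Sum.inr t, ht⟩
        · exact ⟨Sum.inl ⟨i, hi⟩, rfl⟩
      · rintro _ ⟨j | t, rfl⟩
        · exact ⟨j, rfl⟩
        · exact (hr _).1 (hdiag' t)
    have e2 : rppSum q h (Sum.elim b (diagCell (p.1 - L) (p.2 - L) (n := L))) =
        rppSum q h fun i : {i // i ≠ i₁} => box i := by
      refine rppSum_congr (hdinj _) (fun i j hij => Subtype.ext (hinj hij))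
        (Set.Subset.antisymm ?_ ?_)
      · rintro _ ⟨j | t, rfl⟩
        · exact ⟨⟨j, fun hj => j.2 (by rw [hj, hi₁])⟩, rfl⟩
        · obtain ⟨i, hi⟩ := (hr _).1 (hdiag' t.castSucc)
          refine ⟨⟨i, fun hi' => ?_⟩, hi⟩
          rw [hi', hi₁] at hi
          have := congrArg Prod.fst hi
          have ht := t.2
          simp only [diagCell, Fin.val_castSucc] at this
          omega
      · rintro _ ⟨i, rfl⟩
        by_cases hi : cellDiag (box i) = cellDiag p
        · obtain ⟨t, ht⟩ := hdiag _ hi ((hr _).2 ⟨i, rfl⟩)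
          refine ⟨Sum.inr ⟨t, lt_of_le_of_ne (Nat.lt_succ_iff.1 t.2) fun htL => ?_⟩, ht⟩
          refine i.2 (hinj ?_)
          rw [← ht, hi₁]
          refine Prod.ext ?_ ?_ <;> simp only [diagCell] <;> omega
        · exact ⟨Sum.inl ⟨i, hi⟩, rfl⟩
    have hmem : ∀ i : {i // i ≠ i₁}, box i ∈ μ ∧ box i ≠ p := fun i =>
      ⟨(hr _).2 ⟨i, rfl⟩, fun hi => i.2 (hinj (hi.trans hi₁.symm))⟩
    have e3 : ∀ m', rppSum q h (fun i : {i // i ≠ i₁} => box i) m' =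
        vecSum (fun i : {i // i ≠ i₁} => hookVec (μ.eraseMax p hp) (box i))
          (fun i => hookFactor q h (μ.eraseMax p hp) (box i)) m' := fun m' => by
      refine ih (μ.eraseMax p hp) (fun i j hij => Subtype.ext (hinj hij)) (fun c => ?_) m' ?_
      · rw [mem_eraseMax, hr]
        constructor
        · rintro ⟨h1, i, hi⟩
          exact ⟨⟨i, fun hi' => h1 (by rw [← hi, hi', hi₁])⟩, hi⟩
        · rintro ⟨i, rfl⟩
          exact ⟨(hmem i).2, i, rfl⟩
      · show (μ.cells.erase p).card = N
        rw [card_erase_of_mem hp.1, hn]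
        rfl
    have hR : m (cellDiag p) < (((m (cellDiag p)).toNat + 1 : ℕ) : ℤ) := by omega
    have hσ := vecSum_comp_equiv (Equiv.optionSubtypeNe i₁) (fun i => hookVec μ (box i))
      (fun i => hookFactor q h μ (box i)) m
    rw [e1, rppSum_corner H hc m (by rwa [hpp]), e2, ← hσ, vecSum_option
      (fun v => hookVec_nonneg _ _) (fun v => one_le_hookVec ((hr _).2 ⟨_, rfl⟩)) _ _
      (e := cellDiag p) (by simp [hi₁, hookVec_corner hp]) hR]
    refine sum_congr rfl fun k _ => ?_
    simp only [Equiv.optionSubtypeNe_none, Equiv.optionSubtypeNe_some, hpp, hi₁,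
      hookVec_corner hp]
    rw [vecSum_reflectAt hqh (fun i : {i // i ≠ i₁} => hookVec_eraseMax hp (hmem i).1 (hmem i).2)
      (f' := fun (i : {i // i ≠ i₁}) k => hookFactor q h (μ.eraseMax p hp) (box i) k),
      e3, ← mul_assoc]
    · congr 1
      · rw [hookFactor, rowLen_corner hp, mul_assoc, ← zpow_add₀ hqh]
        congr 2
        simp
        ring
      · refine congrArg _ ?_
        rw [reflectAt]
        funext e
        simp only [Function.update_apply, Pi.sub_apply, Pi.smul_apply, Pi.single_apply,
          smul_eq_mul, mul_ite, mul_one, mul_zero]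
        split_ifs <;> omega
    · intro i k
      rw [hookVec_sub hp (hmem i).1 (hmem i).2, hookFactor, hookFactor, mul_assoc,
        ← zpow_add₀ hqh]
      congr 2
      ring

end Shapes

section ValueAtZero

open Polynomial

variable {F : Type*} [Field F]

/-- The rational function `f` is regular at zero, with value `v`. -/
def HasValueAtZero (f : RatFunc F) (v : F) : Prop :=
  ∃ N D : F[X], D.eval 0 ≠ 0 ∧
    f = algebraMap F[X] (RatFunc F) N / algebraMap F[X] (RatFunc F) D ∧ v = N.eval 0 / D.eval 0

namespace HasValueAtZero

variable {f g : RatFunc F} {v w : F}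

lemma algebraMap_ne_zero {D : F[X]} (hD : D.eval 0 ≠ 0) :
    algebraMap F[X] (RatFunc F) D ≠ 0 := by
  refine (map_ne_zero_iff _ (IsFractionRing.injective F[X] (RatFunc F))).2 ?_
  rintro rfl
  simp at hD

lemma const (c : F) : HasValueAtZero (algebraMap F (RatFunc F) c) c :=
  ⟨C c, 1, by simp, by simp [RatFunc.algebraMap_eq_C], by simp⟩

lemma X : HasValueAtZero (RatFunc.X : RatFunc F) 0 :=
  ⟨Polynomial.X, 1, by simp, by simp [RatFunc.algebraMap_X], by simp⟩

lemma one : HasValueAtZero (1 : RatFunc F) 1 := ⟨1, 1, by simp, by simp, by simp⟩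

lemma sub (hf : HasValueAtZero f v) (hg : HasValueAtZero g w) :
    HasValueAtZero (f - g) (v - w) := by
  obtain ⟨N, D, h1, rfl, rfl⟩ := hf
  obtain ⟨N', D', h1', rfl, rfl⟩ := hg
  refine ⟨N * D' - D * N', D * D', by simp [h1, h1'], ?_, ?_⟩
  · rw [div_sub_div _ _ (algebraMap_ne_zero h1) (algebraMap_ne_zero h1')]
    simp
  · rw [div_sub_div _ _ h1 h1']
    simp

lemma add (hf : HasValueAtZero f v) (hg : HasValueAtZero g w) :
    HasValueAtZero (f + g) (v + w) := by
  obtain ⟨N, D, h1, rfl, rfl⟩ := hf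
  obtain ⟨N', D', h1', rfl, rfl⟩ := hg
  refine ⟨N * D' + D * N', D * D', by simp [h1, h1'], ?_, ?_⟩
  · rw [div_add_div _ _ (algebraMap_ne_zero h1) (algebraMap_ne_zero h1')]
    simp
  · rw [div_add_div _ _ h1 h1']
    simp

lemma mul (hf : HasValueAtZero f v) (hg : HasValueAtZero g w) :
    HasValueAtZero (f * g) (v * w) := by
  obtain ⟨N, D, h1, rfl, rfl⟩ := hf
  obtain ⟨N', D', h1', rfl, rfl⟩ := hg
  refine ⟨N * N', D * D', by simp [h1, h1'], ?_, ?_⟩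
  · rw [div_mul_div_comm]
    simp
  · rw [div_mul_div_comm]
    simp

lemma inv (hf : HasValueAtZero f v) (hv : v ≠ 0) : HasValueAtZero f⁻¹ v⁻¹ := by
  obtain ⟨N, D, h1, rfl, rfl⟩ := hf
  exact ⟨D, N, (div_ne_zero_iff.1 hv).1, by rw [inv_div], by rw [inv_div]⟩

lemma prod {ι : Type*} (s : Finset ι) {f : ι → RatFunc F} {v : ι → F}
    (h : ∀ i ∈ s, HasValueAtZero (f i) (v i)) : HasValueAtZero (∏ i ∈ s, f i) (∏ i ∈ s, v i) := by
  classical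
  induction s using Finset.induction_on with
  | empty => simpa using one
  | insert a s ha ih =>
    rw [Finset.prod_insert ha, Finset.prod_insert ha]
    exact (h a (Finset.mem_insert_self a s)).mul
      (ih fun i hi => h i (Finset.mem_insert_of_mem hi))

lemma sum {ι : Type*} (s : Finset ι) {f : ι → RatFunc F} {v : ι → F}
    (h : ∀ i ∈ s, HasValueAtZero (f i) (v i)) : HasValueAtZero (∑ i ∈ s, f i) (∑ i ∈ s, v i) := by
  classical
  induction s using Finset.induction_on with
  | empty => simpa using const (F := F) 0
  | insert a s ha ih =>
    rw [Finset.sum_insert ha, Finset.sum_insert ha]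
    exact (h a (Finset.mem_insert_self a s)).add
      (ih fun i hi => h i (Finset.mem_insert_of_mem hi))

lemma eval_eq (hf : HasValueAtZero f v) : RatFunc.eval (RingHom.id F) 0 f = v := by
  obtain ⟨N, D, h1, hf, rfl⟩ := hf
  have hD := algebraMap_ne_zero h1
  have hd := RatFunc.denom_ne_zero f
  have hmul : f.num * D = N * f.denom := by
    apply IsFractionRing.injective F[X] (RatFunc F)
    rw [map_mul, map_mul]
    have hd' : algebraMap F[X] (RatFunc F) f.denom ≠ 0 :=
      (map_ne_zero_iff _ (IsFractionRing.injective F[X] (RatFunc F))).2 hd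
    rw [← div_eq_div_iff hd' hD, RatFunc.num_div_denom, hf]
  have hev := congrArg (Polynomial.eval 0) hmul
  rw [eval_mul, eval_mul] at hev
  have hd0 : f.denom.eval 0 ≠ 0 := by
    intro h0
    rw [h0, mul_zero] at hev
    have hn0 := (mul_eq_zero.1 hev).resolve_right h1
    obtain ⟨u, w, huw⟩ := RatFunc.isCoprime_num_denom f
    have := congrArg (Polynomial.eval 0) huw
    simp [h0, hn0] at this
  rw [RatFunc.eval, eval₂_id, eval₂_id, div_eq_div_iff hd0 h1, hev]

end HasValueAtZero

lemma map_qPoch {F G : Type*} [Field F] [Field G] (φ : F →+* G) (q x : F) (m : ℤ) :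
    φ (qPoch q x m) = qPoch (φ q) (φ x) m := by
  unfold qPoch
  split_ifs <;> simp

/-- Termwise limits of ratios of Pochhammer symbols. -/
lemma hasValueAtZero_qPoch_div {q b c : RatFunc F} {v₀ : F} (hv₀ : v₀ ≠ 0)
    (h : ∀ j : ℤ, HasValueAtZero ((1 - b * q ^ j) / (1 - c * q ^ j)) v₀) (m : ℤ) :
    HasValueAtZero (qPoch q b m / qPoch q c m) (v₀ ^ m) := by
  rcases le_or_gt 0 m with hm | hm
  · rw [qPoch, qPoch, if_pos hm, if_pos hm, ← Finset.prod_div_distrib]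
    have := HasValueAtZero.prod (Finset.range m.toNat) fun j _ => h j
    rw [Finset.prod_const, Finset.card_range, ← zpow_natCast, Int.toNat_of_nonneg hm] at this
    simpa using this
  · rw [qPoch, qPoch, if_neg (by omega), if_neg (by omega), ← inv_div_inv, inv_inv, inv_inv,
      ← inv_div, ← Finset.prod_div_distrib]
    have := HasValueAtZero.prod (Finset.range (-m).toNat)
      (f := fun j => (1 - b * (q ^ (j + 1))⁻¹) / (1 - c * (q ^ (j + 1))⁻¹)) (v := fun _ => v₀)
      fun j _ => by simpa only [zpow_neg, zpow_natCast] using h (-(j + 1 : ℕ))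
    rw [Finset.prod_const, Finset.card_range, ← zpow_natCast,
      Int.toNat_of_nonneg (by omega)] at this
    have h2 := this.inv (zpow_ne_zero _ hv₀)
    rwa [zpow_neg, inv_inv] at h2

end ValueAtZero

section Fixed

open Finset

lemma s'E_ne : s'E ≠ 0 := RatFunc.X_ne_zero

lemma uE_ne : uE ≠ 0 :=
  (map_ne_zero_iff _ (algebraMap (RatFunc ℚ) Fus).injective).2 RatFunc.X_ne_zero

lemma qE_ne : qE ≠ 0 := pow_ne_zero _ uE_ne

lemma hE_ne : hE ≠ 0 := div_ne_zero qE_ne (pow_ne_zero _ s'E_ne)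

lemma sE_ne : sE ≠ 0 := div_ne_zero uE_ne s'E_ne

lemma sE_sq : sE ^ 2 = hE := by rw [sE, hE, h'E, qE, div_pow]

lemma qE_div_hE : qE / hE = s'E ^ 2 := by
  rw [hE, h'E, div_div_cancel₀ qE_ne]

/-- Powers of the variable are distinguished by their exponents. -/
lemma RatFunc.zpow_X_eq_C {F : Type*} [Field F] {k : ℤ} {c : F}
    (h : (RatFunc.X : RatFunc F) ^ k = RatFunc.C c) : k = 0 := by
  have key : ∀ (n : ℕ) (c : F), (RatFunc.X : RatFunc F) ^ n = RatFunc.C c →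
      n = 0 := fun n c hc => by
    have h1 : algebraMap (Polynomial F) (RatFunc F) (Polynomial.X ^ n) =
        algebraMap (Polynomial F) (RatFunc F) (Polynomial.C c) := by
      rw [map_pow, RatFunc.algebraMap_X, RatFunc.algebraMap_C, hc]
    have h2 := congrArg Polynomial.natDegree (IsFractionRing.injective _ _ h1)
    simpa using h2
  rcases Int.eq_nat_or_neg k with ⟨n, rfl | rfl⟩
  · rw [zpow_natCast] at h
    simpa using key n c h
  · rw [zpow_neg, zpow_natCast, inv_eq_iff_eq_inv, ← map_inv₀] at h
    simpa using key n _ h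

lemma qGeneric_qE_hE : QGeneric qE hE where
  q_ne := qE_ne
  h_ne := hE_ne
  indep := fun a b hab => by
    have hu := uE_ne
    have hs := s'E_ne
    have h1 : s'E ^ (2 * b) = algebraMap (RatFunc ℚ) Fus (RatFunc.X ^ (2 * a + 2 * b)) := by
      rw [map_zpow₀]
      change _ = uE ^ (2 * a + 2 * b)
      rw [hE, h'E, qE, ← zpow_natCast uE, ← zpow_natCast s'E, div_zpow, ← zpow_mul, ← zpow_mul,
        ← zpow_mul, ← mul_div_assoc, ← zpow_add₀ hu, div_eq_one_iff_eq (zpow_ne_zero _ hs)] at hab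
      simpa using hab.symm
    have hb := RatFunc.zpow_X_eq_C h1
    have hb0 : b = 0 := by omega
    subst hb0
    have h2 : (RatFunc.X : RatFunc ℚ) ^ (2 * a) = RatFunc.C 1 := by
      apply (algebraMap (RatFunc ℚ) Fus).injective
      rw [map_one, map_one]
      simpa using h1.symm
    have := RatFunc.zpow_X_eq_C h2
    omega

end Fixed

section Limits

open Finset

lemma hasValueAtZero_X_pow {F : Type*} [Field F] {n : ℕ} (hn : n ≠ 0) :
    HasValueAtZero (RatFunc.X ^ n : RatFunc F) 0 := by
  have h := HasValueAtZero.prod (F := F) (range n) (fun _ _ => HasValueAtZero.X)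
  simpa [prod_const, hn] using h

/-- The value at `X = 0` of the ratio of Pochhammer symbols with arguments `h c Xʷ` and
`q c Xʷ`. -/
noncomputable def phiValue {F : Type*} [Field F] (q h c : F) (w m : ℤ) : F :=
  if w = 0 then qPoch q (h * c) m / qPoch q (q * c) m
  else if w < 0 then (h / q) ^ m else 1

section Phi

variable {F : Type*} [Field F] {q h c : F}

lemma qPoch_div_map (q h c : F) (m : ℤ) :
    qPoch (algebraMap F (RatFunc F) q) (algebraMap F (RatFunc F) h * algebraMap F (RatFunc F) c) m /
        qPoch (algebraMap F (RatFunc F) q)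
          (algebraMap F (RatFunc F) q * algebraMap F (RatFunc F) c) m =
      algebraMap F (RatFunc F) (qPoch q (h * c) m / qPoch q (q * c) m) := by
  rw [map_div₀, map_qPoch, map_qPoch, map_mul, map_mul]

lemma hasValueAtZero_phi_of_ne (hq : q ≠ 0) (hh : h ≠ 0) (hc : c ≠ 0) {w : ℤ} (hw : w ≠ 0)
    (m : ℤ) :
    HasValueAtZero
      (qPoch (algebraMap F (RatFunc F) q)
        (algebraMap F (RatFunc F) h * (algebraMap F (RatFunc F) c * RatFunc.X ^ w)) m /
        qPoch (algebraMap F (RatFunc F) q)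
          (algebraMap F (RatFunc F) q * (algebraMap F (RatFunc F) c * RatFunc.X ^ w)) m)
      ((if w < 0 then h / q else 1) ^ m) := by
  have ha : (RatFunc.X : RatFunc F) ≠ 0 := RatFunc.X_ne_zero
  apply hasValueAtZero_qPoch_div
  · split_ifs
    · exact div_ne_zero hh hq
    · exact one_ne_zero
  intro j
  have hj : q ^ j ≠ 0 := zpow_ne_zero _ hq
  rw [← map_zpow₀]
  rcases lt_or_gt_of_ne hw with hw | hw
  · rw [if_pos hw]
    obtain ⟨k, rfl⟩ : ∃ k : ℕ, w = -k := ⟨w.natAbs, by omega⟩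
    have hX := hasValueAtZero_X_pow (F := F) (n := k) (by omega)
    have hval : h / q = (0 - h * c * q ^ j) * (0 - q * c * q ^ j)⁻¹ := by
      rw [zero_sub, zero_sub, inv_neg, neg_mul_neg, ← div_eq_mul_inv, mul_div_mul_right _ _ hj,
        mul_div_mul_right _ _ hc]
    rw [hval]
    have hnum := hX.sub (HasValueAtZero.const (h * c * q ^ j))
    have hden := (hX.sub (HasValueAtZero.const (q * c * q ^ j))).inv
      (by simp [hq, hc, hj])
    convert hnum.mul hden using 1
    have ha' : (RatFunc.X : RatFunc F) ^ k ≠ 0 := pow_ne_zero _ ha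
    have e : ∀ y : F,
        1 - algebraMap F (RatFunc F) y * (algebraMap F (RatFunc F) c / RatFunc.X ^ k) *
          algebraMap F (RatFunc F) (q ^ j) =
        (RatFunc.X ^ k)⁻¹ * (RatFunc.X ^ k - algebraMap F (RatFunc F) (y * c * q ^ j)) :=
          fun y => by
      rw [mul_sub, inv_mul_cancel₀ ha', map_mul, map_mul]
      ring
    rw [zpow_neg, zpow_natCast, ← div_eq_mul_inv, ← div_eq_mul_inv, e, e,
      mul_div_mul_left _ _ (inv_ne_zero ha')]
  · rw [if_neg (by omega)]
    obtain ⟨k, rfl⟩ : ∃ k : ℕ, w = k := ⟨w.natAbs, by omega⟩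
    have hX := hasValueAtZero_X_pow (F := F) (n := k) (by omega)
    have key : ∀ y : F, HasValueAtZero (1 - algebraMap F (RatFunc F) y *
        (algebraMap F (RatFunc F) c * RatFunc.X ^ (k : ℤ)) * algebraMap F (RatFunc F) (q ^ j)) 1 :=
      fun y => by
        have := HasValueAtZero.one.sub ((HasValueAtZero.const (y * c * q ^ j)).mul hX)
        rw [mul_zero, sub_zero] at this
        convert this using 1
        rw [map_mul, map_mul, zpow_natCast]
        ring
    have := (key h).mul ((key q).inv one_ne_zero)
    rwa [inv_one, one_mul, ← div_eq_mul_inv] at this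

lemma hasValueAtZero_phi (hq : q ≠ 0) (hh : h ≠ 0) (hc : c ≠ 0) (w m : ℤ) :
    HasValueAtZero
      (qPoch (algebraMap F (RatFunc F) q)
        (algebraMap F (RatFunc F) h * (algebraMap F (RatFunc F) c * RatFunc.X ^ w)) m /
        qPoch (algebraMap F (RatFunc F) q)
          (algebraMap F (RatFunc F) q * (algebraMap F (RatFunc F) c * RatFunc.X ^ w)) m)
      (phiValue q h c w m) := by
  rw [phiValue]
  by_cases hw : w = 0
  · subst hw
    rw [zpow_zero, mul_one, qPoch_div_map, if_pos rfl]
    exact HasValueAtZero.const _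
  · rw [if_neg hw]
    convert hasValueAtZero_phi_of_ne hq hh hc hw m using 1
    split_ifs <;> simp

lemma hasValueAtZero_phi_inv (hq : q ≠ 0) (hh : h ≠ 0) (hc : c ≠ 0) (w m : ℤ) :
    HasValueAtZero
      (qPoch (algebraMap F (RatFunc F) q)
        (algebraMap F (RatFunc F) q * (algebraMap F (RatFunc F) c * RatFunc.X ^ w)) m /
        qPoch (algebraMap F (RatFunc F) q)
          (algebraMap F (RatFunc F) h * (algebraMap F (RatFunc F) c * RatFunc.X ^ w)) m)
      (phiValue q h c w m)⁻¹ := by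
  rw [← inv_div]
  by_cases hw : w = 0
  · subst hw
    rw [zpow_zero, mul_one, qPoch_div_map, ← map_inv₀, phiValue, if_pos rfl]
    exact HasValueAtZero.const _
  · refine (hasValueAtZero_phi hq hh hc w m).inv ?_
    rw [phiValue, if_neg hw]
    split_ifs
    · exact zpow_ne_zero _ (div_ne_zero hh hq)
    · exact one_ne_zero

end Phi

/-- A box shifted to zero-based coordinates. -/
def shiftBox (b : ℕ × ℕ) : ℕ × ℕ := (b.1 - 1, b.2 - 1)

/-- The power of `s` in the framing weight of a box. -/
noncomputable def boxScalar (b : ℕ × ℕ) : Fus := sE ^ ((b.1 : ℤ) + b.2 - 2)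

lemma boxScalar_ne (b : ℕ × ℕ) : boxScalar b ≠ 0 := zpow_ne_zero _ sE_ne

lemma mul_inv_zpow_mul {K : Type*} [Field K] {a s : K} (ha : a ≠ 0) (hs : s ≠ 0) (m n : ℤ) :
    (a * s⁻¹) ^ m * (a⁻¹ * s⁻¹) ^ n = s ^ (-m - n) * a ^ (m - n) := by
  rw [mul_zpow, mul_zpow, inv_zpow', inv_zpow', inv_zpow', mul_mul_mul_comm, ← zpow_add₀ ha,
    ← zpow_add₀ hs, mul_comm]
  congr 2

lemma mul_zpow_div_mul_zpow {K : Type*} [Field K] {a : K} (ha : a ≠ 0) (c c' : K) (m n : ℤ) :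
    c * a ^ m / (c' * a ^ n) = c / c' * a ^ (m - n) := by
  rw [mul_div_mul_comm, zpow_sub₀ ha]

lemma mul_mul_zpow_eq {K : Type*} [Field K] {a : K} (ha : a ≠ 0) (c s : K) (m : ℤ) :
    a * s * (c * a ^ m) = s * c * a ^ (1 + m) := by
  rw [zpow_one_add₀ ha]
  ring

lemma xA_eq {n : ℕ} (box : Fin n → ℕ × ℕ) (i : Fin n) :
    xA box i = algebraMap Fus FusA (boxScalar (box i)) *
      aA ^ (((box i).1 : ℤ) - (box i).2) := by
  have ha : aA ≠ 0 := RatFunc.X_ne_zero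
  have hs : sA ≠ 0 := (map_ne_zero_iff _ (algebraMap Fus FusA).injective).2 sE_ne
  rw [boxScalar, map_zpow₀]
  change _ = sA ^ _ * _
  refine (mul_inv_zpow_mul (K := FusA) ha hs _ _).trans ?_
  congr 2 <;> ring

lemma sE_zpow_two_mul (k : ℤ) : sE ^ (2 * k) = hE ^ k := by
  rw [zpow_mul, ← sE_sq]
  rfl

lemma phiValue_boxScalar {b : ℕ × ℕ} (h1 : 1 ≤ b.1) (h2 : 1 ≤ b.2) (m : ℤ) :
    phiValue qE hE (boxScalar b) ((b.1 : ℤ) - b.2) m = boxWeight qE hE (shiftBox b) m := by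
  have hd : cellDiag (shiftBox b) = (b.1 : ℤ) - b.2 := by
    simp only [cellDiag, shiftBox]
    omega
  rw [phiValue, boxWeight, hd]
  split_ifs with h
  · rw [qPhi, boxScalar, show (b.1 : ℤ) + b.2 - 2 = 2 * ((shiftBox b).1 : ℤ) by
      simp only [shiftBox]; omega, sE_zpow_two_mul]
  · rfl
  · rfl

lemma phiValue_pair {b b' : ℕ × ℕ} (h1 : 1 ≤ b.1) (h2 : 1 ≤ b.2) (h1' : 1 ≤ b'.1)
    (h2' : 1 ≤ b'.2) (m : ℤ) :
    phiValue qE hE (sE⁻¹ * boxScalar b / boxScalar b')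
      (1 + ((b.1 : ℤ) - b.2) - ((b'.1 : ℤ) - b'.2)) m *
      (phiValue qE hE (boxScalar b / boxScalar b') (((b.1 : ℤ) - b.2) - ((b'.1 : ℤ) - b'.2)) m)⁻¹ =
      pairWeight qE hE (shiftBox b) (shiftBox b') m := by
  have hs := sE_ne
  have hd : ∀ {b : ℕ × ℕ}, 1 ≤ b.1 → 1 ≤ b.2 → cellDiag (shiftBox b) = (b.1 : ℤ) - b.2 :=
    fun h1 h2 => by
      simp only [cellDiag, shiftBox]
      omega
  have hr : ((shiftBox b).1 : ℤ) - (shiftBox b').1 = (b.1 : ℤ) - b'.1 := by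
    simp only [shiftBox]
    omega
  have hsc : boxScalar b / boxScalar b' = sE ^ (((b.1 : ℤ) + b.2) - (b'.1 + b'.2)) := by
    rw [boxScalar, boxScalar, ← zpow_sub₀ hs]
    congr 1
    ring
  have hsc' : sE⁻¹ * boxScalar b / boxScalar b' =
      sE ^ (((b.1 : ℤ) + b.2) - (b'.1 + b'.2) - 1) := by
    rw [mul_div_assoc, hsc, zpow_sub_one₀ hs, mul_comm]
  have hqh : hE / qE ≠ 0 := div_ne_zero hE_ne qE_ne
  rw [hsc, hsc', pairWeight, hd h1 h2, hd h1' h2', hr, phiValue, phiValue]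
  rcases lt_trichotomy ((b'.1 : ℤ) - b'.2) ((b.1 : ℤ) - b.2) with hlt | heq | hgt
  · rw [if_neg (by omega), if_neg (by omega), if_neg (by omega), if_neg (by omega),
      if_neg (by omega), if_neg (by omega)]
    simp
  · rw [if_neg (by omega), if_neg (by omega), if_pos (by omega), if_neg (by omega),
      if_pos (by omega), one_mul, qPhi,
      show ((b.1 : ℤ) + b.2) - (b'.1 + b'.2) = 2 * ((b.1 : ℤ) - b'.1) by omega, sE_zpow_two_mul]
  · by_cases h : (b'.1 : ℤ) - b'.2 = (b.1 : ℤ) - b.2 + 1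
    · rw [if_pos (by omega), if_neg (by omega), if_pos (by omega), if_pos h, qPhi,
        show ((b.1 : ℤ) + b.2) - (b'.1 + b'.2) - 1 = 2 * ((b.1 : ℤ) - b'.1) by omega,
        sE_zpow_two_mul, ← inv_zpow, inv_div]
    · rw [if_neg (by omega), if_pos (by omega), if_neg (by omega), if_pos (by omega),
        if_neg h, if_neg (by omega), mul_inv_cancel₀ (zpow_ne_zero _ hqh)]

lemma hasValueAtZero_cCoeff {n : ℕ} {box : Fin n → ℕ × ℕ} (h1 : ∀ i, 1 ≤ (box i).1)
    (h2 : ∀ i, 1 ≤ (box i).2) (d : Fin n → ℕ) :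
    HasValueAtZero (cCoeff box d) (rppWeight qE hE (fun i => shiftBox (box i)) d) := by
  have ha : aA ≠ 0 := RatFunc.X_ne_zero
  refine (HasValueAtZero.prod _ fun i _ => ?_).mul
    (HasValueAtZero.prod _ fun i _ => HasValueAtZero.prod _ fun j _ => ?_)
  · rw [xA_eq, ← phiValue_boxScalar (h1 i) (h2 i)]
    exact hasValueAtZero_phi qE_ne hE_ne (boxScalar_ne _) _ _
  · rw [← phiValue_pair (h1 i) (h2 i) (h1 j) (h2 j)]
    have e1 : xA box i / xA box j = algebraMap Fus FusA (boxScalar (box i) / boxScalar (box j)) *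
        aA ^ (((box i).1 : ℤ) - (box i).2 - (((box j).1 : ℤ) - (box j).2)) := by
      rw [xA_eq, xA_eq, map_div₀]
      exact mul_zpow_div_mul_zpow ha _ _ _ _
    have e2 : t1A * (xA box i / xA box j) =
        algebraMap Fus FusA (sE⁻¹ * boxScalar (box i) / boxScalar (box j)) *
        aA ^ (1 + ((box i).1 - (box i).2 : ℤ) - (((box j).1 : ℤ) - (box j).2)) := by
      rw [e1, mul_div_assoc, map_mul, map_inv₀, add_sub_assoc]
      exact mul_mul_zpow_eq (K := FusA) ha _ _ _
    have e3 : ∀ y : FusA, y * t1A * xA box i / xA box j = y * (t1A * (xA box i / xA box j)) :=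
      fun y => by ring
    rw [e3, e3, mul_div_assoc qA (xA box i), mul_div_assoc hA (xA box i), e2, e1]
    exact (hasValueAtZero_phi qE_ne hE_ne
      (div_ne_zero (mul_ne_zero (inv_ne_zero sE_ne) (boxScalar_ne _))
      (boxScalar_ne _)) _ _).mul
      (hasValueAtZero_phi_inv qE_ne hE_ne (div_ne_zero (boxScalar_ne _) (boxScalar_ne _)) _ _)

lemma Lcoeff_eq {n : ℕ} {box : Fin n → ℕ × ℕ} (h1 : ∀ i, 1 ≤ (box i).1)
    (h2 : ∀ i, 1 ≤ (box i).2) (D : ℕ) :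
    Lcoeff box D = ∑ d ∈ Finset.Nat.antidiagonalTuple n D,
      rppWeight qE hE (fun i => shiftBox (box i)) d :=
  (HasValueAtZero.sum _ fun d _ => hasValueAtZero_cCoeff h1 h2 d).eval_eq

end Limits

section Totals

open Finset

lemma sum_eq_sum_finsum_fiber {α β K : Type*} [AddCommMonoid K] [DecidableEq β] (g : α → β)
    {A : Finset α} {M : Finset β} (hM : ∀ d ∈ A, g d ∈ M) (hA : ∀ d, g d ∈ M → d ∈ A)
    (w : α → K) : ∑ d ∈ A, w d = ∑ m ∈ M, ∑ᶠ d, if g d = m then w d else 0 := by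
  rw [← sum_fiberwise_of_maps_to hM]
  refine sum_congr rfl fun m hm => ?_
  rw [sum_filter, finsum_eq_sum_of_support_subset]
  intro d hd
  rw [Function.mem_support] at hd
  exact hA d (by rw [(ite_ne_right_iff.1 hd).1]; exact hm)

/-- Labellings whose weighted total is `D`. -/
def weightedTuples {ι : Type*} [Fintype ι] [DecidableEq ι] (h : ι → ℕ) (D : ℕ) :
    Finset (ι → ℕ) :=
  (Fintype.piFinset fun _ => range (D + 1)).filter fun k => ∑ v, h v * k v = D

lemma mem_weightedTuples {ι : Type*} [Fintype ι] [DecidableEq ι] {h : ι → ℕ} (hpos : ∀ v, 0 < h v)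
    {D : ℕ} {k : ι → ℕ} : k ∈ weightedTuples h D ↔ ∑ v, h v * k v = D := by
  rw [weightedTuples, mem_filter, and_iff_right_iff_imp, Fintype.mem_piFinset]
  intro hk v
  rw [mem_range, Nat.lt_succ_iff, ← hk]
  exact (Nat.le_mul_of_pos_left _ (hpos v)).trans
    (single_le_sum (f := fun v => h v * k v) (fun _ _ => Nat.zero_le _) (mem_univ v))

lemma coeff_prod_mk_dvd {ι R : Type*} [Fintype ι] [DecidableEq ι] [CommRing R] {h : ι → ℕ}
    (hpos : ∀ v, 0 < h v) (g : ι → ℕ → R) (D : ℕ) :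
    PowerSeries.coeff D (∏ v, PowerSeries.mk fun N => if h v ∣ N then g v (N / h v) else 0) =
      ∑ k ∈ weightedTuples h D, ∏ v, g v (k v) := by
  rw [PowerSeries.coeff_prod]
  symm
  refine sum_of_injOn (fun k => Finsupp.equivFunOnFinite.symm fun v => h v * k v) ?_ ?_ ?_ ?_
  · intro k _ k' _ hkk
    funext v
    have := DFunLike.congr_fun hkk v
    exact Nat.eq_of_mul_eq_mul_left (hpos v) (by simpa using this)
  · intro k hk
    rw [mem_coe, mem_weightedTuples hpos] at hk
    simpa [mem_finsuppAntidiag] using hk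
  · intro l hl hl'
    by_contra hne
    have hdvd : ∀ v, h v ∣ l v := fun v => by
      by_contra hv
      exact hne (prod_eq_zero (mem_univ v) (by simp [hv]))
    refine hl' ⟨fun v => l v / h v, ?_, ?_⟩
    · rw [mem_coe, mem_weightedTuples hpos, sum_congr rfl fun v _ => Nat.mul_div_cancel' (hdvd v)]
      exact (mem_finsuppAntidiag.1 hl).1
    · ext v
      simp [Nat.mul_div_cancel' (hdvd v)]
  · intro k _
    refine prod_congr rfl fun v _ => ?_
    simp [Nat.mul_div_cancel_left _ (hpos v)]

lemma sum_diagSum {ι : Type*} [Fintype ι] {box : ι → ℕ × ℕ} {S : Finset ℤ}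
    (hS : ∀ i, cellDiag (box i) ∈ S) (d : ι → ℕ) :
    ∑ e ∈ S, diagSum box d e = ∑ i, (d i : ℤ) := by
  simp only [diagSum]
  rw [sum_comm]
  exact sum_congr rfl fun i _ => by rw [sum_ite_eq, if_pos (hS i)]

lemma sum_hookVec {μ : YoungDiagram} {v : ℕ × ℕ} (hv : v ∈ μ) {S : Finset ℤ}
    (hS : Icc ((v.1 : ℤ) - μ.rowLen v.1 + 1) (μ.colLen v.2 - 1 - v.2) ⊆ S) :
    ∑ e ∈ S, hookVec μ v e =
      ((μ.rowLen v.1 - v.2 - 1 + (μ.colLen v.2 - v.1 - 1) + 1 : ℕ) : ℤ) := by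
  have h1 := YoungDiagram.mem_iff_lt_rowLen.1 hv
  have h2 := YoungDiagram.mem_iff_lt_colLen.1 hv
  simp only [hookVec, ← mem_Icc]
  rw [sum_ite_mem, inter_eq_right.2 hS, sum_const, Int.card_Icc, nsmul_eq_mul, mul_one]
  omega

/-- The sum of the weights of all labellings of given size. -/
lemma sum_rppWeight {K : Type*} [Field K] {q h : K} (H : QGeneric q h) (μ : YoungDiagram) {n : ℕ}
    {box : Fin n → ℕ × ℕ} (hinj : Function.Injective box) (hr : ∀ c, c ∈ μ ↔ ∃ i, box i = c)
    {hook : Fin n → ℕ} (hhook : ∀ i, hook i = μ.rowLen (box i).1 - (box i).2 - 1 +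
      (μ.colLen (box i).2 - (box i).1 - 1) + 1) (D : ℕ) :
    ∑ d ∈ Finset.Nat.antidiagonalTuple n D, rppWeight q h box d =
      ∑ k ∈ weightedTuples hook D, ∏ i, hookFactor q h μ (box i) (k i) := by
  classical
  have hpos : ∀ i, 0 < hook i := fun i => by rw [hhook]; omega
  have hmem : ∀ i, box i ∈ μ := fun i => (hr _).2 ⟨i, rfl⟩
  obtain ⟨S, hS1, hS2⟩ : ∃ S : Finset ℤ, (∀ i, cellDiag (box i) ∈ S) ∧
      ∀ i, Icc (((box i).1 : ℤ) - μ.rowLen (box i).1 + 1)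
        (μ.colLen (box i).2 - 1 - (box i).2) ⊆ S :=
    ⟨univ.biUnion fun i => insert (cellDiag (box i))
      (Icc (((box i).1 : ℤ) - μ.rowLen (box i).1 + 1) (μ.colLen (box i).2 - 1 - (box i).2)),
      fun i => mem_biUnion.2 ⟨i, mem_univ i, mem_insert_self _ _⟩,
      fun i e he => mem_biUnion.2 ⟨i, mem_univ i, mem_insert_of_mem he⟩⟩
  have hS3 : ∀ i, ∑ e ∈ S, hookVec μ (box i) e = hook i := fun i => by
    rw [hhook, sum_hookVec (hmem i) (hS2 i)]
  let g : (Fin n → ℕ) → ℤ → ℤ := diagSum box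
  let g' : (Fin n → ℕ) → ℤ → ℤ := fun k => ∑ v, (k v : ℤ) • hookVec μ (box v)
  have hg : ∀ d, ∑ e ∈ S, g d e = ((∑ i, d i : ℕ) : ℤ) := fun d => by
    rw [Nat.cast_sum]
    exact sum_diagSum hS1 d
  have hg' : ∀ k, ∑ e ∈ S, g' k e = ((∑ v, hook v * k v : ℕ) : ℤ) := fun k => by
    simp only [g', Finset.sum_apply, Pi.smul_apply, smul_eq_mul]
    rw [sum_comm, Nat.cast_sum]
    refine sum_congr rfl fun v _ => ?_
    rw [← mul_sum, hS3, Nat.cast_mul, mul_comm]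
  let M := (Finset.Nat.antidiagonalTuple n D).image g ∪ (weightedTuples hook D).image g'
  have hM : ∀ m ∈ M, ∑ e ∈ S, m e = D := fun m hm => by
    rcases mem_union.1 hm with hm | hm <;> obtain ⟨d, hd, rfl⟩ := mem_image.1 hm
    · rw [hg, Finset.Nat.mem_antidiagonalTuple.1 hd]
    · rw [hg', (mem_weightedTuples hpos).1 hd]
  rw [sum_eq_sum_finsum_fiber g (M := M)
      (fun d hd => mem_union_left _ (mem_image_of_mem g hd))
      (fun d hd => Finset.Nat.mem_antidiagonalTuple.2
        (by exact_mod_cast (hg d).symm.trans (hM _ hd))),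
    sum_eq_sum_finsum_fiber g' (M := M)
      (fun d hd => mem_union_right _ (mem_image_of_mem g' hd))
      (fun d hd => (mem_weightedTuples hpos).2 (by exact_mod_cast (hg' d).symm.trans (hM _ hd)))]
  refine sum_congr rfl fun m _ => ?_
  have := rppSum_eq_vecSum H μ hinj hr m
  rw [rppSum, vecSum] at this
  convert this

end Totals

section Partitions

open Finset

variable {n : ℕ} {lam : ℕ → ℕ} {box : Fin n → ℕ × ℕ}

/-- The Young diagram of a partition. -/
def partitionDiagram (hlam : Antitone lam)
    (hrange : Set.range box = {p : ℕ × ℕ | 1 ≤ p.1 ∧ 1 ≤ p.2 ∧ p.2 ≤ lam p.1}) :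
    YoungDiagram where
  cells := univ.image fun i => shiftBox (box i)
  isLowerSet := by
    intro a b hba ha
    rw [mem_coe, mem_image] at ha ⊢
    obtain ⟨i, -, rfl⟩ := ha
    have hi : box i ∈ Set.range box := ⟨i, rfl⟩
    rw [hrange] at hi
    obtain ⟨h1, h2, h3⟩ := hi
    have hb : (b.1 + 1, b.2 + 1) ∈ Set.range box := by
      rw [hrange]
      obtain ⟨hb1, hb2⟩ := hba
      simp only [shiftBox] at hb1 hb2
      have := hlam (show b.1 + 1 ≤ (box i).1 by omega)
      refine ⟨?_, ?_, ?_⟩ <;> simp only <;> omega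
    obtain ⟨j, hj⟩ := hb
    exact ⟨j, mem_univ j, by rw [hj]; simp [shiftBox]⟩

lemma box_mem
    (hrange : Set.range box = {p : ℕ × ℕ | 1 ≤ p.1 ∧ 1 ≤ p.2 ∧ p.2 ≤ lam p.1}) (i : Fin n) :
    1 ≤ (box i).1 ∧ 1 ≤ (box i).2 ∧ (box i).2 ≤ lam (box i).1 := by
  have hi : box i ∈ Set.range box := ⟨i, rfl⟩
  rwa [hrange] at hi

variable (hlam : Antitone lam)
  (hrange : Set.range box = {p : ℕ × ℕ | 1 ≤ p.1 ∧ 1 ≤ p.2 ∧ p.2 ≤ lam p.1})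

lemma mem_partitionDiagram {c : ℕ × ℕ} :
    c ∈ partitionDiagram hlam hrange ↔ ∃ i, shiftBox (box i) = c := by
  rw [← YoungDiagram.mem_cells]
  simp [partitionDiagram]

lemma mem_partitionDiagram_iff {i j : ℕ} :
    (i, j) ∈ partitionDiagram hlam hrange ↔ j < lam (i + 1) := by
  rw [mem_partitionDiagram]
  constructor
  · rintro ⟨k, hk⟩
    obtain ⟨h1, h2, h3⟩ := box_mem hrange k
    simp only [shiftBox, Prod.mk.injEq] at hk
    rw [← hk.1, Nat.sub_add_cancel h1]
    omega
  · intro h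
    have : (i + 1, j + 1) ∈ Set.range box := by
      rw [hrange]
      exact ⟨by simp, by simp, h⟩
    obtain ⟨k, hk⟩ := this
    exact ⟨k, by rw [hk]; simp [shiftBox]⟩

lemma rowLen_partitionDiagram (i : ℕ) : (partitionDiagram hlam hrange).rowLen i = lam (i + 1) :=
  eq_of_forall_lt_iff fun j => by
    rw [← YoungDiagram.mem_iff_lt_rowLen, mem_partitionDiagram_iff]

lemma colLen_partitionDiagram (j : ℕ) :
    (partitionDiagram hlam hrange).colLen j = ((Icc 1 n).filter fun r => j + 1 ≤ lam r).card := by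
  set μ := partitionDiagram hlam hrange with hμ
  have hle : μ.colLen j ≤ n := by
    rw [YoungDiagram.colLen_eq_card]
    refine (card_le_card (filter_subset _ _)).trans (card_image_le.trans ?_)
    simp
  have : ((Icc 1 n).filter fun r => j + 1 ≤ lam r) = Icc 1 (μ.colLen j) := by
    ext r
    rw [mem_filter, mem_Icc, mem_Icc]
    rcases r with _ | r
    · simp
    · have h := mem_partitionDiagram_iff hlam hrange (i := r) (j := j)
      rw [YoungDiagram.mem_iff_lt_colLen, ← hμ] at h
      omega
  rw [this, Nat.card_Icc, Nat.add_sub_cancel]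

lemma legL_eq (i : Fin n) : legL lam (box i) =
    (partitionDiagram hlam hrange).rowLen (shiftBox (box i)).1 - (shiftBox (box i)).2 - 1 := by
  obtain ⟨h1, h2, h3⟩ := box_mem hrange i
  rw [rowLen_partitionDiagram, legL]
  simp only [shiftBox]
  rw [Nat.sub_add_cancel h1]
  omega

lemma armL_eq (i : Fin n) : armL n lam (box i) =
    (partitionDiagram hlam hrange).colLen (shiftBox (box i)).2 - (shiftBox (box i)).1 - 1 := by
  obtain ⟨h1, h2, h3⟩ := box_mem hrange i
  have h : (shiftBox (box i)).2 + 1 = (box i).2 := Nat.sub_add_cancel h2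
  simp only [colLen_partitionDiagram, armL, h]
  simp only [shiftBox]
  omega

end Partitions

section Factors

lemma hookFactor_qE_hE (μ : YoungDiagram) {v : ℕ × ℕ} (hv : v ∈ μ) {l a : ℕ}
    (hl : l = μ.rowLen v.1 - v.2 - 1) (k : ℕ) :
    s'E ^ ((l + a + 1) * k) * hookFactor qE hE μ v k =
      qPoch qE (qE / h'E) k / qPoch qE qE k * s'E ^ (((a : ℤ) + 1 - l) * k) := by
  have hs := s'E_ne
  have h1 := YoungDiagram.mem_iff_lt_rowLen.1 hv
  have hl' : (μ.rowLen v.1 : ℤ) - v.2 - 1 = l := by omega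
  rw [hookFactor, qE_div_hE, hl', qPhi, zpow_zero, mul_one, mul_one, mul_left_comm,
    ← zpow_natCast s'E, ← zpow_natCast s'E 2, ← zpow_mul, ← zpow_add₀ hs]
  congr 2
  push_cast
  ring

end Factors
/-- Conjecture 1 of the paper for the Hilbert scheme of `n` points in `ℂ²` (self-dual
under 3d mirror symmetry): in `F'[[a']]`,
`∑_D L_D (a' s')^D = ∏_{□ ∈ λ} ∑_m ((q/ħ';q)_m/(q;q)_m) (a'^{l(□)+a(□)+1} s'^{a(□)+1-l(□)})^m`,
where the `□`-th factor is encoded as the power series whose coefficient of `a'^N` is the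
`m`-th term with `m = N/(l(□)+a(□)+1)` when `(l(□)+a(□)+1) ∣ N`, and `0` otherwise. -/
theorem conjecture1_hilbert_scheme (n : ℕ) (hn : 1 ≤ n)
    (lam : ℕ → ℕ) (hlam : Antitone lam)
    (box : Fin n → ℕ × ℕ) (hinj : Function.Injective box)
    (hrange : Set.range box = {p : ℕ × ℕ | 1 ≤ p.1 ∧ 1 ≤ p.2 ∧ p.2 ≤ lam p.1}) :
    PowerSeries.mk (fun D : ℕ => Lcoeff box D * s'E ^ D) =
      ∏ i : Fin n, PowerSeries.mk (fun N : ℕ =>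
        if (legL lam (box i) + armL n lam (box i) + 1) ∣ N then
          (qPoch qE (qE / h'E) ((N / (legL lam (box i) + armL n lam (box i) + 1) : ℕ) : ℤ) /
            qPoch qE qE ((N / (legL lam (box i) + armL n lam (box i) + 1) : ℕ) : ℤ)) *
          s'E ^ ((((armL n lam (box i) : ℤ) + 1) - (legL lam (box i) : ℤ)) *
            ((N / (legL lam (box i) + armL n lam (box i) + 1) : ℕ) : ℤ))
        else 0) := by

  have hbox := box_mem hrange
  have hshift : Function.Injective fun i => shiftBox (box i) := fun i j hij => by
    simp only [shiftBox, Prod.mk.injEq] at hij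
    obtain ⟨h1, h2, -⟩ := hbox i
    obtain ⟨h1', h2', -⟩ := hbox j
    exact hinj (Prod.ext (by omega) (by omega))
  have hmem := fun c => mem_partitionDiagram (c := c) hlam hrange
  ext D
  rw [PowerSeries.coeff_mk, coeff_prod_mk_dvd (h := fun i => legL lam (box i) +
      armL n lam (box i) + 1) (fun _ => Nat.succ_pos _) (fun i k =>
        qPoch qE (qE / h'E) k / qPoch qE qE k *
          s'E ^ (((armL n lam (box i) : ℤ) + 1 - legL lam (box i)) * k)),
    Lcoeff_eq (fun i => (hbox i).1) (fun i => (hbox i).2.1),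
    sum_rppWeight qGeneric_qE_hE (partitionDiagram hlam hrange) hshift hmem
      (hook := fun i => legL lam (box i) + armL n lam (box i) + 1)
      (fun i => by rw [legL_eq hlam hrange, armL_eq hlam hrange]), Finset.sum_mul]
  refine Finset.sum_congr rfl fun k hk => ?_
  rw [mem_weightedTuples fun _ => Nat.succ_pos _] at hk
  rw [← hk, ← Finset.prod_pow_eq_pow_sum, mul_comm, ← Finset.prod_mul_distrib]
  exact Finset.prod_congr rfl fun i _ =>
    hookFactor_qE_hE _ ((hmem _).2 ⟨i, rfl⟩) (legL_eq hlam hrange i) (k i)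
end
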